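/- arXiv:1802.08574 — 10 statements merged into one kernel-verified Lean document; each statement's English description precedes it below -/
import Mathlib

section
/- For a metric space X the following are equivalent: (i) X has strong measure zero; (ii) for every gauge h the h-dimensional Hausdorff measure of X is zero; (iii) for every metric space Y and every uniformly continuous map f : X → Y, the Hausdorff dimension of f(X) is zero. -/
open MeasureTheory Set Filter Pointwise
open scoped ENNReal NNReal Topology

/-- A gauge: a nondecreasing, right-continuous function `h : [0,∞) → [0,∞]` with `h 0 = 0`
and `h r > 0` for `r > 0`. -/
def IsGauge (h : ℝ≥0∞ → ℝ≥0∞) : Prop :=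
  Monotone h ∧ (∀ r : ℝ≥0∞, Filter.Tendsto h (nhdsWithin r (Set.Ioi r)) (nhds (h r))) ∧
    h 0 = 0 ∧ ∀ r : ℝ≥0∞, 0 < r → 0 < h r

/-- `X` has strong measure zero: for every sequence of positive reals `ε n` there is a
countable cover `U n` of `X` with `diam (U n) ≤ ε n` for all `n`. -/
def HasSMZ (X : Type*) [MetricSpace X] : Prop :=
  ∀ ε : ℕ → ℝ, (∀ n, 0 < ε n) →
    ∃ U : ℕ → Set X, (∀ x : X, ∃ n, x ∈ U n) ∧
      ∀ n, EMetric.diam (U n) ≤ ENNReal.ofReal (ε n)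

/-- `⟨U n⟩` is a γ-groupable cover of `E`: there is a strictly increasing sequence
`0 = k 0 < k 1 < ⋯` such that every `x ∈ E` belongs to `⋃_{k j ≤ n < k (j+1)} U n`
for all but finitely many `j`. -/
def IsGammaGroupable {X : Type*} (U : ℕ → Set X) (E : Set X) : Prop :=
  ∃ k : ℕ → ℕ, k 0 = 0 ∧ StrictMono k ∧
    ∀ x ∈ E, ∀ᶠ j in Filter.atTop, ∃ n, k j ≤ n ∧ n < k (j + 1) ∧ x ∈ U n

/-- A set `E` in a metric space has sharp measure zero: for every sequence of positive reals
`ε n` it admits a γ-groupable cover `U n` with `diam (U n) ≤ ε n` for all `n`. -/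
def IsSSMZ {X : Type*} [MetricSpace X] (E : Set X) : Prop :=
  ∀ ε : ℕ → ℝ, (∀ n, 0 < ε n) →
    ∃ U : ℕ → Set X, IsGammaGroupable U E ∧
      ∀ n, EMetric.diam (U n) ≤ ENNReal.ofReal (ε n)

/-- A metric space has sharp measure zero. -/
def HasSSMZ (X : Type*) [MetricSpace X] : Prop := IsSSMZ (Set.univ : Set X)

universe u

section Ranking

/-- A sequence in `ℝ≥0∞` of sum less than one has an injective ranking `π` for which the `j`-th
term is less than `1 / (π j + 1)`. -/
theorem exists_injective_lt_inv_of_tsum_lt_one {c : ℕ → ℝ≥0∞} (hc : ∑' j, c j < 1) :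
    ∃ π : ℕ → ℕ, Function.Injective π ∧ ∀ j, c j < ((π j : ℝ≥0∞) + 1)⁻¹ := by
  obtain ⟨δ, δ_pos, hδ⟩ := ENNReal.exists_pos_sum_of_countable' (tsub_pos_of_lt hc).ne' ℕ
  set a : ℕ → ℝ≥0∞ := fun j => c j + δ j with ha
  have a_pos (j : ℕ) : 0 < a j := (δ_pos j).trans_le le_add_self
  have a_sum : ∑' j, a j < 1 := by
    rw [ENNReal.tsum_add, add_comm]
    exact lt_tsub_iff_right.1 hδ
  let before (i j : ℕ) : Prop := a j < a i ∨ a i = a j ∧ i < j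
  have le_of_before {i j : ℕ} (h : before i j) : a j ≤ a i :=
    h.elim le_of_lt fun h => h.1.ge
  have before_trans {i j k : ℕ} (hij : before i j) (hjk : before j k) : before i k := by
    rcases hij with h | ⟨h, h'⟩ <;> rcases hjk with g | ⟨g, g'⟩
    · exact Or.inl (g.trans h)
    · exact Or.inl (g ▸ h)
    · exact Or.inl (h ▸ g)
    · exact Or.inr ⟨h.trans g, h'.trans g'⟩
  have before_irrefl (i : ℕ) : ¬ before i i := by simp [before]
  have fin (j : ℕ) : {i | before i j}.Finite :=
    (ENNReal.finite_const_le_of_tsum_ne_top (a_sum.trans ENNReal.one_lt_top).ne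
      (a_pos j).ne').subset fun i hi => le_of_before hi
  have card_lt {i j : ℕ} (hij : before i j) : (fin i).toFinset.card < (fin j).toFinset.card := by
    refine Finset.card_lt_card (Finset.ssubset_iff_of_subset ?_ |>.2 ⟨i, ?_, ?_⟩)
    · intro k hk
      simp only [Set.Finite.mem_toFinset, mem_ofPred_eq] at hk ⊢
      exact before_trans hk hij
    · simpa using hij
    · simpa using before_irrefl i
  refine ⟨fun j => (fin j).toFinset.card, fun i j hij => ?_, fun j => ?_⟩
  · by_contra hne
    have : before i j ∨ before j i := by
      rcases lt_trichotomy (a i) (a j) with h | h | h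
      · exact Or.inr (Or.inl h)
      · rcases lt_or_gt_of_ne hne with h' | h'
        · exact Or.inl (Or.inr ⟨h, h'⟩)
        · exact Or.inr (Or.inr ⟨h.symm, h'⟩)
      · exact Or.inl (Or.inl h)
    rcases this with h | h
    · exact (card_lt h).ne hij
    · exact (card_lt h).ne' hij
  · have hj : j ∉ (fin j).toFinset := by simpa using before_irrefl j
    have key : (((fin j).toFinset.card : ℝ≥0∞) + 1) * a j < 1 :=
      calc (((fin j).toFinset.card : ℝ≥0∞) + 1) * a j
          = ∑ _i ∈ insert j (fin j).toFinset, a j := by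
            rw [Finset.sum_const, Finset.card_insert_of_notMem hj, nsmul_eq_mul]
            push_cast
            rfl
        _ ≤ ∑ i ∈ insert j (fin j).toFinset, a i := by
            refine Finset.sum_le_sum fun i hi => ?_
            rcases Finset.mem_insert.1 hi with rfl | hi
            · exact le_rfl
            · exact le_of_before (by simpa using hi)
        _ ≤ ∑' i, a i := ENNReal.sum_le_tsum _
        _ < 1 := a_sum
    refine (le_self_add : c j ≤ a j).trans_lt ?_
    rwa [← one_div, ENNReal.lt_div_iff_mul_lt (by simp) (by simp), mul_comm]

theorem exists_cover_ediam_le_of_tsum_lt_one {X : Type*} [MetricSpace X] {a : ℕ → ℝ≥0∞}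
    {c : ℕ → ℝ≥0∞} {t : ℕ → Set X} (ht : ∀ x, ∃ j, x ∈ t j) (hc : ∑' j, c j < 1)
    (h : ∀ j n : ℕ, c j < ((n : ℝ≥0∞) + 1)⁻¹ → Metric.ediam (t j) ≤ a n) :
    ∃ U : ℕ → Set X, (∀ x, ∃ n, x ∈ U n) ∧ ∀ n, Metric.ediam (U n) ≤ a n := by
  obtain ⟨π, hπ, hlt⟩ := exists_injective_lt_inv_of_tsum_lt_one hc
  refine ⟨Function.extend π t fun _ => ∅, fun x => ?_, fun n => ?_⟩
  · obtain ⟨j, hj⟩ := ht x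
    exact ⟨π j, by rwa [hπ.extend_apply]⟩
  · by_cases hn : ∃ j, π j = n
    · obtain ⟨j, rfl⟩ := hn
      rw [hπ.extend_apply]
      exact h j _ (hlt j)
    · rw [Function.extend_apply' _ _ _ hn]
      simp

end Ranking

section HarmonicGauge

/-- A continuous subadditive gauge which is at least `1 / (n + 1)` on `[a n, ∞]`. -/
noncomputable def harmonicGauge (a : ℕ → ℝ≥0∞) (r : ℝ≥0∞) : ℝ≥0∞ :=
  ⨆ n : ℕ, min (r / a n) 1 / ((n : ℝ≥0∞) + 1)

variable {a : ℕ → ℝ≥0∞}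

theorem harmonicGauge_mono (a : ℕ → ℝ≥0∞) : Monotone (harmonicGauge a) := by
  intro r s hrs
  unfold harmonicGauge
  gcongr

@[simp]
theorem harmonicGauge_zero (a : ℕ → ℝ≥0∞) : harmonicGauge a 0 = 0 := by
  simp [harmonicGauge]

theorem harmonicGauge_le_one (a : ℕ → ℝ≥0∞) (r : ℝ≥0∞) : harmonicGauge a r ≤ 1 :=
  iSup_le fun n => ENNReal.div_le_of_le_mul <| (min_le_right _ _).trans <| by simp

theorem harmonicGauge_add_le (a : ℕ → ℝ≥0∞) (r s : ℝ≥0∞) :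
    harmonicGauge a (r + s) ≤ harmonicGauge a r + harmonicGauge a s := by
  refine iSup_le fun n => ?_
  calc min ((r + s) / a n) 1 / ((n : ℝ≥0∞) + 1)
      ≤ (min (r / a n) 1 + min (s / a n) 1) / ((n : ℝ≥0∞) + 1) := by
        gcongr
        rw [ENNReal.add_div]
        rcases le_total (r / a n) 1 with hr | hr
        · rcases le_total (s / a n) 1 with hs | hs
          · rw [min_eq_left hr, min_eq_left hs]
            exact min_le_left _ _
          · rw [min_eq_right hs]
            exact (min_le_right _ _).trans le_add_self
        · rw [min_eq_right hr]
          exact (min_le_right _ _).trans le_self_add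
    _ = min (r / a n) 1 / ((n : ℝ≥0∞) + 1) + min (s / a n) 1 / ((n : ℝ≥0∞) + 1) :=
        ENNReal.add_div
    _ ≤ harmonicGauge a r + harmonicGauge a s :=
        add_le_add (le_iSup (fun n : ℕ => min (r / a n) 1 / ((n : ℝ≥0∞) + 1)) n)
          (le_iSup (fun n : ℕ => min (s / a n) 1 / ((n : ℝ≥0∞) + 1)) n)

theorem lt_of_harmonicGauge_lt {r : ℝ≥0∞} {n : ℕ} (ha : a n ≠ 0) (ha' : a n ≠ ∞)
    (h : harmonicGauge a r < ((n : ℝ≥0∞) + 1)⁻¹) : r < a n := by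
  contrapose! h
  refine le_trans ?_ (le_iSup _ n)
  rw [min_eq_right, one_div]
  rwa [ENNReal.le_div_iff_mul_le (.inl ha) (.inl ha'), one_mul]

theorem harmonicGauge_pos (ha : a 0 ≠ ∞) {r : ℝ≥0∞} (hr : 0 < r) : 0 < harmonicGauge a r := by
  refine lt_of_lt_of_le ?_ (le_iSup _ 0)
  simpa using ⟨hr.ne', ha⟩

theorem continuous_harmonicGauge (ha : ∀ n, a n ≠ 0) : Continuous (harmonicGauge a) := by
  have hterm (n : ℕ) : Continuous fun r : ℝ≥0∞ => min (r / a n) 1 / ((n : ℝ≥0∞) + 1) :=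
    (ENNReal.continuous_div_const _ (by simp)).comp
      ((ENNReal.continuous_div_const _ (ha n)).min continuous_const)
  refine continuous_iff_continuousAt.2 fun r => tendsto_order.2 ⟨fun b hb => ?_, fun b hb => ?_⟩
  · obtain ⟨n, hn⟩ := lt_iSup_iff.1 hb
    filter_upwards [(hterm n).continuousAt.eventually (lt_mem_nhds hn)] with s hs
    exact hs.trans_le (le_iSup (fun n : ℕ => min (s / a n) 1 / ((n : ℝ≥0∞) + 1)) n)
  · obtain ⟨b', hb', hbb'⟩ := exists_between hb
    obtain ⟨N, hN⟩ := ENNReal.exists_inv_nat_lt (pos_of_gt hb').ne'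
    have hev : ∀ᶠ s in 𝓝 r, ∀ n ∈ Finset.range N, min (s / a n) 1 / ((n : ℝ≥0∞) + 1) < b' :=
      (Finset.eventually_all _).2 fun n _ => (hterm n).continuousAt.eventually
        (gt_mem_nhds ((le_iSup (fun n : ℕ => min (r / a n) 1 / ((n : ℝ≥0∞) + 1)) n).trans_lt hb'))
    filter_upwards [hev] with s hs
    refine (iSup_le fun n => ?_).trans_lt hbb'
    rcases lt_or_ge n N with hn | hn
    · exact (hs n (Finset.mem_range.2 hn)).le
    · calc min (s / a n) 1 / ((n : ℝ≥0∞) + 1) ≤ 1 / (N : ℝ≥0∞) := by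
            gcongr
            · exact min_le_right _ _
            · exact (Nat.cast_le.2 hn).trans le_self_add
        _ ≤ b' := by rw [one_div]; exact hN.le

theorem isGauge_harmonicGauge (ha : ∀ n, a n ≠ 0) (ha' : a 0 ≠ ∞) : IsGauge (harmonicGauge a) :=
  ⟨harmonicGauge_mono a, fun _ => (continuous_harmonicGauge ha).continuousWithinAt,
    harmonicGauge_zero a, fun _ => harmonicGauge_pos ha'⟩

/-- Composing the distance with a harmonic gauge gives a metric. -/
theorem exists_metricSpace_edist_eq_harmonicGauge (X : Type u) [MetricSpace X] (ha : a 0 ≠ ∞) :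
    ∃ (Y : Type u) (_ : MetricSpace Y) (f : X → Y),
      ∀ x y, edist (f x) (f y) = harmonicGauge a (edist x y) := by
  let E : EMetricSpace X :=
    { edist := fun x y => harmonicGauge a (edist x y)
      edist_self := fun x => by simp
      edist_comm := fun x y => by rw [edist_comm]
      edist_triangle := fun x y z =>
        (harmonicGauge_mono a (edist_triangle x y z)).trans (harmonicGauge_add_le a _ _)
      eq_of_edist_eq_zero := fun {x y} h => by
        by_contra hne
        exact (harmonicGauge_pos ha (edist_pos.2 hne)).ne' h }
  exact ⟨X, @EMetricSpace.toMetricSpace X E fun _ _ =>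
    ((harmonicGauge_le_one a _).trans_lt ENNReal.one_lt_top).ne, id, fun _ _ => rfl⟩

theorem uniformContinuous_of_edist_eq_harmonicGauge {X Y : Type*} [MetricSpace X] [MetricSpace Y]
    (ha : ∀ n, a n ≠ 0) {f : X → Y}
    (hf : ∀ x y, edist (f x) (f y) = harmonicGauge a (edist x y)) : UniformContinuous f := by
  refine EMetric.uniformContinuous_iff.2 fun ε hε => ?_
  have h0 : ∀ᶠ r in 𝓝 0, harmonicGauge a r < ε :=
    (continuous_harmonicGauge ha).continuousAt.eventually (gt_mem_nhds (by simpa using hε))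
  obtain ⟨δ, δ_pos, hδ⟩ := ENNReal.nhds_zero_basis.eventually_iff.1 h0
  exact ⟨δ, δ_pos, fun {x y} hxy => (hf x y).trans_lt (hδ hxy)⟩

end HarmonicGauge

section StrongMeasureZero

theorem exists_cover_tsum_lt_of_mkMetric_eq_zero {X : Type*} [MetricSpace X] [MeasurableSpace X]
    [BorelSpace X] {h : ℝ≥0∞ → ℝ≥0∞} {s : Set X} (hs : Measure.mkMetric h s = 0) :
    ∃ t : ℕ → Set X, s ⊆ ⋃ n, t n ∧ ∑' n, ⨆ _ : (t n).Nonempty, h (Metric.ediam (t n)) < 1 := by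
  rw [Measure.mkMetric_apply] at hs
  simp only [ENNReal.iSup_eq_zero] at hs
  have h1 := (hs 1 one_pos).trans_lt (zero_lt_one (α := ℝ≥0∞))
  simp only [iInf_lt_iff] at h1
  obtain ⟨t, ht, -, hlt⟩ := h1
  exact ⟨t, ht, hlt⟩

theorem HasSMZ.mkMetric_range_eq_zero {X Y : Type*} [MetricSpace X] [MetricSpace Y]
    [MeasurableSpace Y] [BorelSpace Y] (hX : HasSMZ X) {f : X → Y} (hf : UniformContinuous f)
    {h : ℝ≥0∞ → ℝ≥0∞} (hh : Tendsto h (𝓝 0) (𝓝 0)) :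
    Measure.mkMetric h (range f) = 0 := by
  rw [Measure.mkMetric_apply]
  simp only [ENNReal.iSup_eq_zero]
  intro r hr
  refine le_antisymm (ENNReal.le_of_forall_pos_le_add fun η hη _ => ?_) zero_le
  obtain ⟨δ, δ_pos, hδ⟩ := ENNReal.exists_pos_sum_of_countable' (ENNReal.coe_pos.2 hη).ne' ℕ
  have H (n : ℕ) : ∃ ε : ℝ, 0 < ε ∧ ∀ U : Set X, Metric.ediam U ≤ ENNReal.ofReal ε →
      Metric.ediam (f '' U) ≤ r ∧ h (Metric.ediam (f '' U)) ≤ δ n := by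
    have h0 : ∀ᶠ u in 𝓝 0, u ≤ r ∧ h u ≤ δ n :=
      Filter.Eventually.and (Iic_mem_nhds hr)
        ((hh.eventually (gt_mem_nhds (δ_pos n))).mono fun _ => le_of_lt)
    obtain ⟨u, u_pos, hu⟩ := ENNReal.nhds_zero_basis_Iic.eventually_iff.1 h0
    obtain ⟨v, v_pos, hv⟩ := EMetric.uniformContinuous_iff.1 hf u u_pos
    obtain ⟨w, w_pos, hwv⟩ := ENNReal.lt_iff_exists_nnreal_btwn.1 v_pos
    refine ⟨w, by exact_mod_cast w_pos, fun U hU => hu (Metric.ediam_image_le_iff.2 ?_)⟩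
    intro x hx y hy
    refine (hv ((Metric.edist_le_of_ediam_le hx hy hU).trans_lt ?_)).le
    simpa using hwv
  choose ε ε_pos hε using H
  obtain ⟨U, hU, hdiam⟩ := hX ε ε_pos
  refine (iInf_le_of_le (fun n => f '' U n) <| iInf₂_le_of_le ?_ ?_ ?_).trans
    (hδ.le.trans le_add_self)
  · rintro _ ⟨x, rfl⟩
    obtain ⟨n, hn⟩ := hU x
    exact mem_iUnion.2 ⟨n, mem_image_of_mem f hn⟩
  · exact fun n => (hε n _ (hdiam n)).1
  · exact ENNReal.tsum_le_tsum fun n => iSup_le fun _ => (hε n _ (hdiam n)).2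

theorem hasSMZ_of_forall_mkMetric_eq_zero {X : Type*} [MetricSpace X] [MeasurableSpace X]
    [BorelSpace X]
    (H : ∀ h : ℝ≥0∞ → ℝ≥0∞, IsGauge h → Measure.mkMetric h (univ : Set X) = 0) : HasSMZ X := by
  intro ε hε
  have ha (n : ℕ) : ENNReal.ofReal (ε n) ≠ 0 := (ENNReal.ofReal_pos.2 (hε n)).ne'
  obtain ⟨t, ht, hlt⟩ := exists_cover_tsum_lt_of_mkMetric_eq_zero
    (H _ (isGauge_harmonicGauge ha ENNReal.ofReal_ne_top))
  refine exists_cover_ediam_le_of_tsum_lt_one (fun x => mem_iUnion.1 (ht (mem_univ x))) hlt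
    fun j n hj => ?_
  rcases (t j).eq_empty_or_nonempty with hempty | hne
  · simp [hempty]
  · rw [iSup_pos hne] at hj
    exact (lt_of_harmonicGauge_lt (ha n) ENNReal.ofReal_ne_top hj).le

theorem hasSMZ_of_forall_dimH_range_eq_zero {X : Type u} [MetricSpace X]
    (H : ∀ (Y : Type u) [MetricSpace Y] (f : X → Y), UniformContinuous f → dimH (range f) = 0) :
    HasSMZ X := by
  intro ε hε
  have ha (n : ℕ) : ENNReal.ofReal (ε n) ≠ 0 := (ENNReal.ofReal_pos.2 (hε n)).ne'
  obtain ⟨Y, _, f, hedist⟩ := exists_metricSpace_edist_eq_harmonicGauge X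
    (a := fun n => ENNReal.ofReal (ε n)) ENNReal.ofReal_ne_top
  have hf := uniformContinuous_of_edist_eq_harmonicGauge ha hedist
  borelize Y
  have h1 : Measure.hausdorffMeasure ((1 : ℝ≥0) : ℝ) (range f) = 0 :=
    hausdorffMeasure_of_dimH_lt (by simp [H Y f hf])
  obtain ⟨t, ht, hlt⟩ := exists_cover_tsum_lt_of_mkMetric_eq_zero h1
  refine exists_cover_ediam_le_of_tsum_lt_one (t := fun j => f ⁻¹' t j)
    (fun x => by simpa using ht (mem_range_self x)) hlt fun j n hj => ?_
  refine Metric.ediam_le fun x hx y hy => ?_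
  rw [iSup_pos ⟨_, hx⟩, NNReal.coe_one, ENNReal.rpow_one] at hj
  refine (lt_of_harmonicGauge_lt (a := fun n => ENNReal.ofReal (ε n)) (ha n)
    ENNReal.ofReal_ne_top ?_).le
  rw [← hedist]
  exact (Metric.edist_le_ediam_of_mem (mem_preimage.1 hx) (mem_preimage.1 hy)).trans_lt hj

theorem HasSMZ.dimH_range_eq_zero {X Y : Type*} [MetricSpace X] [MetricSpace Y] (hX : HasSMZ X)
    {f : X → Y} (hf : UniformContinuous f) : dimH (range f) = 0 := by
  borelize Y
  refine le_antisymm (dimH_le fun d hd => ?_) zero_le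
  by_contra! hpos
  have hd_pos : (0 : ℝ) < d := by exact_mod_cast hpos
  have h0 : Tendsto (fun r : ℝ≥0∞ => r ^ (d : ℝ)) (𝓝 0) (𝓝 0) := by
    simpa [ENNReal.zero_rpow_of_pos hd_pos] using
      (ENNReal.continuous_rpow_const (y := (d : ℝ))).tendsto 0
  have : Measure.hausdorffMeasure (d : ℝ) (range f) = 0 := hX.mkMetric_range_eq_zero hf h0
  simp [this] at hd

theorem IsGauge.tendsto_zero {h : ℝ≥0∞ → ℝ≥0∞} (hh : IsGauge h) : Tendsto h (𝓝 0) (𝓝 0) := by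
  obtain ⟨-, hcont, h0, -⟩ := hh
  have : ContinuousWithinAt h (Ioi 0) 0 := hcont 0
  rw [continuousWithinAt_Ioi_iff_Ici, ContinuousWithinAt, h0] at this
  rwa [show Ici (0 : ℝ≥0∞) = univ from Ici_bot, nhdsWithin_univ] at this

end StrongMeasureZero

/-- Theorem (Besicovitch-type characterization of strong measure zero): for a metric space `X`,
(i) `X` has strong measure zero, (ii) `ℋ^h X = 0` for every gauge `h`, and (iii) every
uniformly continuous image of `X` has Hausdorff dimension zero, are all equivalent. -/
theorem stmt0 (X : Type) [MetricSpace X] [MeasurableSpace X] [BorelSpace X] :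
    (HasSMZ X ↔
      ∀ h : ℝ≥0∞ → ℝ≥0∞, IsGauge h → Measure.mkMetric h (Set.univ : Set X) = 0) ∧
    (HasSMZ X ↔
      ∀ (Y : Type) [MetricSpace Y] (f : X → Y),
        UniformContinuous f → dimH (Set.range f) = 0) := by
  refine ⟨⟨fun hX h hh => ?_, hasSMZ_of_forall_mkMetric_eq_zero⟩,
    fun hX Y _ f hf => hX.dimH_range_eq_zero hf, hasSMZ_of_forall_dimH_range_eq_zero⟩
  simpa using hX.mkMetric_range_eq_zero uniformContinuous_id hh.tendsto_zero
end

section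
/- Let h be a gauge with lim_{r→0+} r/h(r) = 0. Then there exists an infinite set I ⊆ ℕ such that ℋ^h(C_I) > 0, where C_I = {x ∈ 2^ℕ : x(i) = 0 for all i ∈ I} and ℋ^h is the h-dimensional Hausdorff measure on the Cantor space with the least-difference metric. -/
open MeasureTheory Set Filter Pointwise
open scoped ENNReal NNReal Topology

/-- The Cantor space `2^ℕ`. -/
abbrev Cantor : Type := ℕ → ZMod 2

/-- The least-difference metric `d(x,y) = 2^{-min{i : x i ≠ y i}}` on the Cantor space. -/
noncomputable instance : MetricSpace Cantor := PiNat.metricSpace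

noncomputable instance : MeasurableSpace Cantor := borel Cantor
instance : BorelSpace Cantor := ⟨rfl⟩

/-- `C_I = {x ∈ 2^ℕ : x i = 0 for all i ∈ I}`. -/
def CI (I : Set ℕ) : Set Cantor := {x : Cantor | ∀ i ∈ I, x i = 0}

/-- An infinite set which is so sparse that the reciprocal powers of two indexed by its counting
function eventually dominate a given null sequence. -/
theorem exists_infinite_eventually_le_half_pow_card (g : ℕ → ℝ≥0∞) (hg : Tendsto g atTop (𝓝 0)) :
    ∃ I : Set ℕ, I.Infinite ∧ ∃ n₀ : ℕ, ∀ n ≥ n₀, ∀ s : Finset ℕ,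
      (∀ i ∈ s, i < n ∧ i ∈ I) → g n ≤ (2⁻¹ : ℝ≥0∞) ^ s.card := by
  have hev : ∀ j : ℕ, ∀ᶠ k in atTop, ∀ n ≥ k, g n ≤ (2⁻¹ : ℝ≥0∞) ^ (j + 1) := fun j =>
    eventually_forall_ge_atTop.2 <| hg.eventually_le_const
      (ENNReal.pow_pos (ENNReal.inv_pos.2 ENNReal.ofNat_ne_top) _)
  obtain ⟨φ, hφ, hgφ⟩ := extraction_forall_of_eventually hev
  refine ⟨range φ, infinite_range_of_injective hφ.injective, φ 0, fun n hn s hs => ?_⟩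
  have hcard : ∀ j, n ≤ φ j → s.card ≤ j := by
    intro j hj
    have hsub : s ⊆ (Finset.range j).image φ := by
      intro i hi
      obtain ⟨hin, l, rfl⟩ := hs i hi
      exact Finset.mem_image_of_mem φ (Finset.mem_range.2 (hφ.lt_iff_lt.1 (hin.trans_le hj)))
    exact (Finset.card_le_card hsub).trans (Finset.card_image_le.trans (Finset.card_range j).le)
  rcases hk : s.card with _ | j
  · exact (hgφ 0 n hn).trans (pow_le_pow_right_of_le_one'
      (ENNReal.inv_le_one.2 one_le_two) (Nat.zero_le _))
  · refine hgφ j n (le_of_not_ge fun hle => ?_)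
    have := hcard j hle
    omega

/-- The fair coin-tossing measure on `ℕ → Bool`. -/
noncomputable def coinMeasure : Measure (ℕ → Bool) :=
  Measure.infinitePi fun _ => (PMF.uniformOfFintype Bool).toMeasure

theorem coinMeasure_univ : coinMeasure univ = 1 := by
  unfold coinMeasure
  exact measure_univ

theorem coinMeasure_pi_singleton (s : Finset ℕ) (b : ℕ → Bool) :
    coinMeasure ((s : Set ℕ).pi fun i => {b i}) = (2⁻¹ : ℝ≥0∞) ^ s.card := by
  unfold coinMeasure
  rw [Measure.infinitePi_pi _ fun i _ => measurableSet_singleton (b i)]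
  simp

open Classical in
/-- The parametrization of `CI I` by sequences of bits; the bits indexed by `I` are ignored. -/
noncomputable def bitsToCI (I : Set ℕ) (b : ℕ → Bool) : Cantor :=
  fun i => if i ∈ I then 0 else if b i then 1 else 0

theorem bitsToCI_mem (I : Set ℕ) (b : ℕ → Bool) : bitsToCI I b ∈ CI I :=
  fun i hi => by simp [bitsToCI, hi]

theorem coinMeasure_preimage_bitsToCI_le (I : Set ℕ) (E : Set Cantor) (n : ℕ)
    (hE : ∀ x ∈ E, ∀ y ∈ E, ∀ i < n, x i = y i) (s : Finset ℕ) (hs : ∀ i ∈ s, i < n ∧ i ∉ I) :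
    coinMeasure (bitsToCI I ⁻¹' E) ≤ (2⁻¹ : ℝ≥0∞) ^ s.card := by
  rcases (bitsToCI I ⁻¹' E).eq_empty_or_nonempty with hempty | ⟨b, hb⟩
  · simp [hempty]
  · rw [← coinMeasure_pi_singleton s b]
    refine measure_mono fun c hc i hi => ?_
    have h1 := hE _ hc _ hb i (hs i hi).1
    simp only [bitsToCI, if_neg (hs i hi).2] at h1
    cases hci : c i <;> cases hbi : b i <;> simp_all

theorem Cantor.apply_eq_of_ediam_lt {E : Set Cantor} {m : ℕ}
    (hE : Metric.ediam E < (2⁻¹ : ℝ≥0∞) ^ m) {x y : Cantor} (hx : x ∈ E) (hy : y ∈ E) {i : ℕ}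
    (hi : i ≤ m) : x i = y i := by
  refine PiNat.apply_eq_of_dist_lt (n := m) ?_ hi
  have h1 : edist x y < (2⁻¹ : ℝ≥0∞) ^ m := (Metric.edist_le_ediam_of_mem hx hy).trans_lt hE
  have h2 : (2⁻¹ : ℝ≥0∞) ^ m = ENNReal.ofReal ((1 / 2) ^ m) := by
    rw [ENNReal.ofReal_pow (by norm_num), one_div, ENNReal.ofReal_inv_of_pos two_pos,
      ENNReal.ofReal_ofNat]
  rw [h2, edist_dist] at h1
  exact (ENNReal.ofReal_lt_ofReal_iff (by positivity)).1 h1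

theorem tendsto_inv_two_pow_nhdsGT_zero :
    Tendsto (fun n : ℕ => (2⁻¹ : ℝ≥0∞) ^ n) atTop (𝓝[>] 0) :=
  tendsto_nhdsWithin_iff.2
    ⟨ENNReal.tendsto_pow_atTop_nhds_zero_of_lt_one ENNReal.one_half_lt_one,
      Eventually.of_forall fun _ => ENNReal.pow_pos (ENNReal.inv_pos.2 ENNReal.ofNat_ne_top) _⟩

/-- A mass distribution bound on sets confined to cylinders gives a bound by the gauge of the
diameter. -/
theorem le_gauge_ediam_of_forall_agree {h : ℝ≥0∞ → ℝ≥0∞} (hgauge : IsGauge h) {E : Set Cantor}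
    {n₀ : ℕ} {a : ℝ≥0∞}
    (ha : ∀ n ≥ n₀, (∀ x ∈ E, ∀ y ∈ E, ∀ i < n, x i = y i) → a ≤ h (2⁻¹ ^ n))
    (hd : Metric.ediam E ≤ 2⁻¹ ^ n₀) : a ≤ h (Metric.ediam E) := by
  obtain ⟨hmono, hright, h0, -⟩ := hgauge
  rcases eq_or_ne (Metric.ediam E) 0 with hzero | hpos
  · have hlim : Tendsto (fun n : ℕ => h (2⁻¹ ^ n)) atTop (𝓝 (h 0)) :=
      (hright 0).comp tendsto_inv_two_pow_nhdsGT_zero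
    rw [hzero]
    refine ge_of_tendsto hlim ((eventually_ge_atTop n₀).mono fun n hn => ha n hn ?_)
    intro x hx y hy i _
    refine Cantor.apply_eq_of_ediam_lt (m := i) ?_ hx hy le_rfl
    rw [hzero]
    exact ENNReal.pow_pos (ENNReal.inv_pos.2 ENNReal.ofNat_ne_top) _
  · have hex : ∃ n : ℕ, (2⁻¹ : ℝ≥0∞) ^ n ≤ Metric.ediam E :=
      ((tendsto_nhdsWithin_iff.1 tendsto_inv_two_pow_nhdsGT_zero).1.eventually_le_const
        (pos_iff_ne_zero.2 hpos)).exists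
    classical
    refine (ha (Nat.find hex) ?_ ?_).trans (hmono (Nat.find_spec hex))
    · by_contra! hlt
      have hle := (Nat.find_spec hex).trans hd
      rw [← ENNReal.inv_pow, ← ENNReal.inv_pow, ENNReal.inv_le_inv] at hle
      exact absurd (Nat.pow_lt_pow_right one_lt_two hlt) (not_lt.2 (by exact_mod_cast hle))
    · intro x hx y hy i hi
      exact Cantor.apply_eq_of_ediam_lt (not_le.1 (Nat.find_min hex hi)) hx hy le_rfl

/-- If `h` is a gauge with `lim_{r→0+} r / h r = 0`, then there is an infinite `I ⊆ ℕ`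
with `ℋ^h (C_I) > 0`. -/
theorem stmt2 (h : ℝ≥0∞ → ℝ≥0∞) (hgauge : IsGauge h)
    (hlim : Filter.Tendsto (fun r : ℝ≥0∞ => r / h r) (nhdsWithin 0 (Set.Ioi 0)) (nhds 0)) :
    ∃ I : Set ℕ, I.Infinite ∧ 0 < MeasureTheory.Measure.mkMetric h (CI I) := by
  obtain ⟨I, hI, n₀, hn₀⟩ := exists_infinite_eventually_le_half_pow_card _
    (hlim.comp tendsto_inv_two_pow_nhdsGT_zero)
  refine ⟨I, hI, ?_⟩
  have hpow : ∀ n : ℕ, 0 < (2⁻¹ : ℝ≥0∞) ^ n := fun n =>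
    ENNReal.pow_pos (ENNReal.inv_pos.2 ENNReal.ofNat_ne_top) n
  have hpow_top : ∀ n : ℕ, (2⁻¹ : ℝ≥0∞) ^ n ≠ ⊤ := fun n =>
    ENNReal.pow_ne_top (ENNReal.inv_ne_top.2 two_ne_zero)
  have hball : ∀ E : Set Cantor, Metric.ediam E ≤ 2⁻¹ ^ n₀ →
      coinMeasure (bitsToCI I ⁻¹' E) ≤ h (Metric.ediam E) := by
    refine fun E => le_gauge_ediam_of_forall_agree hgauge fun n hn hE => ?_
    classical
    have hin := hn₀ n hn ((Finset.range n).filter (· ∈ I)) (by simp)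
    refine (coinMeasure_preimage_bitsToCI_le I E n hE
      ((Finset.range n).filter (· ∉ I)) (by simp)).trans ?_
    have hcard := Finset.card_filter_add_card_filter_not (s := Finset.range n) (· ∈ I)
    rw [Finset.card_range] at hcard
    set k := ((Finset.range n).filter (· ∈ I)).card
    simp only [Function.comp_apply] at hin
    rw [ENNReal.div_le_iff_le_mul (Or.inl (hgauge.2.2.2 _ (hpow n)).ne') (Or.inr (hpow k).ne')]
      at hin
    nth_rewrite 1 [← hcard] at hin
    rw [pow_add] at hin
    exact (ENNReal.mul_le_mul_iff_right (hpow k).ne' (hpow_top k)).1 hin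
  refine zero_lt_one.trans_le ?_
  rw [Measure.mkMetric_apply]
  refine le_iSup₂_of_le ((2⁻¹ : ℝ≥0∞) ^ n₀) (hpow n₀) ?_
  refine le_iInf₂ fun t ht => le_iInf fun hdiam => ?_
  calc (1 : ℝ≥0∞) = coinMeasure univ := coinMeasure_univ.symm
    _ ≤ coinMeasure (⋃ n, bitsToCI I ⁻¹' t n) := by
      refine measure_mono fun b _ => ?_
      rw [← preimage_iUnion]
      exact ht (bitsToCI_mem I b)
    _ ≤ ∑' n, coinMeasure (bitsToCI I ⁻¹' t n) := measure_iUnion_le _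
    _ ≤ ∑' n, ⨆ _ : (t n).Nonempty, h (Metric.ediam (t n)) := by
      refine ENNReal.tsum_le_tsum fun n => ?_
      rcases (t n).eq_empty_or_nonempty with hempty | hne
      · simp [hempty]
      · rw [iSup_pos hne]
        exact hball _ (hdiam n)
end

section
/- If X is a metric space with strong measure zero, h is a gauge, and Y is a σ-compact metric space with ℋ^h(Y) = 0, then ℋ^h(X × Y) = 0, where X × Y carries the maximum metric. -/
open MeasureTheory Set Filter Pointwise
open scoped ENNReal NNReal Topology

/-- A point where a gauge is finite can be moved slightly to the right without increasing the
gauge by more than a prescribed amount. -/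
lemma IsGauge.exists_gt_le_add {h : ℝ≥0∞ → ℝ≥0∞} (hh : IsGauge h) {d δ c : ℝ≥0∞}
    (hd : h d ≠ ∞) (hδ : d < δ) (hc : c ≠ 0) :
    ∃ r, d < r ∧ r ≤ δ ∧ h r ≤ h d + c := by
  have hev : ∀ᶠ r in 𝓝[>] d, h r < h d + c :=
    (hh.2.1 d).eventually (gt_mem_nhds (ENNReal.lt_add_right hd hc))
  have hne : (𝓝[>] d).NeBot := nhdsGT_neBot_of_exists_gt ⟨δ, hδ⟩
  obtain ⟨r, hr, hdr, hrδ⟩ := (hev.and (Ioo_mem_nhdsGT hδ)).exists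
  exact ⟨r, hdr, hrδ.le, hr.le⟩

/-- A compact set of measure zero for the Hausdorff measure of a gauge has finite covers by sets
of small positive size with small total gauge. -/
lemma IsGauge.exists_finite_cover_of_mkMetric_eq_zero {Y : Type*} [EMetricSpace Y]
    [MeasurableSpace Y] [BorelSpace Y] {h : ℝ≥0∞ → ℝ≥0∞} (hh : IsGauge h) {K : Set Y}
    (hK : IsCompact K) (hK0 : Measure.mkMetric h K = 0) {δ η : ℝ≥0∞} (hδ : 0 < δ)
    (hδt : δ ≠ ∞) (hη : 0 < η) :
    ∃ (t : Finset ℕ) (E : ℕ → Set Y) (r : ℕ → ℝ≥0∞), K ⊆ ⋃ i ∈ t, E i ∧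
      (∀ i, Metric.ediam (E i) ≤ r i ∧ 0 < r i ∧ r i ≤ δ) ∧ ∑ i ∈ t, h (r i) ≤ η := by
  have hη2 : 0 < η / 2 := ENNReal.half_pos hη.ne'
  rw [Measure.mkMetric_apply] at hK0
  have hinf := (le_iSup₂ (f := fun (r : ℝ≥0∞) (_ : 0 < r) =>
      ⨅ (t : ℕ → Set Y) (_ : K ⊆ iUnion t) (_ : ∀ n, Metric.ediam (t n) ≤ r),
        ∑' n, ⨆ _ : (t n).Nonempty, h (Metric.ediam (t n))) (δ / 2)
      (ENNReal.half_pos hδ.ne')).trans hK0.le |>.trans_lt hη2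
  simp only [iInf_lt_iff] at hinf
  obtain ⟨A, hKA, hAδ, hsum⟩ := hinf
  have hterm : ∀ n, (⨆ _ : (A n).Nonempty, h (Metric.ediam (A n))) = h (Metric.ediam (A n)) := by
    intro n
    rcases (A n).eq_empty_or_nonempty with hn | hn
    · simp [hn, hh.2.2.1]
    · simp [hn]
  simp only [hterm] at hsum
  obtain ⟨c, hc, hcsum⟩ := ENNReal.exists_pos_sum_of_countable' hη2.ne' ℕ
  have hr : ∀ i, ∃ r, Metric.ediam (A i) < r ∧ r ≤ δ ∧ h r ≤ h (Metric.ediam (A i)) + c i :=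
    fun i => hh.exists_gt_le_add
      (ne_top_of_le_ne_top hsum.ne_top (ENNReal.le_tsum i))
      ((hAδ i).trans_lt (ENNReal.half_lt_self hδ.ne' hδt)) (hc i).ne'
  choose r hdr hrδ hhr using hr
  have hρ : ∀ i, ∃ ρ : ℝ≥0, 0 < ρ ∧ Metric.ediam (A i) + ρ < r i := fun i =>
    ENNReal.lt_iff_exists_add_pos_lt.1 (hdr i)
  choose ρ hρ0 hρr using hρ
  have hKE : K ⊆ ⋃ i, Metric.thickening ((ρ i / 2 : ℝ≥0) : ℝ) (A i) := hKA.trans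
    (iUnion_mono fun i => Metric.self_subset_thickening (NNReal.coe_pos.2 (half_pos (hρ0 i))) _)
  obtain ⟨t, ht⟩ := hK.elim_finite_subcover _ (fun i => Metric.isOpen_thickening) hKE
  refine ⟨t, _, r, ht, fun i => ⟨?_, zero_le.trans_lt (hdr i), hrδ i⟩, ?_⟩
  · calc
      _ ≤ Metric.ediam (A i) + 2 * ((ρ i / 2 : ℝ≥0) : ℝ≥0∞) := Metric.ediam_thickening_le _
      _ = Metric.ediam (A i) + ρ i := by
        rw [← ENNReal.coe_ofNat, ← ENNReal.coe_mul, mul_div_cancel₀ _ two_ne_zero]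
      _ ≤ r i := (hρr i).le
  · calc
      ∑ i ∈ t, h (r i) ≤ ∑' i, h (r i) := ENNReal.sum_le_tsum t
      _ ≤ ∑' i, (h (Metric.ediam (A i)) + c i) := ENNReal.tsum_le_tsum hhr
      _ = ∑' i, h (Metric.ediam (A i)) + ∑' i, c i := ENNReal.tsum_add
      _ ≤ η / 2 + η / 2 := add_le_add hsum.le hcsum.le
      _ = η := ENNReal.add_halves η

/-- Finitely many positive, finite extended reals have a common positive real lower bound. -/
lemma exists_pos_ofReal_le_of_finset {ι : Type*} (t : Finset ι) {r : ι → ℝ≥0∞}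
    (hr : ∀ i, 0 < r i) : ∃ ε : ℝ, 0 < ε ∧ ∀ i ∈ t, ENNReal.ofReal ε ≤ r i := by
  have hpos : 0 < t.inf r := (Finset.lt_inf_iff ENNReal.zero_lt_top).2 fun i _ => hr i
  obtain ⟨ε, hε, hεr⟩ := ENNReal.lt_iff_exists_nnreal_btwn.1 hpos
  refine ⟨ε, by exact_mod_cast hε, fun i hi => ?_⟩
  rw [ENNReal.ofReal_coe_nnreal]
  exact hεr.le.trans (Finset.inf_le hi)

lemma ediam_prod_le_of_le {X Y : Type*} [PseudoEMetricSpace X] [PseudoEMetricSpace Y]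
    {s : Set X} {t : Set Y} {r : ℝ≥0∞} (hs : Metric.ediam s ≤ r) (ht : Metric.ediam t ≤ r) :
    Metric.ediam (s ×ˢ t) ≤ r :=
  Metric.ediam_le fun _ hp _ hq => max_le (Metric.edist_le_of_ediam_le hp.1 hq.1 hs)
    (Metric.edist_le_of_ediam_le hp.2 hq.2 ht)

/-- The product of a space of strong measure zero and a compact set of measure zero for the
Hausdorff measure of a gauge has covers by small sets with small total gauge. -/
lemma HasSMZ.exists_cover_univ_prod {X Y : Type*} [MetricSpace X] [EMetricSpace Y]
    [MeasurableSpace Y] [BorelSpace Y] (hX : HasSMZ X) {h : ℝ≥0∞ → ℝ≥0∞} (hh : IsGauge h)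
    {K : Set Y} (hK : IsCompact K) (hK0 : Measure.mkMetric h K = 0) {δ η : ℝ≥0∞} (hδ : 0 < δ)
    (hδt : δ ≠ ∞) (hη : 0 < η) :
    ∃ (t : ℕ → Finset ℕ) (V : (Σ n, t n) → Set (X × Y)),
      (∀ p, Metric.ediam (V p) ≤ δ) ∧ univ ×ˢ K ⊆ ⋃ p, V p ∧
        ∑' p, h (Metric.ediam (V p)) ≤ η := by
  obtain ⟨c, hc, hcsum⟩ := ENNReal.exists_pos_sum_of_countable' hη.ne' ℕ
  choose t E r hKE hEr hsum using fun n => hh.exists_finite_cover_of_mkMetric_eq_zero hK hK0 hδ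
    hδt (hc n)
  choose ε hε hεr using fun n => exists_pos_ofReal_le_of_finset (t n) fun i => (hEr n i).2.1
  obtain ⟨U, hU, hUε⟩ := hX ε hε
  have hdiam : ∀ p : Σ n, t n, Metric.ediam (U p.1 ×ˢ E p.1 p.2) ≤ r p.1 p.2 := fun p =>
    ediam_prod_le_of_le ((hUε p.1).trans (hεr p.1 p.2 p.2.2)) (hEr p.1 p.2).1
  refine ⟨t, fun p => U p.1 ×ˢ E p.1 p.2, fun p => (hdiam p).trans (hEr p.1 p.2).2.2, ?_, ?_⟩
  · rintro ⟨x, y⟩ ⟨-, hy⟩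
    obtain ⟨n, hn⟩ := hU x
    obtain ⟨i, hi, hyi⟩ := mem_iUnion₂.1 (hKE n hy)
    exact mem_iUnion.2 ⟨⟨n, i, hi⟩, hn, hyi⟩
  · calc
      ∑' p : Σ n, t n, h (Metric.ediam (U p.1 ×ˢ E p.1 p.2))
          ≤ ∑' p : Σ n, t n, h (r p.1 p.2) := ENNReal.tsum_le_tsum fun p => hh.1 (hdiam p)
      _ = ∑' n, ∑ i ∈ t n, h (r n i) := by
        rw [ENNReal.tsum_sigma']
        exact tsum_congr fun n => Finset.tsum_subtype (t n) fun i => h (r n i)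
      _ ≤ ∑' n, c n := ENNReal.tsum_le_tsum hsum
      _ ≤ η := hcsum.le

/-- If `X` has strong measure zero, `h` is a gauge and `Y` is a σ-compact metric space with
`ℋ^h Y = 0`, then `ℋ^h (X × Y) = 0` (maximum metric on the product). -/
theorem stmt3 (X Y : Type) [MetricSpace X] [MetricSpace Y] [SigmaCompactSpace Y]
    [MeasurableSpace Y] [BorelSpace Y] [MeasurableSpace (X × Y)] [BorelSpace (X × Y)]
    (hX : HasSMZ X) (h : ℝ≥0∞ → ℝ≥0∞) (hgauge : IsGauge h)
    (hY : Measure.mkMetric h (Set.univ : Set Y) = 0) :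
    Measure.mkMetric h (Set.univ : Set (X × Y)) = 0 := by
  have hcompact : ∀ m, Measure.mkMetric h ((univ : Set X) ×ˢ compactCovering Y m) = 0 := by
    intro m
    have hpos : ∀ n : ℕ, (0 : ℝ≥0∞) < ((n : ℝ≥0∞) + 1)⁻¹ := fun n =>
      ENNReal.inv_pos.2 (by finiteness)
    have hlim : Tendsto (fun n : ℕ => ((n : ℝ≥0∞) + 1)⁻¹) atTop (𝓝 0) := by
      simpa using (tendsto_add_atTop_iff_nat 1).2 ENNReal.tendsto_inv_nat_nhds_zero
    choose t V hVδ hV hsum using fun n : ℕ => hX.exists_cover_univ_prod hgauge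
      (isCompact_compactCovering Y m) (measure_mono_null (subset_univ _) hY) (hpos n)
      (ENNReal.inv_ne_top.2 (by simp)) (hpos n)
    refine le_antisymm ?_ zero_le
    calc
      _ ≤ liminf (fun n => ∑' p, h (Metric.ediam (V n p))) atTop :=
        Measure.mkMetric_le_liminf_tsum _ _ hlim V (.of_forall hVδ) (.of_forall hV) h
      _ ≤ liminf (fun n : ℕ => ((n : ℝ≥0∞) + 1)⁻¹) atTop := liminf_le_liminf (.of_forall hsum)
      _ = 0 := hlim.liminf_eq
  rw [← univ_prod_univ, ← iUnion_compactCovering Y, prod_iUnion]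
  exact measure_iUnion_null hcompact
end

section
/- A metric space X has strong measure zero if and only if ℋ^1(X × C_I) = 0 for every infinite set I ⊆ ℕ, where C_I = {x ∈ 2^ℕ : x(i) = 0 for all i ∈ I} carries the least-difference metric of the Cantor space, X × C_I carries the maximum metric, and ℋ^1 is the 1-dimensional Hausdorff measure. -/
open MeasureTheory Set Filter Pointwise
open scoped ENNReal NNReal Topology

theorem Cantor.edist_le_iff (x y : Cantor) (n : ℕ) :
    edist x y ≤ (2⁻¹ : ℝ≥0∞) ^ n ↔ ∀ i < n, x i = y i := by
  have h : (2⁻¹ : ℝ≥0∞) ^ n = ENNReal.ofReal ((1 / 2) ^ n) := by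
    rw [ENNReal.ofReal_pow (by norm_num), one_div, ENNReal.ofReal_inv_of_pos two_pos,
      ENNReal.ofReal_ofNat]
  rw [h, edist_dist, ENNReal.ofReal_le_ofReal_iff (by positivity)]
  exact PiNat.mem_cylinder_iff_dist_le.symm

theorem ENNReal.exists_two_inv_pow_near {d : ℝ≥0∞} (h₀ : 0 < d) (h₁ : d ≤ 1) :
    ∃ n : ℕ, d ≤ 2⁻¹ ^ n ∧ 2⁻¹ ^ n ≤ 2 * d := by
  lift d to ℝ≥0 using ne_top_of_le_ne_top ENNReal.one_ne_top h₁
  have h₂ : (2⁻¹ : ℝ≥0∞) = ((2⁻¹ : ℝ≥0) : ℝ≥0∞) := by simp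
  obtain ⟨n, hn, hn'⟩ := exists_nat_pow_near_of_lt_one (x := d) (y := 2⁻¹)
    (by simpa using h₀) (by simpa using h₁) (by simp) (by
      rw [← NNReal.coe_lt_coe]; norm_num)
  refine ⟨n, by rw [h₂]; exact_mod_cast hn', ?_⟩
  rw [h₂]
  norm_cast
  calc (2⁻¹ : ℝ≥0) ^ n = 2 * 2⁻¹ ^ (n + 1) := by rw [pow_succ]; field_simp
    _ ≤ 2 * d := by gcongr

/-- The product of the point mass at `a` on the coordinates in `I` and of the uniform
distributions on the others, as an outer measure. -/
theorem exists_outerMeasure_sequences {α : Type*} [Fintype α] [MeasurableSpace α]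
    [MeasurableSingletonClass α] (a : α) (I : Set ℕ) [DecidablePred (· ∈ I)] :
    ∃ m : OuterMeasure (ℕ → α), m {c | ∀ i ∈ I, c i = a} = 1 ∧ ∀ (z : ℕ → α) (n : ℕ),
      m {c | ∀ i < n, c i = z i} ≤
        (Fintype.card α : ℝ≥0∞) ^ ((Finset.range n).filter (· ∈ I)).card *
          (Fintype.card α : ℝ≥0∞)⁻¹ ^ n := by
  have : Nonempty α := ⟨a⟩
  let p : ℕ → PMF α := fun i => if i ∈ I then PMF.pure a else PMF.uniformOfFintype α
  let P := Measure.infinitePi fun i => (p i).toMeasure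
  refine ⟨P.toOuterMeasure, ?_, fun z n => ?_⟩
  · have h : {c : ℕ → α | ∀ i ∈ I, c i = a} = Set.pi I fun _ => {a} := by
      ext c; simp [Set.mem_pi]
    change P _ = 1
    rw [h, Measure.infinitePi_pi_of_countable _ (Set.to_countable I) (by simp)]
    have : ∀ i : I, (p i).toMeasure {a} = 1 := fun i => by
      rw [PMF.toMeasure_apply_singleton _ _ (by simp)]
      simp [p]
    simp [this]
  · have h : {c : ℕ → α | ∀ i < n, c i = z i} =
        Set.pi (Finset.range n : Set ℕ) fun i => {z i} := by
      ext c; simp [Set.mem_pi]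
    change P _ ≤ _
    rw [h, Measure.infinitePi_pi _ (by simp)]
    calc ∏ i ∈ Finset.range n, (p i).toMeasure {z i}
        ≤ ∏ i ∈ Finset.range n, ((if i ∈ I then (Fintype.card α : ℝ≥0∞) else 1) *
            (Fintype.card α : ℝ≥0∞)⁻¹) := by
          refine Finset.prod_le_prod' fun i _ => ?_
          rw [PMF.toMeasure_apply_singleton _ _ (by simp)]
          by_cases hi : i ∈ I
          · simpa [hi, ENNReal.mul_inv_cancel] using PMF.coe_le_one _ _
          · simp [p, hi]
      _ = _ := by
          rw [Finset.prod_mul_distrib, Finset.prod_ite]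
          simp

theorem HasSMZ.hausdorffMeasure_prod_CI {X : Type*} [MetricSpace X] (hX : HasSMZ X)
    [MeasurableSpace (X × Cantor)] [BorelSpace (X × Cantor)] {I : Set ℕ} (hI : I.Infinite) :
    μH[1] ((Set.univ : Set X) ×ˢ CI I) = 0 := by
  classical
  have hn : ∀ m k : ℕ, ∃ n, m ≤ n ∧ m + k ≤ ((Finset.range n).filter (· ∈ I)).card := by
    intro m k
    obtain ⟨F, hF, hc⟩ := hI.exists_subset_card_eq (m + k)
    refine ⟨max m (F.sup id + 1), le_max_left _ _, hc ▸ Finset.card_le_card fun i hi => ?_⟩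
    have : i ≤ F.sup id := Finset.le_sup (f := id) hi
    simp only [Finset.mem_filter, Finset.mem_range]
    exact ⟨by omega, hF hi⟩
  choose n hmn hcard using hn
  choose U hU hdiam using fun m => hX (fun k => (1 / 2) ^ n m k) fun k => by positivity
  let ι : ℕ → Type := fun m => Σ k, ((Finset.range (n m k)).filter (· ∉ I) → ZMod 2)
  let t : ∀ m, ι m → Set (X × Cantor) := fun m w =>
    U m w.1 ×ˢ {c | c ∈ CI I ∧ ∀ i, c i.1 = w.2 i}
  have ht : ∀ m w, Metric.ediam (t m w) ≤ 2⁻¹ ^ n m w.1 := by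
    rintro m ⟨k, w⟩
    refine Metric.ediam_le ?_
    rintro ⟨x, c⟩ ⟨hx, hc, hcw⟩ ⟨y, d⟩ ⟨hy, hd, hdw⟩
    refine max_le ?_ ?_
    · refine (Metric.edist_le_of_ediam_le hx hy (hdiam m k)).trans_eq ?_
      rw [ENNReal.ofReal_pow (by norm_num), one_div, ENNReal.ofReal_inv_of_pos two_pos,
        ENNReal.ofReal_ofNat]
    · refine (Cantor.edist_le_iff c d _).2 fun i hi => ?_
      by_cases hiI : i ∈ I
      · exact (hc i hiI).trans (hd i hiI).symm
      · have hi' : i ∈ (Finset.range (n m k)).filter (· ∉ I) := by simp_all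
        exact (hcw ⟨i, hi'⟩).trans (hdw ⟨i, hi'⟩).symm
  have htend : Tendsto (fun m : ℕ => (2⁻¹ : ℝ≥0∞) ^ m) atTop (𝓝 0) :=
    ENNReal.tendsto_pow_atTop_nhds_zero_of_lt_one (by simp)
  have hsum : ∀ m, ∑' w, Metric.ediam (t m w) ^ (1 : ℝ) ≤ 2⁻¹ ^ m * 2 := by
    intro m
    calc ∑' w, Metric.ediam (t m w) ^ (1 : ℝ) ≤ ∑' w : ι m, 2⁻¹ ^ n m w.1 :=
          ENNReal.tsum_le_tsum fun w => by simpa using ht m w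
      _ = ∑' k, 2 ^ ((Finset.range (n m k)).filter (· ∉ I)).card * 2⁻¹ ^ n m k := by
          rw [ENNReal.tsum_sigma']
          refine tsum_congr fun k => ?_
          simp [tsum_fintype, ZMod.card]
      _ ≤ ∑' k, 2⁻¹ ^ m * 2⁻¹ ^ k := by
          refine ENNReal.tsum_le_tsum fun k => ?_
          have hk := hcard m k
          generalize n m k = N at hk ⊢
          have h : ((Finset.range N).filter (· ∈ I)).card +
              ((Finset.range N).filter (· ∉ I)).card = N := by
            rw [Finset.card_filter_add_card_filter_not, Finset.card_range]
          calc (2 : ℝ≥0∞) ^ ((Finset.range N).filter (· ∉ I)).card * 2⁻¹ ^ N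
              = 2⁻¹ ^ ((Finset.range N).filter (· ∈ I)).card := by
                have e : (2⁻¹ : ℝ≥0∞) ^ N = 2⁻¹ ^ ((Finset.range N).filter (· ∈ I)).card *
                    2⁻¹ ^ ((Finset.range N).filter (· ∉ I)).card := by rw [← pow_add, h]
                rw [e, mul_left_comm, ← mul_pow,
                  ENNReal.mul_inv_cancel two_ne_zero ENNReal.ofNat_ne_top, one_pow, mul_one]
            _ ≤ 2⁻¹ ^ (m + k) := pow_le_pow_right_of_le_one' (by simp) hk
            _ = _ := pow_add _ _ _
      _ = 2⁻¹ ^ m * 2 := by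
          rw [ENNReal.tsum_mul_left, ENNReal.tsum_geometric, ENNReal.one_sub_inv_two, inv_inv]
  have key := Measure.hausdorffMeasure_le_liminf_tsum 1 ((Set.univ : Set X) ×ˢ CI I)
    (fun m : ℕ => (2⁻¹ : ℝ≥0∞) ^ m) htend t
    (Eventually.of_forall fun m w => (ht m w).trans
      (pow_le_pow_right_of_le_one' (by simp) (hmn m w.1)))
    (Eventually.of_forall fun m p hp => by
      obtain ⟨k, hk⟩ := hU m p.1
      exact mem_iUnion.2 ⟨⟨k, fun i => p.2 i⟩, hk, hp.2, fun _ => rfl⟩)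
  have htend' : Tendsto (fun m : ℕ => (2⁻¹ : ℝ≥0∞) ^ m * 2) atTop (𝓝 0) := by
    simpa using ENNReal.Tendsto.mul_const (b := 2) htend (Or.inr ENNReal.ofNat_ne_top)
  have hlim := tendsto_of_tendsto_of_tendsto_of_le_of_le tendsto_const_nhds htend'
    (fun m => zero_le) hsum
  exact le_antisymm (key.trans_eq hlim.liminf_eq) zero_le

theorem exists_cover_of_card_separated_le {X : Type*} [PseudoEMetricSpace X] {A : Set X}
    {δ : ℝ≥0∞} {N : ℕ} (h : ∀ F : Finset X, (F : Set X) ⊆ A →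
      (F : Set X).Pairwise (fun x y => δ < edist x y) → F.card ≤ N) :
    ∃ U : ℕ → Set X, (∀ x ∈ A, ∃ t < N, x ∈ U t) ∧ ∀ t, Metric.ediam (U t) ≤ 2 * δ := by
  classical
  let S : Set ℕ := {n | ∃ F : Finset X, (F : Set X) ⊆ A ∧
    (F : Set X).Pairwise (fun x y => δ < edist x y) ∧ F.card = n}
  have hbdd : BddAbove S := ⟨N, by rintro _ ⟨F, hF, hF', rfl⟩; exact h F hF hF'⟩
  obtain ⟨F, hFA, hFsep, hF⟩ : sSup S ∈ S := Nat.sSup_mem ⟨0, ∅, by simp⟩ hbdd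
  have hcov : ∀ x ∈ A, ∃ y ∈ F, edist x y ≤ δ := by
    intro x hx
    by_contra! hfar
    have hxF : x ∉ F := fun hxF => by simpa using hfar x hxF
    have hmem : F.card + 1 ∈ S := by
      refine ⟨insert x F, ?_, ?_, Finset.card_insert_of_notMem hxF⟩
      · simpa [Set.insert_subset_iff] using ⟨hx, hFA⟩
      · rw [Finset.coe_insert]
        exact hFsep.insert fun y hy _ => ⟨hfar y hy, edist_comm x y ▸ hfar y hy⟩
    have := le_csSup hbdd hmem
    omega
  refine ⟨fun t => if ht : t < F.card then Metric.closedEBall (F.equivFin.symm ⟨t, ht⟩ : X) δ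
    else ∅, fun x hx => ?_, fun t => ?_⟩
  · obtain ⟨y, hy, hxy⟩ := hcov x hx
    refine ⟨F.equivFin ⟨y, hy⟩, (F.equivFin ⟨y, hy⟩).2.trans_le (h F hFA hFsep), ?_⟩
    simpa using hxy
  · dsimp only
    split_ifs
    · exact Metric.ediam_closedEBall_le
    · simp

theorem exists_dyadic_cover_of_hausdorffMeasure_eq_zero {Y : Type*} [EMetricSpace Y]
    [MeasurableSpace Y] [BorelSpace Y] {S : Set Y} (hS : μH[1] S = 0) {c : ℝ≥0∞} (hc : 0 < c)
    (hc₁ : c ≤ 1) :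
    ∃ (E : ℕ → Set Y) (n : ℕ → ℕ), S ⊆ ⋃ j, E j ∧ (∀ j, Metric.ediam (E j) ≤ 2⁻¹ ^ n j) ∧
      ∑' j, 2⁻¹ ^ n j ≤ c := by
  have hc4 : 0 < c / 4 := ENNReal.div_pos hc.ne' ENNReal.ofNat_ne_top
  obtain ⟨E, hSE, hE⟩ : ∃ E : ℕ → Set Y, S ⊆ ⋃ j, E j ∧ ∑' j, Metric.ediam (E j) < c / 4 := by
    rw [Measure.hausdorffMeasure_apply] at hS
    have h := (ENNReal.iSup_eq_zero.1 (ENNReal.iSup_eq_zero.1 hS 1) one_pos).trans_lt hc4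
    simp only [iInf_lt_iff] at h
    obtain ⟨E, hSE, -, hE⟩ := h
    refine ⟨E, hSE, (ENNReal.tsum_le_tsum fun j => ?_).trans_lt hE⟩
    rcases (E j).eq_empty_or_nonempty with h | h <;> simp [h]
  obtain ⟨δ, hδ, hδc⟩ := ENNReal.exists_pos_sum_of_countable' hc4.ne' ℕ
  have hsum : ∑' j, (Metric.ediam (E j) + δ j) ≤ c / 2 := by
    rw [ENNReal.tsum_add]
    calc _ ≤ c / 4 + c / 4 := add_le_add hE.le hδc.le
      _ = c / 2 := by
        rw [← two_mul, div_eq_mul_inv, div_eq_mul_inv, show (4 : ℝ≥0∞) = 2 * 2 by norm_num,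
          ENNReal.mul_inv (by simp) (by simp), mul_comm c, ← mul_assoc, ← mul_assoc,
          ENNReal.mul_inv_cancel (by simp) (by simp), one_mul, mul_comm]
  choose n hn hn' using fun j => ENNReal.exists_two_inv_pow_near
    (d := Metric.ediam (E j) + δ j) (lt_of_lt_of_le (hδ j) le_add_self)
    ((ENNReal.le_tsum j).trans (hsum.trans (ENNReal.half_le_self.trans hc₁)))
  refine ⟨E, n, hSE, fun j => le_self_add.trans (hn j), ?_⟩
  calc ∑' j, 2⁻¹ ^ n j ≤ ∑' j, 2 * (Metric.ediam (E j) + δ j) := ENNReal.tsum_le_tsum hn'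
    _ ≤ 2 * (c / 2) := by rw [ENNReal.tsum_mul_left]; gcongr
    _ = c := ENNReal.mul_div_cancel (by simp) (by simp)

theorem StrictMono.exists_between_succ {i : ℕ → ℕ} (hi : StrictMono i) {n : ℕ} (hn : i 0 < n) :
    ∃ k, i k < n ∧ n ≤ i (k + 1) := by
  refine ⟨Nat.findGreatest (i · < n) n, Nat.findGreatest_spec (P := (i · < n)) n.zero_le hn, ?_⟩
  by_contra! h
  exact Nat.findGreatest_is_greatest (P := (i · < n)) (Nat.lt_succ_self _)
    (((hi.id_le _).trans_lt h).le) h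

theorem HasSMZ.of_hausdorffMeasure_prod_CI {X : Type*} [MetricSpace X]
    [MeasurableSpace (X × Cantor)] [BorelSpace (X × Cantor)]
    (H : ∀ I : Set ℕ, I.Infinite → μH[1] ((Set.univ : Set X) ×ˢ CI I) = 0) : HasSMZ X := by
  classical
  intro ε hε
  have htend : Tendsto (fun n : ℕ => 2 * (2⁻¹ : ℝ≥0∞) ^ n) atTop (𝓝 0) := by
    simpa using ENNReal.Tendsto.const_mul (a := 2)
      (ENNReal.tendsto_pow_atTop_nhds_zero_of_lt_one (r := 2⁻¹) (by simp))
      (Or.inr ENNReal.ofNat_ne_top)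
  obtain ⟨i, hi, hiε⟩ := extraction_forall_of_eventually
    (P := fun k n => ∀ t < 2 ^ (2 * k + 3),
      2 * (2⁻¹ : ℝ≥0∞) ^ n ≤ ENNReal.ofReal (ε (Nat.pair k t))) fun k => by
    refine (eventually_all_finite (Set.finite_lt_nat (2 ^ (2 * k + 3)))).2 fun t _ => ?_
    exact htend.eventually_le_const (ENNReal.ofReal_pos.2 (hε _))
  obtain ⟨m, hm, hmcyl⟩ := exists_outerMeasure_sequences (0 : ZMod 2) (range i)
  obtain ⟨E, n, hE, hEn, hsum⟩ := exists_dyadic_cover_of_hausdorffMeasure_eq_zero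
    (H (range i) (infinite_range_of_injective hi.injective)) (c := 2⁻¹ ^ (i 0 + 1))
    (ENNReal.pow_pos (by simp) _) (pow_le_one' (by simp) _)
  have hn : ∀ j, i 0 < n j := fun j => by
    by_contra! h
    have h₁ := ((pow_le_pow_right_of_le_one' (a := (2⁻¹ : ℝ≥0∞)) (by simp) h).trans
      (ENNReal.le_tsum j)).trans hsum
    rw [← ENNReal.inv_pow, ← ENNReal.inv_pow, ENNReal.inv_le_inv] at h₁
    norm_cast at h₁
    exact absurd h₁ (Nat.pow_lt_pow_succ one_lt_two).not_ge
  choose κ hκ hκ' using fun j => hi.exists_between_succ (hn j)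
  let a : ℕ → ℝ≥0∞ := fun j => m {c | ∃ x, (x, c) ∈ E j}
  have ha : ∀ j, a j ≤ 2 ^ (κ j + 1) * 2⁻¹ ^ n j := by
    intro j
    rcases (E j).eq_empty_or_nonempty with h | ⟨⟨x, z⟩, hz⟩
    · simp [a, h]
    · have hsub : {c | ∃ x, (x, c) ∈ E j} ⊆ {c | ∀ l < n j, c l = z l} := by
        rintro c ⟨y, hy⟩
        exact (Cantor.edist_le_iff c z _).1
          ((le_max_right _ _).trans (Metric.edist_le_of_ediam_le hy hz (hEn j)))
      have hcard : ((Finset.range (n j)).filter (· ∈ range i)).card ≤ κ j + 1 := by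
        refine (Finset.card_le_card (t := (Finset.range (κ j + 1)).image i) ?_).trans
          (Finset.card_image_le.trans_eq (Finset.card_range _))
        intro l hl
        obtain ⟨hl, k, rfl⟩ := Finset.mem_filter.1 hl
        exact Finset.mem_image_of_mem _ (Finset.mem_range.2
          (hi.lt_iff_lt.1 ((Finset.mem_range.1 hl).trans_le (hκ' j))))
      refine (m.mono hsub).trans ((hmcyl z (n j)).trans ?_)
      rw [ZMod.card, Nat.cast_ofNat]
      gcongr
      norm_num
  let f : ℕ → X → ℝ≥0∞ := fun k x =>
    ∑' j, if κ j = k ∧ ∃ c, (x, c) ∈ E j then a j else 0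
  have hf : ∀ x, ∃ k, 2⁻¹ ^ (k + 2) ≤ f k x := by
    intro x
    by_contra! hlt
    have : (1 : ℝ≥0∞) ≤ 2⁻¹ :=
      calc (1 : ℝ≥0∞) = m (CI (range i)) := hm.symm
        _ ≤ m (⋃ j, {c | (x, c) ∈ E j}) := m.mono fun c hc => by
            simpa using hE (show (x, c) ∈ univ ×ˢ CI (range i) from ⟨trivial, hc⟩)
        _ ≤ ∑' j, m {c | (x, c) ∈ E j} := measure_iUnion_le _
        _ ≤ ∑' j, if ∃ c, (x, c) ∈ E j then a j else 0 := by
            refine ENNReal.tsum_le_tsum fun j => ?_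
            split_ifs with h
            · exact m.mono fun c hc => ⟨x, hc⟩
            · push Not at h
              simp [h]
        _ = ∑' j, ∑' k, if κ j = k ∧ ∃ c, (x, c) ∈ E j then a j else 0 := by
            refine tsum_congr fun j => ?_
            simp only [ite_and]
            exact ((tsum_congr fun k => by simp only [eq_comm]).trans
              (tsum_ite_eq (κ j) fun _ => if ∃ c, (x, c) ∈ E j then a j else 0)).symm
        _ = ∑' k, f k x := ENNReal.tsum_comm
        _ ≤ ∑' k, 2⁻¹ ^ (k + 2) := ENNReal.tsum_le_tsum fun k => (hlt k).le
        _ = 2⁻¹ := by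
            simp only [pow_add]
            rw [ENNReal.tsum_mul_right, ENNReal.tsum_geometric, ENNReal.one_sub_inv_two, inv_inv,
              pow_two, ← mul_assoc, ENNReal.mul_inv_cancel (by simp) (by simp), one_mul]
    exact absurd this (by simp)
  have hpack : ∀ k (F : Finset X), (F : Set X) ⊆ {x | 2⁻¹ ^ (k + 2) ≤ f k x} →
      (F : Set X).Pairwise (fun x y => 2⁻¹ ^ i k < edist x y) → F.card ≤ 2 ^ (2 * k + 3) := by
    intro k F hF hsep
    have h : (F.card : ℝ≥0∞) * 2⁻¹ ^ (k + 2) ≤ 2 ^ (k + 1) :=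
      calc (F.card : ℝ≥0∞) * 2⁻¹ ^ (k + 2) = ∑ x ∈ F, 2⁻¹ ^ (k + 2) := by simp
        _ ≤ ∑ x ∈ F, f k x := Finset.sum_le_sum fun x hx => hF hx
        _ = ∑' j, ∑ x ∈ F, if κ j = k ∧ ∃ c, (x, c) ∈ E j then a j else 0 :=
            (Summable.tsum_finsetSum fun _ _ => ENNReal.summable).symm
        _ ≤ ∑' j, 2 ^ (k + 1) * 2⁻¹ ^ n j := by
            refine ENNReal.tsum_le_tsum fun j => ?_
            by_cases hj : κ j = k
            · subst hj
              have hone : (F.filter fun x => ∃ c, (x, c) ∈ E j).card ≤ 1 := by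
                refine Finset.card_le_one.2 fun x hx y hy => ?_
                obtain ⟨hx, c, hc⟩ := Finset.mem_filter.1 hx
                obtain ⟨hy, d, hd⟩ := Finset.mem_filter.1 hy
                by_contra hxy
                refine (hsep hx hy hxy).not_ge ((le_max_left _ _).trans
                  ((Metric.edist_le_of_ediam_le hc hd (hEn j)).trans ?_))
                exact pow_le_pow_right_of_le_one' (by simp) (hκ j).le
              simp only [true_and]
              rw [← Finset.sum_filter, Finset.sum_const, nsmul_eq_mul]
              calc _ ≤ 1 * a j := by gcongr; exact_mod_cast hone
                _ ≤ _ := by rw [one_mul]; exact ha j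
            · simp [hj]
        _ ≤ 2 ^ (k + 1) * 1 := by
            rw [ENNReal.tsum_mul_left]
            gcongr
            exact hsum.trans (pow_le_one' (by simp) _)
        _ = _ := mul_one _
    have h' : (F.card : ℝ≥0∞) ≤ 2 ^ (2 * k + 3) :=
      calc (F.card : ℝ≥0∞) = F.card * 2⁻¹ ^ (k + 2) * 2 ^ (k + 2) := by
            rw [mul_assoc, ← mul_pow, ENNReal.inv_mul_cancel (by simp) (by simp), one_pow, mul_one]
        _ ≤ 2 ^ (k + 1) * 2 ^ (k + 2) := by gcongr
        _ = _ := by rw [← pow_add]; congr 1; ring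
    exact_mod_cast h'
  choose U hU hdiam using fun k => exists_cover_of_card_separated_le (hpack k)
  refine ⟨fun l => if l.unpair.2 < 2 ^ (2 * l.unpair.1 + 3) then U l.unpair.1 l.unpair.2 else ∅,
    fun x => ?_, fun l => ?_⟩
  · obtain ⟨k, hk⟩ := hf x
    obtain ⟨t, ht, hx⟩ := hU k x hk
    exact ⟨Nat.pair k t, by simpa [ht] using hx⟩
  · change Metric.ediam (if _ then _ else _) ≤ _
    split_ifs with hl
    · simpa using (hdiam _ _).trans (hiε _ _ hl)
    · simp

/-- A metric space `X` has strong measure zero iff `ℋ^1 (X × C_I) = 0` for every infinite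
`I ⊆ ℕ` (maximum metric on the product). -/
theorem stmt4 (X : Type) [MetricSpace X]
    [MeasurableSpace (X × Cantor)] [BorelSpace (X × Cantor)] :
    HasSMZ X ↔
      ∀ I : Set ℕ, I.Infinite → μH[1] ((Set.univ : Set X) ×ˢ CI I) = 0 := by
  exact ⟨fun hX _ hI => hX.hausdorffMeasure_prod_CI hI, HasSMZ.of_hausdorffMeasure_prod_CI⟩
end

section
/- Let h be a gauge and E a set in a metric space X. Then E can be written as a countable union of sets E_k such that for every ε > 0 each E_k admits a finite cover 𝒢 with ∑_{G∈𝒢} h(diam G) < ε, if and only if E admits a γ-groupable cover ⟨U_n⟩ (of E) with ∑_{n∈ℕ} h(diam U_n) < ∞. -/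
open MeasureTheory Set Filter Pointwise
open scoped ENNReal NNReal Topology

/-- Any function on a finset that vanishes at `a` can be summed along a nonempty finite sequence
enumerating the finset, padded with `a`. -/
theorem Finset.exists_seq_enumeration {α : Type*} (w : α → ℝ≥0∞) (a : α) (ha : w a = 0)
    (s : Finset α) :
    ∃ m : ℕ, 0 < m ∧ ∃ f : ℕ → α, (∀ x ∈ s, ∃ i < m, f i = x) ∧
      ∑ i ∈ Finset.range m, w (f i) = ∑ x ∈ s, w x := by
  classical
  induction s using Finset.induction_on with
  | empty => exact ⟨1, one_pos, fun _ => a, by simp, by simp [ha]⟩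
  | insert b s hb ih =>
    obtain ⟨m, hm, f, hf, hsum⟩ := ih
    refine ⟨m + 1, by omega, Function.update f m b, ?_, ?_⟩
    · intro x hx
      rcases Finset.mem_insert.1 hx with rfl | hx
      · exact ⟨m, by omega, by simp⟩
      · obtain ⟨i, hi, rfl⟩ := hf x hx
        exact ⟨i, by omega, by rw [Function.update_of_ne (by omega)]⟩
    · rw [Finset.sum_range_succ, Finset.sum_insert hb, ← hsum, Function.update_self, add_comm]
      congr 1
      refine Finset.sum_congr rfl fun i hi => ?_
      rw [Function.update_of_ne (by have := Finset.mem_range.1 hi; omega)]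

/-- Nonempty finite blocks can be concatenated into one sequence. -/
theorem exists_concat_blocks {α : Type*} (m : ℕ → ℕ) (hm : ∀ j, 0 < m j) (f : ℕ → ℕ → α) :
    ∃ U : ℕ → α, ∀ j, ∀ i < m j, U ((∑ l ∈ Finset.range j, m l) + i) = f j i := by
  set k : ℕ → ℕ := fun j => ∑ l ∈ Finset.range j, m l with hk
  have hsucc : ∀ j, k (j + 1) = k j + m j := fun j => Finset.sum_range_succ _ _
  have hmono : StrictMono k := strictMono_nat_of_lt_succ fun j => by
    rw [hsucc]; exact Nat.lt_add_of_pos_right (hm j)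
  refine ⟨fun n => f (Nat.findGreatest (fun j => k j ≤ n) n)
    (n - k (Nat.findGreatest (fun j => k j ≤ n) n)), fun j i hi => ?_⟩
  have hj : Nat.findGreatest (fun l => k l ≤ k j + i) (k j + i) = j := by
    rw [Nat.findGreatest_eq_iff]
    refine ⟨(hmono.le_apply).trans (Nat.le_add_right _ _), fun _ => Nat.le_add_right _ _, ?_⟩
    intro l hl _ hle
    have := hmono.monotone (Nat.succ_le_of_lt hl)
    have := hsucc j
    simp only [Nat.succ_eq_add_one] at *
    omega
  change f (Nat.findGreatest (fun l => k l ≤ k j + i) (k j + i))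
    (k j + i - k (Nat.findGreatest (fun l => k l ≤ k j + i) (k j + i))) = _
  rw [hj, Nat.add_sub_cancel_left]

/-- A sum over an indexed union of finsets is at most the iterated sum. -/
theorem Finset.sum_biUnion_le_sum_sum {ι α : Type*} [DecidableEq α] (w : α → ℝ≥0∞)
    (s : Finset ι) (t : ι → Finset α) :
    ∑ x ∈ s.biUnion t, w x ≤ ∑ i ∈ s, ∑ x ∈ t i, w x := by
  classical
  induction s using Finset.induction_on with
  | empty => simp
  | insert i s hi ih =>
    rw [Finset.biUnion_insert, Finset.sum_insert hi]
    calc ∑ x ∈ t i ∪ s.biUnion t, w x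
        ≤ ∑ x ∈ t i ∪ s.biUnion t, w x + ∑ x ∈ t i ∩ s.biUnion t, w x := le_self_add
      _ = ∑ x ∈ t i, w x + ∑ x ∈ s.biUnion t, w x := Finset.sum_union_inter
      _ ≤ _ := by gcongr

/-- `E` is a countable union of sets each of which has, for every `ε > 0`, a finite cover `𝒢`
with `∑_{G ∈ 𝒢} h (diam G) < ε`, iff `E` has a γ-groupable cover `⟨U n⟩` with
`∑ₙ h (diam (U n)) < ∞`. -/
theorem stmt6 {X : Type} [MetricSpace X] (h : ℝ≥0∞ → ℝ≥0∞) (hgauge : IsGauge h) (E : Set X) :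
    (∃ Ek : ℕ → Set X, E = ⋃ k, Ek k ∧
        ∀ k, ∀ ε : ℝ≥0∞, 0 < ε → ∃ 𝒢 : Finset (Set X),
          (Ek k ⊆ ⋃ G ∈ 𝒢, G) ∧ ∑ G ∈ 𝒢, h (EMetric.diam G) < ε) ↔
      (∃ U : ℕ → Set X, IsGammaGroupable U E ∧ ∑' n, h (EMetric.diam (U n)) < ⊤) := by
  classical
  constructor
  · rintro ⟨Ek, rfl, hE⟩
    have hpos : ∀ i j : ℕ, (0 : ℝ≥0∞) < 2⁻¹ ^ i * 2⁻¹ ^ j := fun i j =>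
      ENNReal.mul_pos (pow_ne_zero _ (by simp)) (pow_ne_zero _ (by simp))
    choose 𝒢 hcov hsum using fun i j : ℕ => hE i _ (hpos i j)
    choose m hm f hf hfsum using fun j : ℕ =>
      Finset.exists_seq_enumeration (fun G : Set X => h (Metric.ediam G)) ∅
        ((congrArg h Metric.ediam_empty).trans hgauge.2.2.1) ((Finset.range (j + 1)).biUnion fun i => 𝒢 i j)
    obtain ⟨U, hU⟩ := exists_concat_blocks m hm f
    have hsucc : ∀ j, ∑ l ∈ Finset.range (j + 1), m l = (∑ l ∈ Finset.range j, m l) + m j :=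
      fun j => Finset.sum_range_succ _ _
    have hmono : StrictMono fun j => ∑ l ∈ Finset.range j, m l :=
      strictMono_nat_of_lt_succ fun j => by
        rw [hsucc]; exact Nat.lt_add_of_pos_right (hm j)
    refine ⟨U, ⟨fun j => ∑ l ∈ Finset.range j, m l, by simp, hmono, ?_⟩, ?_⟩
    · intro x hx
      obtain ⟨i, hi⟩ := mem_iUnion.1 hx
      filter_upwards [eventually_ge_atTop i] with j hj
      obtain ⟨G, hG, hxG⟩ := mem_iUnion₂.1 (hcov i j hi)
      obtain ⟨n, hn, rfl⟩ := hf j G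
        (Finset.mem_biUnion.2 ⟨i, Finset.mem_range.2 (by omega), hG⟩)
      exact ⟨_, Nat.le_add_right _ n, by rw [hsucc]; omega, by rwa [hU j n hn]⟩
    · have hblock : ∀ j, ∑ i ∈ Finset.range (m j), h (Metric.ediam (f j i)) ≤
          2 * 2⁻¹ ^ j := fun j =>
        calc ∑ i ∈ Finset.range (m j), h (Metric.ediam (f j i))
            ≤ ∑ i ∈ Finset.range (j + 1), ∑ G ∈ 𝒢 i j, h (Metric.ediam G) :=
              (hfsum j).trans_le (Finset.sum_biUnion_le_sum_sum _ _ _)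
          _ ≤ ∑ i ∈ Finset.range (j + 1), 2⁻¹ ^ i * 2⁻¹ ^ j :=
              Finset.sum_le_sum fun i _ => (hsum i j).le
          _ ≤ ∑' i : ℕ, 2⁻¹ ^ i * 2⁻¹ ^ j := ENNReal.sum_le_tsum _
          _ = 2 * 2⁻¹ ^ j := by rw [ENNReal.tsum_mul_right, ENNReal.tsum_geometric, ENNReal.one_sub_inv_two, inv_inv]
      have hpart : ∀ N, ∑ n ∈ Finset.range (∑ l ∈ Finset.range N, m l), h (Metric.ediam (U n)) =
          ∑ j ∈ Finset.range N, ∑ i ∈ Finset.range (m j), h (Metric.ediam (f j i)) := by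
        intro N
        induction N with
        | zero => simp
        | succ N ih =>
          rw [hsucc, Finset.sum_range_add, ih, Finset.sum_range_succ]
          congr 1
          refine Finset.sum_congr rfl fun i hi => ?_
          rw [hU N i (Finset.mem_range.1 hi)]
      rw [ENNReal.tsum_eq_iSup_nat' hmono.tendsto_atTop]
      refine lt_of_le_of_lt (b := (2 * 2 : ℝ≥0∞)) (iSup_le fun N => ?_) (by finiteness)
      refine (hpart N).trans_le ?_
      calc _ ≤ ∑ j ∈ Finset.range N, (2 * 2⁻¹ ^ j : ℝ≥0∞) :=
            Finset.sum_le_sum fun j _ => hblock j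
        _ ≤ ∑' j : ℕ, (2 * 2⁻¹ ^ j : ℝ≥0∞) := ENNReal.sum_le_tsum _
        _ = 2 * 2 := by rw [ENNReal.tsum_mul_left, ENNReal.tsum_geometric, ENNReal.one_sub_inv_two, inv_inv]
  · rintro ⟨U, ⟨k, -, hk, hx⟩, hsum⟩
    refine ⟨fun i => {x ∈ E | ∀ j ≥ i, ∃ n, k j ≤ n ∧ n < k (j + 1) ∧ x ∈ U n}, ?_, ?_⟩
    · ext x
      simp only [mem_iUnion, mem_ofPred_eq, exists_and_left]
      exact ⟨fun hxE => ⟨hxE, eventually_atTop.1 (hx x hxE)⟩, fun hxE => hxE.1⟩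
    · intro i ε hε
      have htail := (ENNReal.tendsto_sum_nat_add (fun n => h (Metric.ediam (U n))) hsum.ne).comp
        hk.tendsto_atTop
      obtain ⟨j, hjε, hij⟩ :=
        ((htail.eventually (gt_mem_nhds hε)).and (eventually_ge_atTop i)).exists
      refine ⟨(Finset.Ico (k j) (k (j + 1))).image U, ?_, ?_⟩
      · rintro x ⟨-, hxU⟩
        obtain ⟨n, h1, h2, h3⟩ := hxU j hij
        exact mem_iUnion₂.2
          ⟨U n, Finset.mem_image_of_mem U (Finset.mem_Ico.2 ⟨h1, h2⟩), h3⟩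
      · calc ∑ G ∈ (Finset.Ico (k j) (k (j + 1))).image U, h (Metric.ediam G)
            ≤ ∑ n ∈ Finset.Ico (k j) (k (j + 1)), h (Metric.ediam (U n)) :=
              Finset.sum_image_le_of_nonneg (f := fun G : Set X => h (Metric.ediam G))
                fun _ _ => zero_le
          _ = ∑ n ∈ Finset.range (k (j + 1) - k j), h (Metric.ediam (U (n + k j))) := by
              rw [Finset.sum_Ico_eq_sum_range]
              simp only [add_comm]
          _ ≤ ∑' n, h (Metric.ediam (U (n + k j))) := ENNReal.sum_le_tsum _
          _ < ε := hjε
end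

section
/- If X and Y are metric spaces each having sharp measure zero, then X × Y with the maximum metric has sharp measure zero. -/
open MeasureTheory Set Filter Pointwise
open scoped ENNReal NNReal Topology

/-- Finitely many positive reals have a positive lower bound. -/
theorem exists_pos_forall_lt_le {ε : ℕ → ℝ} (hε : ∀ n, 0 < ε n) (N : ℕ) :
    ∃ η : ℝ, 0 < η ∧ ∀ n < N, η ≤ ε n := by
  induction N with
  | zero => exact ⟨1, one_pos, by simp⟩
  | succ N ih =>
    obtain ⟨η, hη, h⟩ := ih
    refine ⟨min η (ε N), lt_min hη (hε N), fun n hn => ?_⟩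
    rcases Nat.lt_succ_iff_lt_or_eq.mp hn with hn | rfl
    · exact (min_le_left _ _).trans (h n hn)
    · exact min_le_right _ _

/-- If `X` and `Y` have sharp measure zero, then so does `X × Y` with the maximum metric. -/
theorem stmt7 (X Y : Type) [MetricSpace X] [MetricSpace Y]
    (hX : HasSSMZ X) (hY : HasSSMZ Y) : HasSSMZ (X × Y) := by
  intro ε hε
  obtain ⟨U, ⟨k, hk0, hk, hU⟩, hUd⟩ := hX ε hε
  choose η hη hηε using fun j => exists_pos_forall_lt_le hε (k (j + 1))
  obtain ⟨V, ⟨l, hl0, hl, hV⟩, hVd⟩ := hY η hη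
  refine ⟨fun n => {p | p.1 ∈ U n ∧ ∃ j, k j ≤ n ∧ n < k (j + 1) ∧ p.2 ∈ V j},
    ⟨fun i => k (l i), by simp [hk0, hl0], hk.comp hl, ?_⟩, fun n => ?_⟩
  · rintro ⟨x, y⟩ -
    filter_upwards [hl.tendsto_atTop.eventually (eventually_forall_ge_atTop.mpr
      (hU x (mem_univ x))), hV y (mem_univ y)] with i hx ⟨j, hij, hji, hyj⟩
    obtain ⟨n, hjn, hnj, hxn⟩ := hx j hij
    exact ⟨n, (hk.monotone hij).trans hjn, hnj.trans_le (hk.monotone hji), hxn,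
      j, hjn, hnj, hyj⟩
  · refine Metric.ediam_le ?_
    rintro ⟨x, y⟩ ⟨hx, j, hj, hj', hy⟩ ⟨x', y'⟩ ⟨hx', j', hi, hi', hy'⟩
    obtain rfl : j = j' := by
      have h₁ := hk.lt_iff_lt.mp (hj.trans_lt hi')
      have h₂ := hk.lt_iff_lt.mp (hi.trans_lt hj')
      omega
    rw [Prod.edist_eq]
    exact max_le ((Metric.edist_le_ediam_of_mem hx hx').trans (hUd n))
      ((Metric.edist_le_ediam_of_mem hy hy').trans
        ((hVd j).trans (ENNReal.ofReal_le_ofReal (hηε j n hj'))))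
end

section
/- A metric space X has sharp measure zero if and only if Player I has no winning strategy in the game G^♯(X): a strategy for Player I is a function σ assigning to each finite sequence (U_0,…,U_{n−1}) of subsets of X a positive real number; a run ⟨U_n⟩ is played according to σ if diam U_n ≤ σ(U_0,…,U_{n−1}) for every n; the strategy σ is winning if no run played according to σ is a γ-groupable cover of X. -/
open MeasureTheory Set Filter Pointwise
open scoped ENNReal NNReal Topology

/-- A space of sharp measure zero is an increasing union of totally bounded sets. -/
theorem HasSSMZ.exists_monotone_totallyBounded {X : Type*} [MetricSpace X] (h : HasSSMZ X) :
    ∃ K : ℕ → Set X, Monotone K ∧ (∀ x, ∃ n, x ∈ K n) ∧ ∀ n, TotallyBounded (K n) := by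
  obtain ⟨U, ⟨k, -, hk, hU⟩, hd⟩ := h (fun n => 1 / ((n : ℝ) + 1)) fun n => by positivity
  refine ⟨fun m => {x | ∀ j ≥ m, ∃ n, k j ≤ n ∧ n < k (j + 1) ∧ x ∈ U n},
    fun m m' hm x hx j hj => hx j (hm.trans hj),
    fun x => eventually_atTop.1 (hU x (mem_univ x)), fun m => ?_⟩
  rw [Metric.totallyBounded_iff]
  intro ε hε
  obtain ⟨N, hN⟩ := exists_nat_one_div_lt hε
  have hc : ∀ n, ∃ t : Set X, t.Finite ∧ (N ≤ n → U n ⊆ ⋃ y ∈ t, Metric.ball y ε) := by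
    intro n
    rcases (U n).eq_empty_or_nonempty with h0 | ⟨y, hy⟩
    · exact ⟨∅, finite_empty, fun _ => by simp [h0]⟩
    · refine ⟨{y}, finite_singleton y, fun hn x hx => ?_⟩
      have hxy : edist x y ≤ ENNReal.ofReal (1 / ((n : ℝ) + 1)) :=
        (Metric.edist_le_ediam_of_mem hx hy).trans (hd n)
      rw [edist_le_ofReal (by positivity)] at hxy
      simpa using (hxy.trans (one_div_le_one_div_of_le (by positivity)
        (by gcongr : (N : ℝ) + 1 ≤ n + 1))).trans_lt hN
  choose t ht htU using hc
  let j := max m N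
  refine ⟨⋃ n ∈ Set.Iio (k (j + 1)), t n, (finite_Iio _).biUnion fun n _ => ht n, fun x hx => ?_⟩
  obtain ⟨n, hn, hn', hxn⟩ := hx j (le_max_left m N)
  obtain ⟨y, hy, hxy⟩ := mem_iUnion₂.1
    (htU n ((le_max_right m N).trans ((hk.le_apply (x := j)).trans hn)) hxn)
  exact mem_iUnion₂.2 ⟨y, mem_iUnion₂.2 ⟨n, hn', hy⟩, hxy⟩

/-- A totally bounded set admits finite families of small sets absorbing every sufficiently
small set that meets it. -/
theorem TotallyBounded.exists_finite_absorbing {X : Type*} [MetricSpace X] {K : Set X}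
    (hK : TotallyBounded K) {e : ℝ} (he : 0 < e) :
    ∃ F : Set (Set X), F.Finite ∧ (∀ u ∈ F, Metric.ediam u ≤ ENNReal.ofReal e) ∧
      ∀ V : Set X, Metric.ediam V ≤ ENNReal.ofReal (e / 4) →
        ∃ u ∈ F, (V ∩ K).Nonempty → V ⊆ u := by
  obtain ⟨t, ht, hKt⟩ := Metric.totallyBounded_iff.1 hK (e / 4) (by positivity)
  refine ⟨insert ∅ ((fun y => Metric.closedBall y (e / 2)) '' t), (ht.image _).insert _, ?_, ?_⟩
  · rintro u (rfl | ⟨y, -, rfl⟩)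
    · simp
    · refine Metric.ediam_le fun a ha b hb => ?_
      rw [edist_le_ofReal he.le]
      have := dist_triangle_right a b y
      simp only [Metric.mem_closedBall] at ha hb
      linarith
  · intro V hV
    by_cases hVK : (V ∩ K).Nonempty
    · obtain ⟨p, hpV, hpK⟩ := hVK
      obtain ⟨y, hy, hpy⟩ := mem_iUnion₂.1 (hKt hpK)
      refine ⟨_, mem_insert_of_mem _ (mem_image_of_mem _ hy), fun _ x hx => ?_⟩
      have hxp := (Metric.edist_le_ediam_of_mem hx hpV).trans hV
      rw [edist_le_ofReal (by positivity)] at hxp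
      have := dist_triangle x p y
      simp only [Metric.mem_ball] at hpy
      simp only [Metric.mem_closedBall]
      linarith
    · exact ⟨∅, mem_insert _ _, fun h => absurd h hVK⟩

/-- A metric space `X` has sharp measure zero iff Player I has no winning strategy in the
game `G^♯(X)`: a strategy assigns to each finite sequence of subsets of `X` a positive real;
a run `⟨U n⟩` follows the strategy if `diam (U n) ≤ σ (U 0, …, U (n-1))` for all `n`; the
strategy is winning if no run following it is a γ-groupable cover of `X`. -/
theorem stmt9 (X : Type) [MetricSpace X] :
    HasSSMZ X ↔
      ¬ ∃ σ : List (Set X) → ℝ, (∀ l, 0 < σ l) ∧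
        ∀ U : ℕ → Set X,
          (∀ n, EMetric.diam (U n) ≤ ENNReal.ofReal (σ (List.ofFn fun i : Fin n => U i))) →
          ¬ IsGammaGroupable U (Set.univ : Set X) := by
  constructor
  · rintro h ⟨σ, hσ, hwin⟩
    obtain ⟨K, hKm, hK, hKt⟩ := h.exists_monotone_totallyBounded
    have hg : ∀ S : Set (List (Set X)), ∃ e : ℝ, 0 < e ∧ (S.Finite → ∀ l ∈ S, e ≤ σ l) := by
      intro S
      by_cases hS : S.Finite ∧ S.Nonempty
      · obtain ⟨l, -, hl⟩ := S.exists_min_image σ hS.1 hS.2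
        exact ⟨σ l, hσ l, fun _ => hl⟩
      · exact ⟨1, one_pos, fun hf l hl => absurd ⟨hf, l, hl⟩ hS⟩
    choose g hg0 hg using hg
    choose F hFf hFd hF using fun n S => (hKt n).exists_finite_absorbing (hg0 S)
    let P : ℕ → Set (List (Set X)) := fun n =>
      Nat.rec {[]} (fun n S => image2 (fun l u => l ++ [u]) S (F n S)) n
    have hP : ∀ n, (P n).Finite := by
      intro n
      induction n with
      | zero => exact finite_singleton _
      | succ n ih => exact ih.image2 _ (hFf n (P n))
    obtain ⟨V, ⟨k, hk0, hk, hV⟩, hVd⟩ := h (fun n => g (P n) / 4) fun n =>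
      div_pos (hg0 _) four_pos
    choose U hUF hVU using fun n => hF n (P n) (V n) (hVd n)
    have hUP : ∀ n, (List.ofFn fun i : Fin n => U i) ∈ P n := by
      intro n
      induction n with
      | zero => simp [P]
      | succ n ih =>
        rw [List.ofFn_succ', List.concat_eq_append]
        exact mem_image2_of_mem ih (hUF n)
    refine hwin U (fun n => (hFd n (P n) (U n) (hUF n)).trans
      (ENNReal.ofReal_le_ofReal (hg (P n) (hP n) _ (hUP n)))) ⟨k, hk0, hk, fun x hx => ?_⟩
    obtain ⟨m, hm⟩ := hK x
    filter_upwards [hV x hx, eventually_ge_atTop m] with j ⟨n, hn, hn', hxn⟩ hj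
    exact ⟨n, hn, hn', hVU n ⟨x, hxn, hKm (hj.trans (hk.le_apply.trans hn)) hm⟩ hxn⟩
  · intro h ε hε
    by_contra! hc
    refine h ⟨fun l => ε l.length, fun l => hε _, fun U hU hγ => ?_⟩
    obtain ⟨n, hn⟩ := hc U hγ
    exact absurd (hU n) (by simpa using hn)
end

section
/- For any set X ⊆ 2^ℕ the following are equivalent: (i) X has sharp measure zero (with respect to the least-difference metric); (ii) X is meager-additive, i.e., X + M is meager for every meager M ⊆ 2^ℕ; (iii) X is sharply meager-additive, i.e., for every meager M ⊆ 2^ℕ there is a σ-compact set F with X ⊆ F and F + M meager; (iv) for every meager M ⊆ 2^ℕ there is a σ-compact set F with X ⊆ F and F + M ≠ 2^ℕ. -/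
open MeasureTheory Set Filter Pointwise
open scoped ENNReal NNReal Topology

/-- A block condition on `X`: for every interval partition with endpoints `f`, some `z` agrees with
each `x ∈ X` on a block within almost every group of consecutive blocks, for a suitable grouping. -/
def HasBlockMatching (X : Set Cantor) : Prop :=
  ∀ f : ℕ → ℕ, f 0 = 0 → StrictMono f → ∃ (z : Cantor) (G : ℕ → ℕ), G 0 = 0 ∧ StrictMono G ∧
    ∀ x ∈ X, ∀ᶠ j in atTop, ∃ k ∈ Ico (G j) (G (j + 1)), EqOn x z (Ico (f k) (f (k + 1)))

theorem exists_strictMono_of_forall_exists_gt {P : ℕ → ℕ → ℕ → Prop}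
    (h : ∀ n a, ∃ b, a < b ∧ P n a b) :
    ∃ G : ℕ → ℕ, G 0 = 0 ∧ StrictMono G ∧ ∀ n, P n (G n) (G (n + 1)) := by
  choose next hlt hP using h
  let G : ℕ → ℕ := fun n => Nat.rec 0 next n
  exact ⟨G, rfl, strictMono_nat_of_lt_succ fun n => hlt n (G n), fun n => hP n (G n)⟩

theorem exists_mem_block {f : ℕ → ℕ} (hf : StrictMono f) {a i : ℕ} (hi : f a ≤ i) :
    ∃ k, a ≤ k ∧ i ∈ Ico (f k) (f (k + 1)) := by
  have hai : a ≤ i := hf.le_apply.trans hi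
  refine ⟨Nat.findGreatest (fun n => f n ≤ i) i, Nat.le_findGreatest hai hi,
    Nat.findGreatest_spec (P := fun n => f n ≤ i) hai hi, ?_⟩
  by_contra! hlt
  exact absurd (Nat.le_findGreatest (P := fun n => f n ≤ i) (hf.le_apply.trans hlt) hlt) (by simp)

theorem exists_eqOn_blocks {α : Type*} {h : ℕ → ℕ} (hh : StrictMono h) (s : ℕ → ℕ → α) :
    ∃ y : ℕ → α, ∀ n, EqOn y (s n) (Ico (h n) (h (n + 1))) := by
  refine ⟨fun i => s (Nat.findGreatest (fun n => h n ≤ i) i) i, fun n i hi => ?_⟩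
  have : Nat.findGreatest (fun n => h n ≤ i) i = n := by
    rw [Nat.findGreatest_eq_iff]
    refine ⟨(hh.le_apply).trans hi.1, fun _ => hi.1, fun m hm _ hmi => ?_⟩
    exact absurd (hi.2.trans_le (hh.monotone (Nat.succ_le_of_lt hm))) (not_lt.2 hmi)
  simp only [this]

theorem Cantor.dist_le_iff_eqOn {x y : Cantor} {n : ℕ} :
    dist x y ≤ (1 / 2 : ℝ) ^ n ↔ EqOn x y (Iio n) :=
  PiNat.mem_cylinder_iff_dist_le.symm.trans PiNat.mem_cylinder_iff

theorem Cantor.isClopen_eqOn_Ico (u : Cantor) (a b : ℕ) :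
    IsClopen {w : Cantor | EqOn w u (Ico a b)} := by
  have : {w : Cantor | EqOn w u (Ico a b)} = ⋂ i ∈ Ico a b, (fun w : Cantor => w i) ⁻¹' {u i} := by
    ext w; simp [EqOn]
  rw [this]
  exact (finite_Ico a b).isClopen_biInter fun i _ =>
    (isClopen_discrete {u i}).preimage (continuous_apply i)

theorem Cantor.exists_cylinder_subset {O : Set Cantor} (hO : IsOpen O) {x : Cantor} (hx : x ∈ O) :
    ∃ n, ∀ y, EqOn y x (Iio n) → y ∈ O := by
  obtain ⟨ε, hε, hb⟩ := Metric.isOpen_iff.1 hO x hx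
  obtain ⟨n, hn⟩ := exists_pow_lt_of_lt_one hε (one_half_lt_one (α := ℝ))
  exact ⟨n, fun y hy => hb ((Cantor.dist_le_iff_eqOn.2 hy).trans_lt hn)⟩

theorem Cantor.exists_block_of_dense {O : Set Cantor} (hO : IsOpen O) (hd : Dense O) (N : ℕ) :
    ∃ (N' : ℕ) (s : Cantor), ∀ x, EqOn x s (Ico N N') → x ∈ O := by
  let pad : (Fin N → ZMod 2) → Cantor := fun t i => if h : i < N then t ⟨i, h⟩ else 0
  let O' : Set Cantor := ⋂ t, (Homeomorph.addLeft (pad t)) ⁻¹' O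
  have hO' : IsOpen O' := isOpen_iInter_of_finite fun t => hO.preimage (Homeomorph.continuous _)
  have hd' : Dense O' := dense_iInter_of_isOpen
    (fun t => hO.preimage (Homeomorph.continuous _))
    fun t => hd.preimage (Homeomorph.isOpenMap _)
  obtain ⟨s, hs⟩ := hd'.nonempty
  obtain ⟨n, hn⟩ := Cantor.exists_cylinder_subset hO' hs
  refine ⟨n, s, fun x hx => ?_⟩
  have hmem : pad (fun i => s i - x i) + x ∈ O' := by
    refine hn _ fun i hi => ?_
    by_cases h : i < N
    · simp [pad, h]
    · simp [pad, h, hx ⟨not_lt.1 h, hi⟩]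
  have key := mem_iInter.1 hmem fun i => x i - s i
  simp only [mem_preimage, Homeomorph.coe_addLeft] at key
  convert key using 1
  funext i
  by_cases h : i < N <;> simp [pad, h]

/-- A meagre set eventually avoids a pattern on some interval partition coarser than a given one. -/
theorem Cantor.exists_blocks_of_isMeagre {M : Set Cantor} (hM : IsMeagre M) {f : ℕ → ℕ}
    (hf : StrictMono f) :
    ∃ (y : Cantor) (G : ℕ → ℕ), G 0 = 0 ∧ StrictMono G ∧
      ∀ x ∈ M, ∀ᶠ n in atTop, ¬ EqOn x y (Ico (f (G n)) (f (G (n + 1)))) := by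
  obtain ⟨S, hSo, hSd, hSc, hSM⟩ := mem_residual_iff.1 hM
  obtain ⟨O, hO⟩ := (hSc.insert univ).exists_eq_range (insert_nonempty _ _)
  have hOo : ∀ n, IsOpen (O n) ∧ Dense (O n) := fun n => by
    have : O n ∈ insert univ S := hO ▸ mem_range_self n
    rcases this with h | h
    · rw [h]; exact ⟨isOpen_univ, dense_univ⟩
    · exact ⟨hSo _ h, hSd _ h⟩
  have hOM : ∀ x ∈ M, ∃ m, x ∉ O m := fun x hx => by
    by_contra! hcon
    refine hSM (mem_sInter.2 fun t ht => ?_) hx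
    have : t ∈ range O := hO ▸ mem_insert_of_mem _ ht
    obtain ⟨m, rfl⟩ := this
    exact hcon m
  let D : ℕ → Set Cantor := fun n => ⋂ m : Fin (n + 1), O m
  have hstep : ∀ n a, ∃ b, a < b ∧
      ∃ s : Cantor, ∀ x, EqOn x s (Ico (f a) (f b)) → x ∈ D n := fun n a => by
    obtain ⟨N', s, hs⟩ := Cantor.exists_block_of_dense (O := D n)
      (isOpen_iInter_of_finite fun m => (hOo m).1)
      (dense_iInter_of_isOpen (fun m => (hOo m).1) fun m => (hOo m).2) (f a)
    refine ⟨max (a + 1) N', by simp, s, fun x hx => hs x (hx.mono (Ico_subset_Ico_right ?_))⟩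
    exact (le_max_right _ _).trans hf.le_apply
  obtain ⟨G, hG0, hG, hs⟩ := exists_strictMono_of_forall_exists_gt hstep
  choose s hs using hs
  obtain ⟨y, hy⟩ := exists_eqOn_blocks (hf.comp hG) s
  refine ⟨y, G, hG0, hG, fun x hx => ?_⟩
  obtain ⟨m, hm⟩ := hOM x hx
  filter_upwards [eventually_ge_atTop m] with n hn hxy
  exact hm (mem_iInter.1 (hs n x (hxy.trans (hy n))) ⟨m, Nat.lt_succ_of_le hn⟩)

theorem Cantor.isMeagre_eventually_not_eqOn {h : ℕ → ℕ} (hh : StrictMono h) (u : Cantor) :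
    IsMeagre {w : Cantor | ∀ᶠ n in atTop, ¬ EqOn w u (Ico (h n) (h (n + 1)))} := by
  have hres : ∀ N, (⋃ n ≥ N, {w : Cantor | EqOn w u (Ico (h n) (h (n + 1)))}) ∈ residual Cantor := by
    refine fun N => residual_of_dense_open
      (isOpen_biUnion fun n _ => (Cantor.isClopen_eqOn_Ico u _ _).isOpen) fun w => ?_
    let v : ℕ → Cantor := fun n => (Ico (h n) (h (n + 1))).piecewise u w
    have hv : Tendsto v atTop (𝓝 w) := by
      refine tendsto_pi_nhds.2 fun i => tendsto_const_nhds.congr' ?_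
      filter_upwards [eventually_gt_atTop i] with n hn
      refine (piecewise_eq_of_notMem _ _ _ fun hi => ?_).symm
      exact absurd (hn.trans_le hh.le_apply) (not_lt.2 hi.1)
    refine mem_closure_of_tendsto hv ?_
    filter_upwards [eventually_ge_atTop N] with n hn
    exact mem_biUnion hn (piecewise_eqOn _ _ _)
  refine mem_of_superset (countable_iInter_mem.2 hres) fun w hw hev => ?_
  obtain ⟨N, hN⟩ := eventually_atTop.1 hev
  obtain ⟨n, hn, hwn⟩ := mem_iUnion₂.1 (mem_iInter.1 hw N)
  exact hN n hn hwn

theorem IsSSMZ.hasBlockMatching {X : Set Cantor} (hX : IsSSMZ X) : HasBlockMatching X := by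
  intro f _ hf
  obtain ⟨U, ⟨G, hG0, hG, hU⟩, hdiam⟩ := hX (fun n => (1 / 2) ^ f (n + 1)) fun n => by positivity
  have hrep : ∀ n, ∃ u : Cantor, ∀ x ∈ U n, EqOn x u (Iio (f (n + 1))) := fun n => by
    rcases (U n).eq_empty_or_nonempty with h | ⟨u, hu⟩
    · exact ⟨0, by simp [h]⟩
    · refine ⟨u, fun x hx => Cantor.dist_le_iff_eqOn.1 ?_⟩
      rw [← ENNReal.ofReal_le_ofReal_iff (by positivity), ← edist_dist]
      exact (Metric.edist_le_ediam_of_mem hx hu).trans (hdiam n)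
  choose u hu using hrep
  obtain ⟨z, hz⟩ := exists_eqOn_blocks hf u
  refine ⟨z, G, hG0, hG, fun x hx => (hU x hx).mono ?_⟩
  rintro j ⟨k, hk, hk', hxk⟩
  exact ⟨k, ⟨hk, hk'⟩, fun i hi => (hu k x hxk hi.2).trans (hz k hi).symm⟩

theorem Cantor.exists_code (a : ℕ) :
    ∃ c : Cantor → ℕ, (∀ x, c x < 2 ^ a) ∧ ∀ x y, c x = c y → EqOn x y (Iio a) := by
  let e : (Fin a → ZMod 2) ≃ Fin (2 ^ a) := Fintype.equivFinOfCardEq (by simp)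
  refine ⟨fun x => e fun i => x i, fun x => Fin.is_lt _, fun x y h i hi => ?_⟩
  exact congrFun (e.injective (Fin.ext h)) ⟨i, hi⟩

theorem HasBlockMatching.isSSMZ {X : Set Cantor} (hX : HasBlockMatching X) : IsSSMZ X := by
  intro ε hε
  have hstep : ∀ _n a : ℕ, ∃ b, a < b ∧ ∀ i < 2 ^ (a + 1), (1 / 2 : ℝ) ^ b ≤ ε i := fun _ a => by
    have hsmall : ∀ i, ∀ᶠ b : ℕ in atTop, (1 / 2 : ℝ) ^ b ≤ ε i := fun i =>
      ((tendsto_pow_atTop_nhds_zero_of_lt_one (by norm_num) (by norm_num)).eventually_lt_const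
        (hε i)).mono fun _ => le_of_lt
    exact ((eventually_gt_atTop a).and
      ((eventually_all_finite (finite_Iio (2 ^ (a + 1)))).2 fun i _ => hsmall i)).exists
  obtain ⟨f, hf0, hf, hfε⟩ := exists_strictMono_of_forall_exists_gt hstep
  obtain ⟨z, G, hG0, hG, hz⟩ := hX f hf0 hf
  choose c hc hcinj using Cantor.exists_code
  let U : ℕ → Set Cantor := fun n =>
    {x | ∃ k, n + 1 = 2 ^ f k + c (f k) x ∧ EqOn x z (Ico (f k) (f (k + 1)))}
  have hlog : ∀ {n k x}, n + 1 = 2 ^ f k + c (f k) x → Nat.log 2 (n + 1) = f k := by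
    intro n k x h
    have := hc (f k) x
    exact Nat.log_eq_of_pow_le_of_lt_pow (by omega) (by rw [pow_succ]; omega)
  refine ⟨U, ⟨fun j => 2 ^ f (G j) - 1, by simp [hG0, hf0], fun i j hij => ?_, fun x hx => ?_⟩,
    fun n => Metric.ediam_le ?_⟩
  · have : 2 ^ f (G i) < 2 ^ f (G j) := Nat.pow_lt_pow_right one_lt_two (hf (hG hij))
    have := Nat.one_le_two_pow (n := f (G i))
    show 2 ^ f (G i) - 1 < 2 ^ f (G j) - 1
    omega
  · filter_upwards [hz x hx] with j hj
    obtain ⟨k, hk, hxk⟩ := hj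
    have h1 : 2 ^ f (G j) ≤ 2 ^ f k := Nat.pow_le_pow_right two_pos (hf.monotone hk.1)
    have h2 : 2 ^ (f k + 1) ≤ 2 ^ f (G (j + 1)) := Nat.pow_le_pow_right two_pos (hf hk.2)
    have h3 := hc (f k) x
    have h4 := Nat.one_le_two_pow (n := f (G j))
    rw [pow_succ] at h2
    exact ⟨2 ^ f k + c (f k) x - 1, by omega, by omega, k, by omega, hxk⟩
  · rintro x ⟨k, hk, hxk⟩ y ⟨l, hl, hyl⟩
    obtain rfl : k = l := hf.injective ((hlog hk).symm.trans (hlog hl))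
    rw [edist_dist]
    refine ENNReal.ofReal_le_ofReal (le_trans (Cantor.dist_le_iff_eqOn.2 fun i hi => ?_)
      (hfε k n (by have := hc (f k) x; rw [pow_succ]; omega)))
    rcases lt_or_ge i (f k) with h | h
    · exact hcinj (f k) x y (by omega) h
    · exact (hxk ⟨h, hi⟩).trans (hyl ⟨h, hi⟩).symm

theorem HasBlockMatching.exists_isSigmaCompact {X M : Set Cantor} (hX : HasBlockMatching X)
    (hM : IsMeagre M) : ∃ F : Set Cantor, IsSigmaCompact F ∧ X ⊆ F ∧ IsMeagre (F + M) := by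
  obtain ⟨y, f, hf0, hf, hy⟩ := Cantor.exists_blocks_of_isMeagre hM strictMono_id
  obtain ⟨z, G, -, hG, hz⟩ := hX f hf0 hf
  let C : ℕ → Set Cantor := fun j =>
    ⋃ k ∈ Ico (G j) (G (j + 1)), {x | EqOn x z (Ico (f k) (f (k + 1)))}
  have hC : ∀ j, IsClosed (C j) := fun j =>
    (finite_Ico _ _).isClosed_biUnion fun k _ => (Cantor.isClopen_eqOn_Ico _ _ _).isClosed
  refine ⟨⋃ N, ⋂ j ≥ N, C j, isSigmaCompact_iUnion_of_isCompact _ fun N =>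
    (isClosed_biInter fun j _ => hC j).isCompact, fun x hx => ?_, ?_⟩
  · obtain ⟨N, hN⟩ := eventually_atTop.1 (hz x hx)
    refine mem_iUnion.2 ⟨N, mem_iInter₂.2 fun j hj => ?_⟩
    obtain ⟨k, hk, hxk⟩ := hN j hj
    exact mem_biUnion hk hxk
  · refine (Cantor.isMeagre_eventually_not_eqOn (hf.comp hG) (z + y)).mono ?_
    rintro _ ⟨x, hx, m, hm, rfl⟩
    obtain ⟨N, hN⟩ := mem_iUnion.1 hx
    obtain ⟨N', hN'⟩ := eventually_atTop.1 (hy m hm)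
    filter_upwards [eventually_ge_atTop N, eventually_ge_atTop N'] with j hj hj' heq
    obtain ⟨k, hk, hxk⟩ := mem_iUnion₂.1 (mem_iInter₂.1 hN j hj)
    refine hN' k (hj'.trans (hG.le_apply.trans hk.1)) fun i hi => ?_
    have h1 := heq ⟨(hf.monotone hk.1).trans hi.1, hi.2.trans_le (hf.monotone hk.2)⟩
    simpa [hxk hi] using h1

theorem hasBlockMatching_of_exists_isSigmaCompact {X : Set Cantor}
    (hX : ∀ M : Set Cantor, IsMeagre M →
      ∃ F : Set Cantor, IsSigmaCompact F ∧ X ⊆ F ∧ F + M ≠ univ) : HasBlockMatching X := by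
  intro f _ hf
  obtain ⟨F, ⟨K, hK, rfl⟩, hXF, hne⟩ := hX _ (Cantor.isMeagre_eventually_not_eqOn hf 0)
  obtain ⟨z, hz⟩ := (ne_univ_iff_exists_notMem _).1 hne
  have hfreq : ∀ x ∈ ⋃ n, K n, ∀ N, ∃ n ≥ N, EqOn x z (Ico (f n) (f (n + 1))) := by
    intro x hx
    by_contra! ⟨N, hN⟩
    refine hz ⟨x, hx, z - x, ?_, by simp⟩
    filter_upwards [eventually_ge_atTop N] with n hn heq
    exact hN n hn fun i hi => (sub_eq_zero.1 (heq hi)).symm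
  have hstep : ∀ n a, ∃ b, a < b ∧ ∀ x ∈ accumulate K n,
      ∃ k ∈ Ico a b, EqOn x z (Ico (f k) (f (k + 1))) := by
    intro n a
    have hcomp : IsCompact (accumulate K n) := isCompact_accumulate hK n
    obtain ⟨t, ht⟩ := hcomp.elim_finite_subcover
      (fun k : Ici a => {x : Cantor | EqOn x z (Ico (f k) (f (k + 1)))})
      (fun k => (Cantor.isClopen_eqOn_Ico _ _ _).isOpen) fun x hx => by
        obtain ⟨k, hk, hxk⟩ := hfreq x (accumulate_subset_iUnion n hx) a
        exact mem_iUnion.2 ⟨⟨k, hk⟩, hxk⟩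
    refine ⟨a + 1 + t.sup Subtype.val, by omega, fun x hx => ?_⟩
    obtain ⟨k, hk, hxk⟩ := mem_iUnion₂.1 (ht hx)
    have : (k : ℕ) ≤ t.sup Subtype.val := Finset.le_sup (f := Subtype.val) hk
    exact ⟨k, ⟨k.2, by omega⟩, hxk⟩
  obtain ⟨G, hG0, hG, hGK⟩ := exists_strictMono_of_forall_exists_gt hstep
  refine ⟨z, G, hG0, hG, fun x hx => ?_⟩
  obtain ⟨m, hm⟩ := mem_iUnion.1 (hXF hx)
  filter_upwards [eventually_ge_atTop m] with j hj
  exact hGK j x (mem_accumulate.2 ⟨m, hj, hm⟩)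

theorem hasBlockMatching_of_isMeagre_add {X : Set Cantor}
    (hX : ∀ M : Set Cantor, IsMeagre M → IsMeagre (X + M)) : HasBlockMatching X := by
  intro f _ hf
  obtain ⟨y, G, hG0, hG, hy⟩ :=
    Cantor.exists_blocks_of_isMeagre (hX _ (Cantor.isMeagre_eventually_not_eqOn hf 0)) hf
  refine ⟨y, G, hG0, hG, fun x hx => ?_⟩
  by_contra hcon
  classical
  obtain ⟨w, hw⟩ := exists_eqOn_blocks hf
    fun k => if EqOn x y (Ico (f k) (f (k + 1))) then x + 1 else y
  have hwx : ∀ k, ¬ EqOn w x (Ico (f k) (f (k + 1))) := by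
    intro k heq
    by_cases h : EqOn x y (Ico (f k) (f (k + 1)))
    · have hk : f k ∈ Ico (f k) (f (k + 1)) := ⟨le_rfl, hf k.lt_succ_self⟩
      have := (hw k hk).symm.trans (heq hk)
      simp [h] at this
    · exact h (heq.symm.trans (by simpa only [if_neg h] using hw k))
  have hwM : w ∈ X + {w : Cantor | ∀ᶠ n in atTop, ¬ EqOn w 0 (Ico (f n) (f (n + 1)))} :=
    ⟨x, hx, w - x, Eventually.of_forall fun n heq =>
      hwx n fun i hi => sub_eq_zero.1 (heq hi), by simp⟩
  refine hcon ((hy w hwM).mono fun j hj => ?_)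
  by_contra! hno
  refine hj fun i hi => ?_
  obtain ⟨k, hk, hik⟩ := exists_mem_block hf hi.1
  have hkj : k < G (j + 1) := hf.lt_iff_lt.1 (hik.1.trans_lt hi.2)
  simpa [hno k ⟨hk, hkj⟩] using hw k hik

/-- For `X ⊆ 2^ℕ` the following are equivalent: (i) `X` has sharp measure zero;
(ii) `X` is meager-additive; (iii) `X` is sharply meager-additive; (iv) for every meager `M`
there is a σ-compact `F ⊇ X` with `F + M ≠ 2^ℕ`. -/
theorem stmt10 (X : Set Cantor) :
    (IsSSMZ X ↔ ∀ M : Set Cantor, IsMeagre M → IsMeagre (X + M)) ∧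
    (IsSSMZ X ↔ ∀ M : Set Cantor, IsMeagre M →
        ∃ F : Set Cantor, IsSigmaCompact F ∧ X ⊆ F ∧ IsMeagre (F + M)) ∧
    (IsSSMZ X ↔ ∀ M : Set Cantor, IsMeagre M →
        ∃ F : Set Cantor, IsSigmaCompact F ∧ X ⊆ F ∧ F + M ≠ Set.univ) := by
  have sigma : IsSSMZ X → ∀ M : Set Cantor, IsMeagre M →
      ∃ F : Set Cantor, IsSigmaCompact F ∧ X ⊆ F ∧ IsMeagre (F + M) :=
    fun hX _ hM => hX.hasBlockMatching.exists_isSigmaCompact hM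
  have add_of_sigma : (∀ M : Set Cantor, IsMeagre M →
      ∃ F : Set Cantor, IsSigmaCompact F ∧ X ⊆ F ∧ IsMeagre (F + M)) →
      ∀ M : Set Cantor, IsMeagre M → IsMeagre (X + M) := fun h M hM => by
    obtain ⟨F, -, hXF, hF⟩ := h M hM
    exact hF.mono (add_subset_add_right hXF)
  have of_add : (∀ M : Set Cantor, IsMeagre M → IsMeagre (X + M)) → IsSSMZ X :=
    fun h => (hasBlockMatching_of_isMeagre_add h).isSSMZ
  refine ⟨⟨fun h => add_of_sigma (sigma h), of_add⟩,
    ⟨sigma, fun h => of_add (add_of_sigma h)⟩, fun h M hM => ?_,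
    fun h => (hasBlockMatching_of_exists_isSigmaCompact h).isSSMZ⟩
  obtain ⟨F, hF, hXF, hFM⟩ := sigma h M hM
  refine ⟨F, hF, hXF, fun huniv => ?_⟩
  rw [huniv] at hFM
  exact not_isMeagre_of_isOpen isOpen_univ univ_nonempty hFM
end

section
/- For any set X ⊆ 2^ℕ the following are equivalent: (i) X has sharp measure zero (with respect to the least-difference metric); (ii) X is 𝔈-additive, i.e., X + E ∈ 𝔈 for every E ∈ 𝔈; (iii) X is sharply 𝔈-additive, i.e., for every E ∈ 𝔈 there is a σ-compact set F with X ⊆ F and F + E ∈ 𝔈. Consequently, X ⊆ 2^ℕ is meager-additive if and only if it is 𝔈-additive. -/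
open MeasureTheory Set Filter Pointwise
open scoped ENNReal NNReal Topology

/-- Membership in the σ-ideal `𝔈`: `E` is contained in an `F_σ` set of Haar measure zero. -/
def MemE (E : Set Cantor) : Prop :=
  ∃ F : Set Cantor, E ⊆ F ∧ MeasureTheory.Measure.addHaar F = 0 ∧
    ∃ C : ℕ → Set Cantor, (∀ n, IsClosed (C n)) ∧ F = ⋃ n, C n

namespace CantorAdd

lemma add_self_eq_zero (x : Cantor) : x + x = 0 := by
  funext i
  exact CharTwo.add_self_eq_zero (x i)

lemma add_cancel_right_self (x y : Cantor) : x + y + y = x := by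
  rw [add_assoc, add_self_eq_zero, add_zero]

/-- The extension by zero of a finite binary word. -/
def extend {n : ℕ} (s : Fin n → ZMod 2) : Cantor := fun i => if h : i < n then s ⟨i, h⟩ else 0

/-- The initial segment of length `n`. -/
def initial (n : ℕ) (x : Cantor) : Fin n → ZMod 2 := fun i => x i

lemma continuous_initial (n : ℕ) : Continuous (initial n) := by
  unfold initial
  fun_prop

lemma initial_eq_iff {n : ℕ} {x y : Cantor} : initial n x = initial n y ↔ EqOn x y (Iio n) :=
  ⟨fun h i hi => congrFun h ⟨i, hi⟩, fun h => funext fun i => h i.2⟩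

lemma initial_extend {n : ℕ} (s : Fin n → ZMod 2) : initial n (extend s) = s := by
  funext i
  simp [initial, extend]

/-- The cylinder of all sequences with the same first `n` terms as `v`. -/
def cyl (v : Cantor) (n : ℕ) : Set Cantor := {w | EqOn w v (Iio n)}

lemma cyl_eq_preimage (v : Cantor) (n : ℕ) : cyl v n = initial n ⁻¹' {initial n v} := by
  ext w
  exact initial_eq_iff.symm

lemma cyl_congr {v w : Cantor} {n : ℕ} (h : EqOn v w (Iio n)) : cyl v n = cyl w n := by
  rw [cyl_eq_preimage, cyl_eq_preimage, initial_eq_iff.2 h]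

lemma isClopen_of_dependsOn {A : Set Cantor} {n : ℕ} (h : DependsOn (· ∈ A) (Iio n)) :
    IsClopen A := by
  have : A = initial n ⁻¹' (initial n '' A) := by
    refine subset_antisymm (subset_preimage_image _ _) ?_
    rintro x ⟨y, hy, hxy⟩
    have := h (initial_eq_iff.1 hxy)
    simpa [hy] using this
  rw [this]
  exact (isClopen_discrete _).preimage (continuous_initial n)

lemma measurableSet_of_dependsOn {A : Set Cantor} {n : ℕ} (h : DependsOn (· ∈ A) (Iio n)) :
    MeasurableSet A := (isClopen_of_dependsOn h).isOpen.measurableSet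

lemma dependsOn_cyl (v : Cantor) (n : ℕ) : DependsOn (· ∈ cyl v n) (Iio n) := by
  intro x y h
  exact propext ⟨fun hx i hi => (h i hi).symm.trans (hx hi), fun hy i hi => (h i hi).trans (hy hi)⟩

lemma isClopen_cyl (v : Cantor) (n : ℕ) : IsClopen (cyl v n) :=
  isClopen_of_dependsOn (dependsOn_cyl v n)

lemma exists_cyl_subset {U : Set Cantor} (hU : IsOpen U) {x : Cantor} (hx : x ∈ U) :
    ∃ n, cyl x n ⊆ U := by
  obtain ⟨ε, hε, h⟩ := Metric.isOpen_iff.1 hU x hx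
  obtain ⟨n, hn⟩ := exists_pow_lt_of_lt_one hε (by norm_num : (1 / 2 : ℝ) < 1)
  refine ⟨n, fun y hy => h ?_⟩
  have : dist y x ≤ (1 / 2) ^ n := PiNat.mem_cylinder_iff_dist_le.1 fun i hi => hy hi
  exact this.trans_lt hn

lemma exists_blockwise {h : ℕ → ℕ} (hh : StrictMono h) (z : ℕ → Cantor) :
    ∃ y : Cantor, ∀ n, EqOn y (z n) (Ico (h n) (h (n + 1))) := by
  classical
  refine ⟨fun i => z (Nat.findGreatest (fun n => h n ≤ i) i) i, fun n i hi => ?_⟩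
  have : Nat.findGreatest (fun n => h n ≤ i) i = n := by
    rw [Nat.findGreatest_eq_iff]
    refine ⟨(hh.le_apply).trans hi.1, fun _ => hi.1, fun l hl _ hli => ?_⟩
    exact absurd (hi.2.trans_le (hh.monotone hl)) (not_lt.2 hli)
  simp only [this]

lemma exists_block {h : ℕ → ℕ} (hh : StrictMono h) (h0 : h 0 = 0) (n : ℕ) :
    ∃ k, h k ≤ n ∧ n < h (k + 1) := by
  classical
  refine ⟨Nat.findGreatest (fun k => h k ≤ n) n, ?_, ?_⟩
  · exact Nat.findGreatest_spec (P := fun k => h k ≤ n) (Nat.zero_le n) (by simp [h0])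
  · by_contra hn
    have := Nat.le_findGreatest (P := fun k => h k ≤ n) ((hh.le_apply).trans (not_lt.1 hn))
      (not_lt.1 hn)
    omega

lemma block_unique {h : ℕ → ℕ} (hh : StrictMono h) {n k l : ℕ} (hk : n ∈ Ico (h k) (h (k + 1)))
    (hl : n ∈ Ico (h l) (h (l + 1))) : k = l := by
  refine le_antisymm ?_ ?_
  · exact Nat.lt_succ_iff.1 (hh.monotone.reflect_lt (hk.1.trans_lt hl.2))
  · exact Nat.lt_succ_iff.1 (hh.monotone.reflect_lt (hl.1.trans_lt hk.2))

lemma exists_strictMono_of_eventually {P : ℕ → ℕ → ℕ → Prop}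
    (hP : ∀ n a, ∃ b, ∀ b' ≥ b, P n a b') :
    ∃ g : ℕ → ℕ, StrictMono g ∧ g 0 = 0 ∧ ∀ n, P n (g n) (g (n + 1)) := by
  choose b hb using hP
  let g : ℕ → ℕ := fun n => Nat.rec 0 (fun n a => max (a + 1) (b n a)) n
  have hg : ∀ n, g (n + 1) = max (g n + 1) (b n (g n)) := fun n => rfl
  refine ⟨g, strictMono_nat_of_lt_succ fun n => ?_, rfl, fun n => hb _ _ _ ?_⟩
  · rw [hg]; exact (Nat.lt_succ_self _).trans_le (le_max_left _ _)
  · rw [hg]; exact le_max_right _ _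

/-- The sequences that agree with a member of `K` on the coordinates in `s`. -/
def agreeing (K : Set Cantor) (s : Set ℕ) : Set Cantor := {w | ∃ c ∈ K, EqOn w c s}

lemma dependsOn_agreeing (K : Set Cantor) (s : Set ℕ) : DependsOn (· ∈ agreeing K s) s := by
  intro x y h
  refine propext ⟨?_, ?_⟩
  · rintro ⟨c, hc, hx⟩
    exact ⟨c, hc, fun i hi => (h i hi).symm.trans (hx hi)⟩
  · rintro ⟨c, hc, hx⟩
    exact ⟨c, hc, fun i hi => (h i hi).trans (hx hi)⟩

lemma subset_agreeing (K : Set Cantor) (s : Set ℕ) : K ⊆ agreeing K s :=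
  fun c hc => ⟨c, hc, eqOn_refl c s⟩

lemma agreeing_anti (K : Set Cantor) {s t : Set ℕ} (h : s ⊆ t) : agreeing K t ⊆ agreeing K s :=
  fun _ ⟨c, hc, hw⟩ => ⟨c, hc, hw.mono h⟩

lemma agreeing_Ici (K : Set Cantor) (p : ℕ) :
    agreeing K (Ici p) = ⋃ s : Fin p → ZMod 2, (extend s + ·) ⁻¹' K := by
  ext w
  simp only [mem_iUnion, mem_preimage]
  constructor
  · rintro ⟨c, hc, hw⟩
    refine ⟨initial p (w + c), ?_⟩
    have : extend (initial p (w + c)) = w + c := by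
      funext i
      by_cases hi : i < p
      · simp [extend, initial, hi]
      · simp [extend, hi, hw (not_lt.1 hi), CharTwo.add_self_eq_zero]
    rwa [this, add_comm w, add_cancel_right_self]
  · rintro ⟨s, hs⟩
    refine ⟨_, hs, fun i hi => ?_⟩
    simp [extend, not_lt.2 (mem_Ici.1 hi)]

lemma iInter_agreeing {K : Set Cantor} (hK : IsClosed K) (p : ℕ) :
    ⋂ q, agreeing K (Ico p q) = agreeing K (Ici p) := by
  refine subset_antisymm (fun w hw => ?_)
    (subset_iInter fun q => agreeing_anti K fun i hi => hi.1)
  have hcl : ∀ q, IsClosed (K ∩ {c | EqOn w c (Ico p q)}) := fun q => by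
    have : DependsOn (· ∈ {c : Cantor | EqOn w c (Ico p q)}) (Iio q) := fun x y h =>
      propext ⟨fun hx i hi => (hx hi).trans (h i hi.2), fun hy i hi =>
        (hy hi).trans (h i hi.2).symm⟩
    exact hK.inter (isClopen_of_dependsOn this).isClosed
  obtain ⟨c, hc⟩ := IsCompact.nonempty_iInter_of_directed_nonempty_isCompact_isClosed
    (fun q => K ∩ {c | EqOn w c (Ico p q)})
    (directed_of_isDirected_le fun a b hab c hc =>
      ⟨hc.1, hc.2.mono (Ico_subset_Ico_right hab)⟩)
    (fun q => by
      obtain ⟨c, hc, h⟩ := mem_iInter.1 hw q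
      exact ⟨c, hc, h⟩) (fun q => (hcl q).isCompact) hcl
  rw [mem_iInter] at hc
  exact ⟨c, (hc 0).1, fun i hi => (hc (i + 1)).2 ⟨hi, Nat.lt_succ_self i⟩⟩

/-! ### Normal forms for meager sets and for members of `𝔈` -/

lemma exists_isClosed_monotone {M : Set Cantor} (hM : IsMeagre M) :
    ∃ K : ℕ → Set Cantor, (∀ n, IsClosed (K n)) ∧ Monotone K ∧ (∀ n, IsMeagre (K n)) ∧
      M ⊆ ⋃ n, K n := by
  obtain ⟨S, hS, hc, hMS⟩ := isMeagre_iff_countable_union_isNowhereDense.1 hM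
  obtain ⟨t, ht⟩ := (hc.insert ∅).exists_eq_range (insert_nonempty _ _)
  have hn : ∀ n, IsNowhereDense (t n) := fun n => by
    have : t n ∈ insert ∅ S := ht ▸ mem_range_self n
    rcases this with h | h
    · rw [h]; exact isNowhereDense_empty
    · exact hS _ h
  refine ⟨fun n => ⋃ i ∈ Iic n, closure (t i), fun n => ?_, fun a b hab => ?_, fun n => ?_,
    fun x hx => ?_⟩
  · exact (finite_Iic n).isClosed_biUnion fun i _ => isClosed_closure
  · exact biUnion_subset_biUnion_left (Iic_subset_Iic.2 hab)
  · exact isMeagre_iUnion fun i => isMeagre_iUnion fun _ => (hn i).closure.isMeagre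
  · obtain ⟨s, hs, hxs⟩ := hMS hx
    obtain ⟨n, rfl⟩ : s ∈ range t := ht ▸ mem_insert_of_mem _ hs
    exact mem_iUnion.2 ⟨n, mem_biUnion (mem_Iic.2 le_rfl) (subset_closure hxs)⟩

lemma IsMeagre.agreeing_Ici {K : Set Cantor} (hK : IsMeagre K) (p : ℕ) :
    IsMeagre (agreeing K (Ici p)) := by
  rw [CantorAdd.agreeing_Ici]
  exact isMeagre_iUnion fun s => hK.preimage_of_isOpenMap (continuous_const_add _)
    (isOpenMap_add_left _)

theorem IsMeagre.exists_blocks {M : Set Cantor} (hM : IsMeagre M) {f : ℕ → ℕ}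
    (hf : StrictMono f) :
    ∃ g : ℕ → ℕ, StrictMono g ∧ g 0 = 0 ∧ ∃ z : Cantor, ∀ w ∈ M, ∀ᶠ n in atTop,
      ¬ EqOn w z (Ico (f (g n)) (f (g (n + 1)))) := by
  obtain ⟨K, hcl, hmono, hme, hMK⟩ := exists_isClosed_monotone hM
  obtain ⟨g, hg, hg0, h⟩ := exists_strictMono_of_eventually
    (P := fun n a b => ∃ z : Cantor, ∀ w, EqOn w z (Ico (f a) (f b)) → w ∉ K n) fun n a => by
      have hne : (agreeing (K n) (Ici (f a)))ᶜ.Nonempty := by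
        rw [nonempty_compl]
        intro h
        exact not_isMeagre_of_isOpen isOpen_univ univ_nonempty
          (h ▸ IsMeagre.agreeing_Ici (hme n) (f a))
      obtain ⟨z, hz⟩ := hne
      have hz' : ∃ q, z ∉ agreeing (K n) (Ico (f a) q) := by
        rw [← iInter_agreeing (hcl n)] at hz
        simpa using hz
      obtain ⟨q, hq⟩ := hz'
      refine ⟨q, fun b hb => ⟨z, fun w hw hwK => hq ⟨w, hwK, ?_⟩⟩⟩
      exact hw.symm.mono (Ico_subset_Ico_right (hb.trans (hf.le_apply)))
  choose z hz using h
  obtain ⟨y, hy⟩ := exists_blockwise (hf.comp hg) z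
  refine ⟨g, hg, hg0, y, fun w hw => ?_⟩
  obtain ⟨m, hm⟩ := mem_iUnion.1 (hMK hw)
  filter_upwards [eventually_ge_atTop m] with n hn hwy
  exact hz n w (hwy.trans (hy n)) (hmono hn hm)

lemma isMeagre_eventually_not_eqOn {h : ℕ → ℕ} (hh : StrictMono h) (z : Cantor) :
    IsMeagre {w : Cantor | ∀ᶠ n in atTop, ¬ EqOn w z (Ico (h n) (h (n + 1)))} := by
  have : {w : Cantor | ∀ᶠ n in atTop, ¬ EqOn w z (Ico (h n) (h (n + 1)))} =
      ⋃ m, ⋂ n ∈ Ici m, {w | ¬ EqOn w z (Ico (h n) (h (n + 1)))} := by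
    ext w
    simp [eventually_atTop]
  rw [this]
  refine isMeagre_iUnion fun m => IsNowhereDense.isMeagre ?_
  have hcl : IsClosed (⋂ n ∈ Ici m, {w : Cantor | ¬ EqOn w z (Ico (h n) (h (n + 1)))}) := by
    refine isClosed_biInter fun n _ => ?_
    have : DependsOn (· ∈ {w : Cantor | ¬ EqOn w z (Ico (h n) (h (n + 1)))})
        (Iio (h (n + 1))) := fun x y hxy => by
      have : EqOn x y (Ico (h n) (h (n + 1))) := fun i hi => hxy i hi.2
      exact propext (not_congr ⟨this.symm.trans, this.trans⟩)
    exact (isClopen_of_dependsOn this).isClosed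
  rw [hcl.isNowhereDense_iff, eq_empty_iff_forall_notMem]
  intro w hw
  obtain ⟨p, hp⟩ := exists_cyl_subset isOpen_interior hw
  let n := max m p
  let u : Cantor := fun i => if i < p then w i else z i
  have hu : u ∈ cyl w p := fun i hi => if_pos hi
  have := mem_iInter₂.1 (interior_subset (hp hu)) n (le_max_left m p)
  refine this fun i hi => if_neg (not_lt.2 ?_)
  exact (le_max_right m p).trans ((hh.le_apply).trans hi.1)

/-- The Haar measure used to define `𝔈`. -/
noncomputable abbrev haar : Measure Cantor := Measure.addHaar

theorem MemE.exists_blocks {E : Set Cantor} (hE : MemE E) {f : ℕ → ℕ} (hf : StrictMono f)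
    {δ : ℕ → ℝ≥0∞} (hδ : ∀ n, 0 < δ n) :
    ∃ g : ℕ → ℕ, StrictMono g ∧ g 0 = 0 ∧ ∃ A : ℕ → Set Cantor,
      (∀ n, DependsOn (· ∈ A n) (Ico (f (g n)) (f (g (n + 1))))) ∧ (∀ n, haar (A n) ≤ δ n) ∧
      ∀ e ∈ E, ∀ᶠ n in atTop, e ∈ A n := by
  obtain ⟨F, hEF, hF, C, hC, rfl⟩ := hE
  let K : ℕ → Set Cantor := fun n => ⋃ i ∈ Iic n, C i
  have hK : ∀ n, IsClosed (K n) := fun n => (finite_Iic n).isClosed_biUnion fun i _ => hC i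
  have hK0 : ∀ n, haar (K n) = 0 := fun n =>
    measure_mono_null (iUnion₂_subset fun i _ => subset_iUnion C i) hF
  have hdep : ∀ n p q, DependsOn (· ∈ agreeing (K n) (Ico p q)) (Iio q) := fun n p q x y h =>
    dependsOn_agreeing (K n) (Ico p q) fun i hi => h i hi.2
  obtain ⟨g, hg, hg0, h⟩ := exists_strictMono_of_eventually
    (P := fun n a b => haar (agreeing (K n) (Ico (f a) (f b))) ≤ δ n) fun n a => by
      have hlim := tendsto_measure_iInter_atTop (μ := haar)
        (s := fun q => agreeing (K n) (Ico (f a) q))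
        (fun q => (measurableSet_of_dependsOn (hdep n _ q)).nullMeasurableSet)
        (fun q r hqr => agreeing_anti _ (Ico_subset_Ico_right hqr)) ⟨0, measure_ne_top _ _⟩
      have hnull : haar (agreeing (K n) (Ici (f a))) = 0 := by
        rw [agreeing_Ici]
        refine measure_iUnion_null fun s => ?_
        rw [measure_preimage_add, hK0]
      rw [iInter_agreeing (hK n), hnull] at hlim
      obtain ⟨q, hq⟩ := eventually_atTop.1 (hlim.eventually_lt_const (hδ n))
      exact ⟨q, fun b hb => (hq _ (hb.trans (hf.le_apply))).le⟩
  refine ⟨g, hg, hg0, _, fun n => dependsOn_agreeing _ _, h, fun e he => ?_⟩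
  obtain ⟨m, hm⟩ := mem_iUnion.1 (hEF he)
  filter_upwards [eventually_ge_atTop m] with n hn
  exact subset_agreeing _ _ (mem_biUnion (mem_Iic.2 hn) hm)

/-! ### Shelah's combinatorial property -/

/-- Shelah's combinatorial property: for every interval partition given by `f` there are a coarser
partition and a sequence `y` such that each `x ∈ X` agrees, within almost every coarse block, with
`y` on some fine block. -/
def BlockGuessable (X : Set Cantor) : Prop :=
  ∀ f : ℕ → ℕ, StrictMono f → ∃ g : ℕ → ℕ, StrictMono g ∧ g 0 = 0 ∧ ∃ y : Cantor, ∀ x ∈ X,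
    ∀ᶠ n in atTop, ∃ k ∈ Ico (g n) (g (n + 1)), EqOn x y (Ico (f k) (f (k + 1)))

theorem BlockGuessable.isMeagre_add {X M : Set Cantor} (hX : BlockGuessable X)
    (hM : IsMeagre M) : IsMeagre (X + M) := by
  obtain ⟨f, hf, -, z, hz⟩ := IsMeagre.exists_blocks hM strictMono_id
  obtain ⟨g, hg, -, y, hy⟩ := hX f hf
  refine (isMeagre_eventually_not_eqOn (hf.comp hg) (y + z)).mono ?_
  rintro _ ⟨x, hx, w, hw, rfl⟩
  obtain ⟨m, hm⟩ := eventually_atTop.1 (hz w hw)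
  filter_upwards [hy x hx, eventually_ge_atTop m] with n ⟨k, hk, hxy⟩ hn hxw
  refine hm k (hn.trans (hg.le_apply.trans hk.1)) fun i hi => ?_
  have h := hxw (x := i) ⟨(hf.monotone hk.1).trans hi.1, hi.2.trans_le (hf.monotone hk.2)⟩
  simp only [Pi.add_apply, hxy hi] at h
  exact add_left_cancel h

theorem blockGuessable_of_isMeagre_add {X : Set Cantor}
    (hX : ∀ M : Set Cantor, IsMeagre M → IsMeagre (X + M)) : BlockGuessable X := by
  intro f hf
  obtain ⟨g, hg, hg0, z, hz⟩ :=
    IsMeagre.exists_blocks (hX _ (isMeagre_eventually_not_eqOn hf 0)) hf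
  refine ⟨g, hg, hg0, z, fun x hx => ?_⟩
  by_contra hbad
  obtain ⟨w, hw⟩ : ∃ w : Cantor, ∀ n,
      (∀ k ∈ Ico (g n) (g (n + 1)), ¬ EqOn w 0 (Ico (f k) (f (k + 1)))) ∧
      ((∃ k ∈ Ico (g n) (g (n + 1)), EqOn x z (Ico (f k) (f (k + 1)))) ∨
        EqOn (x + w) z (Ico (f (g n)) (f (g (n + 1))))) := by
    have hloc : ∀ n, ∃ u : Cantor,
        (∀ k ∈ Ico (g n) (g (n + 1)), ¬ EqOn u 0 (Ico (f k) (f (k + 1)))) ∧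
        ((∃ k ∈ Ico (g n) (g (n + 1)), EqOn x z (Ico (f k) (f (k + 1)))) ∨
          EqOn (x + u) z (Ico (f (g n)) (f (g (n + 1))))) := by
      intro n
      by_cases h : ∃ k ∈ Ico (g n) (g (n + 1)), EqOn x z (Ico (f k) (f (k + 1)))
      · refine ⟨1, fun k _ hk => ?_, Or.inl h⟩
        exact one_ne_zero (hk (x := f k) ⟨le_rfl, hf k.lt_succ_self⟩)
      · refine ⟨x + z, fun k hk h0 => h ⟨k, hk, fun i hi => ?_⟩, Or.inr fun i _ => ?_⟩
        · exact CharTwo.add_eq_zero.1 (h0 hi)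
        · rw [← add_assoc, add_self_eq_zero, zero_add]
    choose u hu hu' using hloc
    obtain ⟨w, hw⟩ := exists_blockwise (hf.comp hg) u
    refine ⟨w, fun n => ⟨fun k hk hk0 => hu n k hk ?_, (hu' n).imp_right fun h i hi => ?_⟩⟩
    · refine ((hw n).mono ?_).symm.trans hk0
      exact Ico_subset_Ico (hf.monotone hk.1) (hf.monotone hk.2)
    · rw [← h hi, Pi.add_apply, Pi.add_apply, hw n hi]
  have hwM : ∀ᶠ n in atTop, ¬ EqOn w 0 (Ico (f n) (f (n + 1))) := .of_forall fun n => by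
    obtain ⟨j, hj⟩ := exists_block hg hg0 n
    exact (hw j).1 n hj
  refine hbad ((hz (x + w) (add_mem_add hx hwM)).mono fun n hn => ?_)
  exact (hw n).2.resolve_right hn

lemma ediam_le_of_eqOn {U : Set Cantor} {n : ℕ}
    (h : ∀ x ∈ U, ∀ y ∈ U, EqOn x y (Iio n)) :
    Metric.ediam U ≤ ENNReal.ofReal ((1 / 2) ^ n) := by
  refine Metric.ediam_le fun x hx y hy => ?_
  rw [edist_dist]
  refine ENNReal.ofReal_le_ofReal (PiNat.mem_cylinder_iff_dist_le.1 fun i hi => ?_)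
  exact h x hx y hy hi

lemma eqOn_of_ediam_le {U : Set Cantor} {n : ℕ}
    (h : Metric.ediam U ≤ ENNReal.ofReal ((1 / 2) ^ n)) {x y : Cantor} (hx : x ∈ U)
    (hy : y ∈ U) : EqOn x y (Iio n) := by
  have := (Metric.edist_le_ediam_of_mem hx hy).trans h
  rw [edist_dist, ENNReal.ofReal_le_ofReal_iff (by positivity)] at this
  exact fun i hi => PiNat.mem_cylinder_iff_dist_le.2 this i hi

theorem IsSSMZ.blockGuessable {X : Set Cantor} (hX : IsSSMZ X) : BlockGuessable X := by
  intro f hf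
  obtain ⟨U, ⟨g, hg0, hg, hU⟩, hdiam⟩ := hX (fun n => (1 / 2) ^ f (n + 1)) fun n => by positivity
  have hpt : ∀ n, ∃ c : Cantor, ∀ x ∈ U n, EqOn x c (Iio (f (n + 1))) := fun n => by
    rcases (U n).eq_empty_or_nonempty with h | ⟨c, hc⟩
    · exact ⟨0, by simp [h]⟩
    · exact ⟨c, fun x hx => eqOn_of_ediam_le (hdiam n) hx hc⟩
  choose c hc using hpt
  obtain ⟨y, hy⟩ := exists_blockwise hf c
  refine ⟨g, hg, hg0, y, fun x hx => (hU x hx).mono fun j ⟨n, h1, h2, hxn⟩ => ?_⟩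
  exact ⟨n, ⟨h1, h2⟩, ((hc n x hxn).mono fun i hi => hi.2).trans (hy n).symm⟩

theorem BlockGuessable.isSSMZ {X : Set Cantor} (hX : BlockGuessable X) : IsSSMZ X := by
  intro ε hε
  have hpow : ∀ n, ∃ d : ℕ, (1 / 2 : ℝ) ^ d ≤ ε n := fun n =>
    (exists_pow_lt_of_lt_one (hε n) (by norm_num)).imp fun d hd => hd.le
  choose d hd using hpow
  -- `s k` is a pair: the cut point `f k` and the number of cylinders used before stage `k`
  let s : ℕ → ℕ × ℕ := fun k => Nat.rec (0, 0)
    (fun _ a => (a.1 + 1 + ∑ n ∈ Finset.range (a.2 + 2 ^ a.1), d n, a.2 + 2 ^ a.1)) k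
  let f : ℕ → ℕ := fun k => (s k).1
  let N : ℕ → ℕ := fun k => (s k).2
  have hf' : ∀ k, f (k + 1) = f k + 1 + ∑ n ∈ Finset.range (N (k + 1)), d n := fun k => rfl
  have hN' : ∀ k, N (k + 1) = N k + 2 ^ f k := fun k => rfl
  have hf : StrictMono f := strictMono_nat_of_lt_succ fun k => by rw [hf']; omega
  have hN : StrictMono N := strictMono_nat_of_lt_succ fun k => by
    rw [hN']; exact Nat.lt_add_of_pos_right (by positivity)
  have hN0 : N 0 = 0 := rfl
  have hdf : ∀ k n, n < N (k + 1) → d n ≤ f (k + 1) := fun k n hn => by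
    have := Finset.single_le_sum (f := d) (fun i _ => Nat.zero_le _) (Finset.mem_range.2 hn)
    rw [hf']; omega
  obtain ⟨g, hg, hg0, y, hy⟩ := hX f hf
  have henum : ∀ k, Nonempty ((Fin k → ZMod 2) ≃ Fin (2 ^ k)) := fun k =>
    ⟨Fintype.equivFinOfCardEq (by simp)⟩
  let e : ∀ k, (Fin k → ZMod 2) ≃ Fin (2 ^ k) := fun k => (henum k).some
  refine ⟨fun n => {x | ∃ k, N k + e (f k) (initial (f k) x) = n ∧
      EqOn x y (Ico (f k) (f (k + 1)))}, ⟨N ∘ g, by simp [hg0, hN0], hN.comp hg, fun x hx =>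
        (hy x hx).mono fun j ⟨k, hk, hxy⟩ => ?_⟩, fun n => ?_⟩
  · have hlt := (e (f k) (initial (f k) x)).2
    refine ⟨_, ?_, ?_, k, rfl, hxy⟩
    · exact (hN.monotone hk.1).trans (Nat.le_add_right _ _)
    · refine lt_of_lt_of_le ?_ (hN.monotone hk.2)
      rw [hN']
      exact Nat.add_lt_add_left hlt _
  · obtain ⟨k, hk⟩ := exists_block hN hN0 n
    have huniq : ∀ l (u : Fin (2 ^ f l)), N l + u = n → l = k := fun l u hl => by
      have := u.2
      have := hN' l
      exact block_unique hN (n := n) ⟨by omega, by omega⟩ hk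
    refine (ediam_le_of_eqOn (n := f (k + 1)) ?_).trans (ENNReal.ofReal_le_ofReal ?_)
    · rintro x ⟨l, hl, hx⟩ x' ⟨l', hl', hx'⟩ i hi
      obtain rfl := huniq l _ hl
      obtain rfl := huniq l' _ hl'
      rcases lt_or_ge i (f l') with h | h
      · have : initial (f l') x = initial (f l') x' := (e (f l')).injective (Fin.ext (by omega))
        exact initial_eq_iff.1 this h
      · exact (hx ⟨h, hi⟩).trans (hx' ⟨h, hi⟩).symm
    · exact (pow_le_pow_of_le_one (by norm_num) (by norm_num) (hdf k n hk.2)).trans (hd n)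

lemma MemE.mono {E F : Set Cantor} (hF : MemE F) (h : E ⊆ F) : MemE E := by
  obtain ⟨G, hG, h0⟩ := hF
  exact ⟨G, h.trans hG, h0⟩

theorem BlockGuessable.exists_isSigmaCompact {X E : Set Cantor} (hX : BlockGuessable X)
    (hE : MemE E) : ∃ F : Set Cantor, IsSigmaCompact F ∧ X ⊆ F ∧ MemE (F + E) := by
  obtain ⟨δ, hδ, hsum⟩ := ENNReal.exists_pos_sum_of_countable' one_ne_zero ℕ
  obtain ⟨f, hf, -, A, hA, hAδ, hEA⟩ := MemE.exists_blocks hE strictMono_id hδ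
  obtain ⟨g, hg, -, y, hy⟩ := hX f hf
  let T : ℕ → Set Cantor := fun n =>
    ⋃ k ∈ Ico (g n) (g (n + 1)), {x | EqOn x y (Ico (f k) (f (k + 1)))}
  let D : ℕ → Set Cantor := fun n => ⋃ k ∈ Ico (g n) (g (n + 1)), (y + ·) ⁻¹' A k
  have hTcl : ∀ n, IsClosed (T n) := fun n => (finite_Ico _ _).isClosed_biUnion fun k _ => by
    refine (isClopen_of_dependsOn (n := f (k + 1)) fun u v huv => ?_).isClosed
    have : EqOn u v (Ico (f k) (f (k + 1))) := fun i hi => huv i hi.2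
    exact propext ⟨this.symm.trans, this.trans⟩
  have hDcl : ∀ n, IsClosed (D n) := fun n => (finite_Ico _ _).isClosed_biUnion fun k _ =>
    (isClopen_of_dependsOn (n := f (k + 1)) fun u v huv =>
      hA k fun i hi => huv i hi.2).isClosed.preimage (continuous_const_add y)
  refine ⟨⋃ m, ⋂ n ∈ Ici m, T n, isSigmaCompact_iUnion_of_isCompact _ fun m =>
      (isClosed_biInter fun n _ => hTcl n).isCompact, fun x hx => ?_,
    ⋃ m, ⋂ n ∈ Ici m, D n, ?_, ?_, _, fun m => isClosed_biInter fun n _ => hDcl n, rfl⟩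
  · obtain ⟨m, hm⟩ := eventually_atTop.1 (hy x hx)
    refine mem_iUnion.2 ⟨m, mem_iInter₂.2 fun n hn => ?_⟩
    simpa [T] using hm n hn
  · rintro _ ⟨x, hx, e, he, rfl⟩
    obtain ⟨m, hm⟩ := mem_iUnion.1 hx
    obtain ⟨l, hl⟩ := eventually_atTop.1 (hEA e he)
    refine mem_iUnion.2 ⟨max m l, mem_iInter₂.2 fun n hn => ?_⟩
    obtain ⟨k, hk, hxk⟩ := mem_iUnion₂.1 (mem_iInter₂.1 hm n ((le_max_left m l).trans hn))
    refine mem_iUnion₂.2 ⟨k, hk, ?_⟩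
    have hek := hl k (((le_max_right m l).trans hn).trans (hg.le_apply.trans hk.1))
    refine (hA k fun i hi => ?_).mp hek
    change e i = y i + (x i + e i)
    rw [hxk hi, ← add_assoc, CharTwo.add_self_eq_zero, zero_add]
  · refine measure_iUnion_null fun m => ?_
    have hlim : haar (limsup (fun k => (y + ·) ⁻¹' A k) atTop) = 0 := by
      refine measure_limsup_atTop_eq_zero (ne_top_of_le_ne_top ENNReal.one_ne_top ?_)
      refine le_trans (ENNReal.tsum_le_tsum fun k => ?_) hsum.le
      rw [measure_preimage_add]
      exact hAδ k
    refine measure_mono_null (fun w hw => ?_) hlim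
    rw [mem_limsup_iff_frequently_mem, frequently_atTop]
    intro a
    obtain ⟨k, hk, hwk⟩ := mem_iUnion₂.1 (mem_iInter₂.1 hw (max m a) (le_max_left m a))
    exact ⟨k, (le_max_right m a).trans (hg.le_apply.trans hk.1), hwk⟩

/-! ### Quadratic forms with small translates' intersections -/

/-- A quadratic form on the coordinates `p, …, p + 2 m`. -/
def quad (p m : ℕ) (w : Cantor) : ZMod 2 :=
  w (p + 2 * m) + ∑ i ∈ Finset.range m, w (p + i) * w (p + m + i)

lemma dependsOn_quad (p m : ℕ) : DependsOn (quad p m) (Ico p (p + 2 * m + 1)) := by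
  intro x y h
  unfold quad
  rw [h _ ⟨by omega, by omega⟩]
  congr 1
  refine Finset.sum_congr rfl fun i hi => ?_
  rw [Finset.mem_range] at hi
  rw [h _ ⟨by omega, by omega⟩, h _ ⟨by omega, by omega⟩]

lemma continuous_quad (p m : ℕ) : Continuous (quad p m) := by
  unfold quad
  fun_prop

lemma quad_zero (p m : ℕ) : quad p m 0 = 0 := by simp [quad]

lemma quad_add_single_last (p m : ℕ) (w : Cantor) :
    quad p m (w + Pi.single (p + 2 * m) 1) = quad p m w + 1 := by
  have : ∀ i ∈ Finset.range m, (w + Pi.single (p + 2 * m) 1 : Cantor) (p + i) *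
      (w + Pi.single (p + 2 * m) 1 : Cantor) (p + m + i) = w (p + i) * w (p + m + i) := by
    intro i hi
    rw [Finset.mem_range] at hi
    rw [Pi.add_apply, Pi.add_apply, Pi.single_eq_of_ne (by omega), Pi.single_eq_of_ne (by omega),
      add_zero, add_zero]
  rw [quad, Finset.sum_congr rfl this, Pi.add_apply, Pi.single_eq_same, quad]
  ring

lemma quad_add_single {p m j : ℕ} (hj : j < m) (w : Cantor) :
    quad p m (w + Pi.single (p + m + j) 1) = quad p m w + w (p + j) := by
  have : ∀ i ∈ Finset.range m, (w + Pi.single (p + m + j) 1 : Cantor) (p + i) *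
      (w + Pi.single (p + m + j) 1 : Cantor) (p + m + i) =
      w (p + i) * w (p + m + i) + if i = j then w (p + i) else 0 := by
    intro i hi
    rw [Finset.mem_range] at hi
    rw [Pi.add_apply, Pi.add_apply, Pi.single_eq_of_ne (by omega), add_zero]
    split_ifs with h
    · rw [h, Pi.single_eq_same, mul_add, mul_one]
    · rw [Pi.single_eq_of_ne (by omega), add_zero, add_zero]
  rw [quad, Finset.sum_congr rfl this, Pi.add_apply, Pi.single_eq_of_ne (by omega), add_zero,
    Finset.sum_add_distrib, Finset.sum_ite_eq', if_pos (Finset.mem_range.2 hj), quad, add_assoc]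

/-- The sign character of `ZMod 2`, negative at `0`. -/
def sgn (a : ZMod 2) : ℤ := if a = 0 then -1 else 1

lemma sgn_mul_self : ∀ a : ZMod 2, sgn a * sgn a = 1 := by decide

lemma sgn_add_mul_sgn_add :
    ∀ a b s t : ZMod 2, s ≠ t → sgn (a + s) * sgn (b + t) = -(sgn a * sgn b) := by decide

lemma continuous_sgn_quad (p m : ℕ) (c : Cantor) :
    Continuous fun w : Cantor => (sgn (quad p m (w + c)) : ℝ) :=
  (continuous_of_discreteTopology (f := fun a : ZMod 2 => (sgn a : ℝ))).comp
    ((continuous_quad p m).comp (continuous_add_const c))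

lemma setIntegral_sgn_quad_mul {p m j : ℕ} (hj : j < m) {c c' : Cantor}
    (hc : c (p + j) ≠ c' (p + j)) (v : Cantor) :
    ∫ w in cyl v p, (sgn (quad p m (w + c)) : ℝ) * sgn (quad p m (w + c')) ∂haar = 0 := by
  rw [← integral_indicator (isClopen_cyl v p).isOpen.measurableSet]
  set F : Cantor → ℝ := (cyl v p).indicator
    fun w => (sgn (quad p m (w + c)) : ℝ) * sgn (quad p m (w + c')) with hF
  have hneg : ∀ w, F (w + Pi.single (p + m + j) 1) = - F w := by
    intro w
    have hmem : w + Pi.single (p + m + j) 1 ∈ cyl v p ↔ w ∈ cyl v p := by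
      refine iff_of_eq (dependsOn_cyl v p fun i hi => ?_)
      rw [mem_Iio] at hi
      rw [Pi.add_apply, Pi.single_eq_of_ne (by omega), add_zero]
    by_cases hw : w ∈ cyl v p
    · rw [hF, indicator_of_mem hw, indicator_of_mem (hmem.2 hw), add_right_comm w _ c,
        add_right_comm w _ c', quad_add_single hj, quad_add_single hj]
      have := sgn_add_mul_sgn_add (quad p m (w + c)) (quad p m (w + c')) ((w + c) (p + j))
        ((w + c') (p + j)) (by simpa using hc)
      exact_mod_cast this
    · rw [hF, indicator_of_notMem hw, indicator_of_notMem (mt hmem.1 hw), neg_zero]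
  have h := integral_add_right_eq_self (μ := haar) F (Pi.single (p + m + j) 1)
  simp only [hneg, integral_neg] at h
  linarith

lemma measure_forall_quad_ne_zero_le {p m N : ℕ} {c : Fin N → Cantor}
    (hc : ∀ i j, i ≠ j → ∃ l < m, c i (p + l) ≠ c j (p + l)) (v : Cantor) :
    N * haar.real (cyl v p ∩ {w | ∀ i, quad p m (w + c i) ≠ 0}) ≤ haar.real (cyl v p) := by
  rcases Nat.eq_zero_or_pos N with rfl | hN
  · simp
  set V := cyl v p
  set B := {w : Cantor | ∀ i, quad p m (w + c i) ≠ 0}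
  let Z : Cantor → ℝ := fun w => ∑ i, (sgn (quad p m (w + c i)) : ℝ)
  have hV : IsClopen V := isClopen_cyl v p
  have hB : IsClopen B := by
    have : B = ⋂ i, (fun w : Cantor => quad p m (w + c i)) ⁻¹' {0}ᶜ := by
      ext w; simp [B]
    rw [this]
    exact isClopen_iInter_of_finite fun i => (isClopen_discrete _).preimage
      ((continuous_quad p m).comp (continuous_add_const _))
  have hZc : Continuous Z := continuous_finsetSum _ fun i _ => continuous_sgn_quad p m (c i)
  have hint : ∀ i j, IntegrableOn (fun w => (sgn (quad p m (w + c i)) : ℝ) *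
      sgn (quad p m (w + c j))) V haar := fun i j =>
    ((continuous_sgn_quad p m (c i)).mul
      (continuous_sgn_quad p m (c j))).continuousOn.integrableOn_compact hV.isClosed.isCompact
  have hZ : ∫ w in V, Z w ^ 2 ∂haar = N * haar.real V := by
    have : ∀ w, Z w ^ 2 =
        ∑ i, ∑ j, (sgn (quad p m (w + c i)) : ℝ) * sgn (quad p m (w + c j)) := fun w => by
      rw [sq, Finset.sum_mul_sum]
    simp only [this]
    rw [integral_finsetSum _ fun i _ => integrable_finsetSum _ fun j _ => hint i j]
    have hi : ∀ i, ∫ w in V, ∑ j, (sgn (quad p m (w + c i)) : ℝ) * sgn (quad p m (w + c j)) ∂haar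
        = haar.real V := fun i => by
      rw [integral_finsetSum _ fun j _ => hint i j, Finset.sum_eq_single i]
      · have h1 : ∀ a : ZMod 2, (sgn a : ℝ) * sgn a = 1 := fun a => by
          exact_mod_cast sgn_mul_self a
        simp [h1]
      · intro j _ hij
        obtain ⟨l, hl, hne⟩ := hc i j hij.symm
        exact setIntegral_sgn_quad_mul hl hne v
      · simp
    simp [hi]
  have hle : ∫ w in V ∩ B, Z w ^ 2 ∂haar ≤ ∫ w in V, Z w ^ 2 ∂haar :=
    setIntegral_mono_set ((hZc.pow 2).continuousOn.integrableOn_compact hV.isClosed.isCompact)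
      (ae_of_all _ fun w => sq_nonneg _) inter_subset_left.eventuallyLE
  have hVB : ∫ w in V ∩ B, Z w ^ 2 ∂haar = N ^ 2 * haar.real (V ∩ B) := by
    rw [setIntegral_congr_fun (g := fun _ => (N : ℝ) ^ 2)
      (hV.isOpen.inter hB.isOpen).measurableSet fun w hw => ?_]
    · simp [mul_comm]
    · have : ∀ i, sgn (quad p m (w + c i)) = 1 := fun i => if_neg (hw.2 i)
      simp [Z, this]
  rw [hVB, hZ] at hle
  have hN' : (0 : ℝ) < N := by exact_mod_cast hN
  nlinarith [hle]

lemma sum_measureReal_inter_cyl (B : Set Cantor) (n : ℕ) :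
    ∑ s : Fin n → ZMod 2, haar.real (B ∩ cyl (extend s) n) = haar.real B := by
  have h := sum_measureReal_preimage_singleton (μ := haar.restrict B)
    (Finset.univ : Finset (Fin n → ZMod 2)) (f := initial n) fun s _ =>
      ((isClopen_discrete {s}).preimage (continuous_initial n)).isOpen.measurableSet
  rw [Finset.coe_univ, preimage_univ, measureReal_restrict_apply_univ] at h
  rw [← h]
  refine Finset.sum_congr rfl fun s _ => ?_
  rw [cyl_eq_preimage, initial_extend, measureReal_restrict_apply
    ((isClopen_discrete {s}).preimage (continuous_initial n)).isOpen.measurableSet, inter_comm]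

lemma mul_measureReal_le_of_cyl {A B : Set Cantor} {n : ℕ} (hB : DependsOn (· ∈ B) (Iio n))
    {ρ : ℝ} (h : ∀ v ∈ B, ρ * haar.real (cyl v n) ≤ haar.real (A ∩ cyl v n)) :
    ρ * haar.real B ≤ haar.real (A ∩ B) := by
  rw [← sum_measureReal_inter_cyl B n, ← sum_measureReal_inter_cyl (A ∩ B) n, Finset.mul_sum]
  refine Finset.sum_le_sum fun s _ => ?_
  by_cases hs : extend s ∈ B
  · have : cyl (extend s) n ⊆ B := fun w hw => (hB hw).mpr hs
    rw [inter_assoc, inter_eq_right.2 this]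
    exact h _ hs
  · have : B ∩ cyl (extend s) n = ∅ :=
      eq_empty_iff_forall_notMem.2 fun w hw => hs ((hB hw.2).mp hw.1)
    rw [this]
    simp

lemma exists_representatives {α β : Type*} [Nonempty α] (r : α → β) (S : Set α) {N : ℕ}
    (hN : ∀ c : Fin N → α, (∀ i, c i ∈ S) → ¬ Function.Injective (r ∘ c)) :
    ∃ t : Fin N → α, ∀ x ∈ S, ∃ i, r x = r (t i) := by
  rcases Function.Embedding.total (Fin N) (r '' S) with ⟨⟨φ⟩⟩ | ⟨⟨φ⟩⟩
  · have h : ∀ i, ∃ x ∈ S, r x = φ i := fun i => (φ i).2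
    choose c hc hcφ using h
    refine absurd (fun i j hij => ?_) (hN c hc)
    exact φ.injective (Subtype.ext ((hcφ i).symm.trans (hij.trans (hcφ j))))
  · have h : ∀ i, ∃ y : α, ∀ b, φ b = i → r y = b := fun i => by
      by_cases hi : ∃ b, φ b = i
      · obtain ⟨b, rfl⟩ := hi
        obtain ⟨y, -, hy⟩ := b.2
        exact ⟨y, fun b' hb' => by rw [hy, φ.injective hb']⟩
      · exact ⟨Classical.arbitrary α, fun b hb => absurd ⟨b, hb⟩ hi⟩
    choose t ht using h
    exact ⟨t, fun x hx => ⟨_, (ht _ ⟨r x, mem_image_of_mem r hx⟩ rfl).symm⟩⟩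

lemma exists_guess_of_cyl {p m p' N : ℕ} (hp' : p + 2 * m < p') (hN : 0 < N) {A : Set Cantor}
    {θ θ' : ℝ} (hθ' : 0 ≤ θ') (hθ : N * θ ≤ (N - 1) * θ') {v : Cantor}
    (hA : haar.real (A ∩ cyl v p) < θ * haar.real (cyl v p)) :
    ∃ t : Fin N → Cantor, ∀ x : Cantor,
      (∀ w ∈ cyl v p, quad p m (w + x) = 0 →
        θ' * haar.real (cyl w p') ≤ haar.real (A ∩ cyl w p')) →
      ∃ i, EqOn x (t i) (Ico p (p + m)) := by
  have hS : ∀ c : Fin N → Cantor, (∀ i, c i ∈ {x : Cantor | ∀ w ∈ cyl v p,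
      quad p m (w + x) = 0 → θ' * haar.real (cyl w p') ≤ haar.real (A ∩ cyl w p')}) →
      ¬ Function.Injective ((fun (x : Cantor) (i : Fin m) => x (p + i)) ∘ c) := by
    intro c hc hinj
    have hne : ∀ i j, i ≠ j → ∃ l < m, c i (p + l) ≠ c j (p + l) := fun i j hij => by
      by_contra! h
      exact hij (hinj (funext fun l => h l l.2))
    have hcheb := measure_forall_quad_ne_zero_le hne v
    set V := cyl v p
    set G := {w : Cantor | ∀ i, quad p m (w + c i) ≠ 0}
    have hG : DependsOn (· ∈ G) (Iio p') := fun x y hxy => by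
      have : ∀ i, quad p m (x + c i) = quad p m (y + c i) := fun i =>
        dependsOn_quad p m fun l hl => by
          have := hl.2
          rw [Pi.add_apply, Pi.add_apply, hxy l (mem_Iio.2 (by omega))]
      simp [G, this]
    have hV : DependsOn (· ∈ V) (Iio p') := fun x y hxy =>
      dependsOn_cyl v p fun l hl => hxy l (mem_Iio.2 (by have := mem_Iio.1 hl; omega))
    have hVG : DependsOn (· ∈ V \ G) (Iio p') := fun x y hxy => by
      have h1 : (x ∈ G) = (y ∈ G) := hG hxy
      have h2 : (x ∈ V) = (y ∈ V) := hV hxy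
      change (x ∈ V ∧ ¬ x ∈ G) = (y ∈ V ∧ ¬ y ∈ G)
      rw [h1, h2]
    have hlow : θ' * haar.real (V \ G) ≤ haar.real (A ∩ (V \ G)) := by
      refine mul_measureReal_le_of_cyl hVG fun w hw => ?_
      obtain ⟨i, hi⟩ : ∃ i, quad p m (w + c i) = 0 := by simpa [G] using hw.2
      exact hc i w hw.1 hi
    have hmono : haar.real (A ∩ (V \ G)) ≤ haar.real (A ∩ V) :=
      measureReal_mono (inter_subset_inter_right A sdiff_subset)
    have hsplit := measureReal_inter_add_sdiff (μ := haar) (s := V) (measurableSet_of_dependsOn hG)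
    have hN' : (0 : ℝ) < N := by exact_mod_cast hN
    have h1 : N * (θ' * haar.real (V \ G)) < N * (θ * haar.real V) :=
      mul_lt_mul_of_pos_left (hlow.trans_lt (hmono.trans_lt hA)) hN'
    have h2 : N * θ * haar.real V ≤ (N - 1) * θ' * haar.real V :=
      mul_le_mul_of_nonneg_right hθ measureReal_nonneg
    have h3 : θ' * (N * haar.real (V ∩ G)) ≤ θ' * haar.real V :=
      mul_le_mul_of_nonneg_left hcheb hθ'
    have h4 : N * θ' * (haar.real (V ∩ G) + haar.real (V \ G)) = N * θ' * haar.real V := by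
      rw [hsplit]
    linarith
  obtain ⟨t, ht⟩ := exists_representatives (fun (x : Cantor) (i : Fin m) => x (p + i))
    {x | ∀ w ∈ cyl v p, quad p m (w + x) = 0 →
      θ' * haar.real (cyl w p') ≤ haar.real (A ∩ cyl w p')} hS
  refine ⟨t, fun x hx => (ht x hx).imp fun i hi j hj => ?_⟩
  have := congrFun hi ⟨j - p, by have := hj.1; have := hj.2; omega⟩
  simpa [Nat.add_sub_cancel' hj.1] using this

lemma exists_guess {p m p' N : ℕ} (hp' : p + 2 * m < p') (hN : 0 < N) (A : Set Cantor)
    {θ θ' : ℝ} (hθ' : 0 ≤ θ') (hθ : N * θ ≤ (N - 1) * θ') :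
    ∃ t : Fin (2 ^ p * N) → Cantor, ∀ v x : Cantor,
      haar.real (A ∩ cyl v p) < θ * haar.real (cyl v p) →
      (∀ w ∈ cyl v p, quad p m (w + x) = 0 →
        θ' * haar.real (cyl w p') ≤ haar.real (A ∩ cyl w p')) →
      ∃ i, EqOn x (t i) (Ico p (p + m)) := by
  have h : ∀ s : Fin p → ZMod 2, ∃ t : Fin N → Cantor,
      haar.real (A ∩ cyl (extend s) p) < θ * haar.real (cyl (extend s) p) → ∀ x : Cantor,
      (∀ w ∈ cyl (extend s) p, quad p m (w + x) = 0 →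
        θ' * haar.real (cyl w p') ≤ haar.real (A ∩ cyl w p')) →
      ∃ i, EqOn x (t i) (Ico p (p + m)) := fun s => by
    by_cases hs : haar.real (A ∩ cyl (extend s) p) < θ * haar.real (cyl (extend s) p)
    · exact (exists_guess_of_cyl hp' hN hθ' hθ hs).imp fun t ht _ => ht
    · exact ⟨fun _ => 0, fun h => absurd h hs⟩
  choose t ht using h
  let e : Fin (2 ^ p * N) ≃ (Fin p → ZMod 2) × Fin N :=
    (Fintype.equivFinOfCardEq (by simp)).symm
  refine ⟨fun i => t (e i).1 (e i).2, fun v x hv hx => ?_⟩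
  have hcyl : cyl v p = cyl (extend (initial p v)) p :=
    cyl_congr (initial_eq_iff.1 (initial_extend _).symm)
  rw [hcyl] at hv hx
  obtain ⟨i, hi⟩ := ht _ hv x hx
  exact ⟨e.symm (initial p v, i), by simpa using hi⟩

/-- Density thresholds, increasing from `1 / 2` towards `1`. -/
noncomputable def threshold (k : ℕ) : ℝ := 1 - (1 / 2) ^ (k + 1)

lemma half_le_threshold (k : ℕ) : 1 / 2 ≤ threshold k := by
  have : (1 / 2 : ℝ) ^ (k + 1) ≤ (1 / 2) ^ 1 :=
    pow_le_pow_of_le_one (by norm_num) (by norm_num) (by omega)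
  rw [threshold]
  linarith

lemma threshold_lt_one (k : ℕ) : threshold k < 1 := by
  rw [threshold]
  linarith [show (0 : ℝ) < (1 / 2) ^ (k + 1) by positivity]

lemma mul_threshold_le (k : ℕ) : ((2 ^ (k + 2) : ℕ) : ℝ) * threshold k ≤
    (((2 ^ (k + 2) : ℕ) : ℝ) - 1) * threshold (k + 1) := by
  have h1 : (2 : ℝ) ^ k * (1 / 2) ^ k = 1 := by rw [← mul_pow]; norm_num
  have h2 : (0 : ℝ) < (1 / 2) ^ k := by positivity
  rw [threshold, threshold]
  push_cast
  ring_nf at h1 h2 ⊢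
  nlinarith

/-- `t` lists guesses at level `k` that catch every sequence blocking each continuation of a
cylinder in which `A` has small density. -/
def Catches (F m : ℕ → ℕ) (A : Set Cantor) (k : ℕ) {M : ℕ} (t : Fin M → Cantor) : Prop :=
  ∀ v x : Cantor, haar.real (A ∩ cyl v (F k)) < threshold k * haar.real (cyl v (F k)) →
    (∀ w ∈ cyl v (F k), quad (F k) (m k) (w + x) = 0 →
      threshold (k + 1) * haar.real (cyl w (F (k + 1))) ≤ haar.real (A ∩ cyl w (F (k + 1)))) →
    ∃ i, EqOn x (t i) (Ico (F k) (F k + m k))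

lemma exists_add_notMem {F m : ℕ → ℕ} (hF : ∀ k, F k + 2 * m k < F (k + 1)) {A : Set Cantor}
    (hA : haar.real A < 1 / 2 * haar.real univ) {a b : ℕ} (hab : a ≤ b)
    (hdep : DependsOn (· ∈ A) (Iio (F b))) {M : ℕ → ℕ} {t : ∀ k, Fin (M k) → Cantor}
    (ht : ∀ k ∈ Ico a b, Catches F m A k (t k)) {x : Cantor}
    (hx : ∀ k ∈ Ico a b, ∀ i, ¬ EqOn x (t k i) (Ico (F k) (F k + m k))) :
    ∃ e : Cantor, (∀ k ∈ Ico a b, quad (F k) (m k) e = 0) ∧ x + e ∉ A := by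
  have hFm : StrictMono F := strictMono_nat_of_lt_succ fun k => by have := hF k; omega
  have key : ∀ c, a ≤ c → c ≤ b → ∃ v : Cantor,
      haar.real (A ∩ cyl v (F c)) < threshold c * haar.real (cyl v (F c)) ∧
      ∀ k ∈ Ico a c, quad (F k) (m k) (v + x) = 0 := by
    intro c hac
    induction c, hac using Nat.le_induction with
    | base =>
      intro _
      by_contra! h
      have := mul_measureReal_le_of_cyl (A := A) (B := univ) (n := F a) (ρ := threshold a)
        (fun _ _ _ => rfl) fun v _ => by
          by_contra! hv
          obtain ⟨k, hk, -⟩ := h v hv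
          exact absurd hk.2 (not_lt.2 hk.1)
      rw [inter_univ] at this
      have := mul_le_mul_of_nonneg_right (half_le_threshold a)
        (measureReal_nonneg (μ := haar) (s := univ))
      linarith
    | succ c hac ih =>
      intro hcb
      obtain ⟨v, hv, hvq⟩ := ih (by omega)
      by_contra! h
      obtain ⟨i, hi⟩ := ht c ⟨hac, hcb⟩ v x hv fun w hw hwq => by
        by_contra! hlt
        obtain ⟨k, hk, hkq⟩ := h w hlt
        refine hkq ?_
        rcases Nat.lt_succ_iff_lt_or_eq.1 hk.2 with hkc | rfl
        · rw [← hvq k ⟨hk.1, hkc⟩]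
          refine dependsOn_quad _ _ fun l hl => ?_
          have h1 := hF k
          have h2 := hFm.monotone (show k + 1 ≤ c from hkc)
          have h3 := hl.2
          rw [Pi.add_apply, Pi.add_apply, hw (mem_Iio.2 (by omega))]
        · exact hwq
      exact hx c ⟨hac, hcb⟩ i hi
  obtain ⟨v, hv, hvq⟩ := key b hab le_rfl
  refine ⟨v + x, hvq, ?_⟩
  rw [add_comm v, ← add_assoc, add_self_eq_zero, zero_add]
  intro hvA
  have : cyl v (F b) ⊆ A := fun w hw => (hdep hw).mpr hvA
  rw [inter_eq_right.2 this] at hv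
  have := mul_le_mul_of_nonneg_right (threshold_lt_one b).le
    (measureReal_nonneg (μ := haar) (s := cyl v (F b)))
  linarith

lemma memE_forall_quad_eq_zero {F m : ℕ → ℕ} (hF : ∀ k, F k + 2 * m k < F (k + 1)) :
    MemE {w : Cantor | ∀ k, quad (F k) (m k) w = 0} := by
  have hFm : StrictMono F := strictMono_nat_of_lt_succ fun k => by have := hF k; omega
  let B : ℕ → Set Cantor := fun n => {w | ∀ k < n, quad (F k) (m k) w = 0}
  have hdep : ∀ n, DependsOn (· ∈ B n) (Iio (F n)) := fun n x y hxy => by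
    have : ∀ k < n, quad (F k) (m k) x = quad (F k) (m k) y := fun k hk =>
      dependsOn_quad _ _ fun l hl => hxy l (mem_Iio.2 (by
        have h1 := hF k
        have h2 : F (k + 1) ≤ F n := hFm.monotone hk
        have h3 := hl.2
        omega))
    exact propext (forall₂_congr fun k hk => by rw [this k hk])
  have hhalf : ∀ n, haar (B (n + 1)) ≤ 2⁻¹ * haar (B n) := fun n => by
    let e : Cantor := Pi.single (F n + 2 * m n) 1
    have hdisj : Disjoint (B (n + 1)) ((e + ·) ⁻¹' B (n + 1)) := by
      refine disjoint_left.2 fun w hw hw' => ?_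
      have h := hw' n n.lt_succ_self
      simp only [add_comm e w] at h
      rw [quad_add_single_last, hw n n.lt_succ_self] at h
      exact absurd h (by decide)
    have hsub : B (n + 1) ∪ (e + ·) ⁻¹' B (n + 1) ⊆ B n := by
      refine union_subset (fun w hw k hk => hw k (by omega)) fun w hw => ?_
      have : e + w ∈ B n := fun k hk => hw k (by omega)
      refine (hdep n fun l hl => ?_).mp this
      rw [mem_Iio] at hl
      change (Pi.single (F n + 2 * m n) 1 : Cantor) l + w l = w l
      rw [Pi.single_eq_of_ne (by omega), zero_add]
    have h := measure_mono (μ := haar) hsub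
    rw [measure_union hdisj ((measurableSet_of_dependsOn (hdep _)).preimage
      (measurable_const_add e)), measure_preimage_add, ← two_mul] at h
    exact (ENNReal.mul_le_iff_le_inv two_ne_zero ENNReal.ofNat_ne_top).1 h
  have hpow : ∀ n, haar (B n) ≤ 2⁻¹ ^ n * haar univ := fun n => by
    induction n with
    | zero => simpa using measure_mono (subset_univ (B 0))
    | succ n ih =>
      rw [pow_succ', mul_assoc]
      exact (hhalf n).trans (mul_le_mul_right ih _)
  refine ⟨_, Subset.rfl, ?_, fun _ => {w | ∀ k, quad (F k) (m k) w = 0}, fun _ => ?_,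
    (iUnion_const _).symm⟩
  · have hlim : Tendsto (fun n : ℕ => (2⁻¹ : ℝ≥0∞) ^ n * haar univ) atTop (𝓝 (0 * haar univ)) :=
      ENNReal.Tendsto.mul_const (ENNReal.tendsto_pow_atTop_nhds_zero_of_lt_one
        (by simp)) (Or.inr (measure_ne_top _ _))
    rw [zero_mul] at hlim
    refine le_antisymm (ge_of_tendsto' hlim fun n => ?_) zero_le
    have hsub : {w : Cantor | ∀ k, quad (F k) (m k) w = 0} ⊆ B n := fun w hw k _ => hw k
    exact (measure_mono hsub).trans (hpow n)
  · rw [ofPred_forall]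
    exact isClosed_iInter fun k => isClosed_eq (continuous_quad _ _) continuous_const

theorem blockGuessable_of_memE_add {X : Set Cantor}
    (hX : ∀ E : Set Cantor, MemE E → MemE (X + E)) : BlockGuessable X := by
  intro f hf
  let a : ℕ → ℕ := fun k => Nat.rec 0 (fun k b => 2 * f (b + 2 ^ f b * 2 ^ (k + 2)) + 1) k
  let F : ℕ → ℕ := fun k => f (a k)
  let M : ℕ → ℕ := fun k => 2 ^ F k * 2 ^ (k + 2)
  let m : ℕ → ℕ := fun k => f (a k + M k) - f (a k)
  have ha : ∀ k, a (k + 1) = 2 * f (a k + M k) + 1 := fun k => rfl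
  have haM : ∀ k, a k + M k < a (k + 1) := fun k => by
    have := hf.le_apply (x := a k + M k)
    rw [ha]; omega
  have ham : StrictMono a := strictMono_nat_of_lt_succ fun k => by have := haM k; omega
  have hfM : ∀ k, f (a k) ≤ f (a k + M k) := fun k => hf.monotone (Nat.le_add_right _ _)
  have hm : ∀ k, F k + m k = f (a k + M k) := fun k => Nat.add_sub_cancel' (hfM k)
  have hF : ∀ k, F k + 2 * m k < F (k + 1) := fun k => by
    have h1 : a (k + 1) ≤ F (k + 1) := hf.le_apply
    have h2 := hm k
    have h3 := ha k
    omega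
  have hFm : StrictMono F := hf.comp ham
  obtain ⟨g, hg, hg0, A, hA, hAδ, hXA⟩ := MemE.exists_blocks (hX _ (memE_forall_quad_eq_zero hF))
    hFm (δ := fun _ => 4⁻¹ * haar univ) fun _ => by simp [pos_iff_ne_zero, NeZero.ne]
  have hpos : 0 < haar.real univ := by
    rw [measureReal_def]
    exact ENNReal.toReal_pos (NeZero.ne _) (measure_ne_top _ _)
  have hAhalf : ∀ n, haar.real (A n) < 1 / 2 * haar.real univ := fun n => by
    have := ENNReal.toReal_mono (by finiteness) (hAδ n)
    rw [ENNReal.toReal_mul, ← measureReal_def, ← measureReal_def] at this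
    norm_num at this
    linarith
  have hguess : ∀ k, ∃ t : Fin (M k) → Cantor, ∀ n, k ∈ Ico (g n) (g (n + 1)) →
      Catches F m (A n) k t := fun k => by
    obtain ⟨n, hn⟩ := exists_block hg hg0 k
    obtain ⟨t, ht⟩ := exists_guess (hF k) (by positivity) (A n)
      (by linarith [half_le_threshold (k + 1)]) (mul_threshold_le k)
    refine ⟨t, fun n' hn' => ?_⟩
    rw [block_unique hg hn' hn]
    exact ht
  choose t ht using hguess
  have hz : ∀ l, ∃ u : Cantor, ∀ k (i : Fin (M k)), a k + i = l → u = t k i := fun l => by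
    by_cases h : ∃ k, ∃ i : Fin (M k), a k + i = l
    · obtain ⟨k, i, hl⟩ := h
      refine ⟨t k i, fun k' i' hl' => ?_⟩
      have h1 := haM k
      have h2 := haM k'
      have h3 := i.2
      have h4 := i'.2
      obtain rfl := block_unique ham (n := l) (k := k) (l := k') ⟨by omega, by omega⟩
        ⟨by omega, by omega⟩
      rw [show i = i' from Fin.ext (by omega)]
    · exact ⟨0, fun k i hl => absurd ⟨k, i, hl⟩ h⟩
  choose z hz using hz
  obtain ⟨y, hy⟩ := exists_blockwise hf z
  refine ⟨a ∘ g, ham.comp hg, by simp only [Function.comp, hg0]; rfl, y, fun x hx => ?_⟩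
  have hloc : ∀ n, ∃ e : Cantor, (∀ k ∈ Ico (g n) (g (n + 1)), quad (F k) (m k) e = 0) ∧
      ((∃ k ∈ Ico (g n) (g (n + 1)), ∃ i, EqOn x (t k i) (Ico (F k) (F k + m k))) ∨
        x + e ∉ A n) := fun n => by
    by_cases h : ∃ k ∈ Ico (g n) (g (n + 1)), ∃ i, EqOn x (t k i) (Ico (F k) (F k + m k))
    · exact ⟨0, fun k _ => quad_zero _ _, Or.inl h⟩
    · push Not at h
      obtain ⟨e, he, hxe⟩ := exists_add_notMem hF (hAhalf n) (hg n.lt_succ_self).le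
        (fun u v huv => hA n fun i hi => huv i hi.2) (fun k hk => ht k n hk) h
      exact ⟨e, he, Or.inr hxe⟩
  choose e he hxe using hloc
  obtain ⟨u, hu⟩ := exists_blockwise (hFm.comp hg) e
  have huE : ∀ k, quad (F k) (m k) u = 0 := fun k => by
    obtain ⟨n, hn⟩ := exists_block hg hg0 k
    rw [← he n k hn]
    refine dependsOn_quad _ _ fun i hi => hu n ⟨(hFm.monotone hn.1).trans hi.1, ?_⟩
    have h1 := hF k
    have h2 : F (k + 1) ≤ F (g (n + 1)) := hFm.monotone hn.2
    have h3 := hi.2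
    simp only [Function.comp_apply]
    omega
  filter_upwards [hXA _ (add_mem_add hx huE)] with n hn
  have hn' : x + e n ∈ A n := (hA n fun i hi => by
    rw [Pi.add_apply, Pi.add_apply, hu n hi]).mp hn
  obtain ⟨k, hk, i, hi⟩ := (hxe n).resolve_right (not_not.2 hn')
  have hlt := haM k
  have hik := i.2
  refine ⟨a k + i, ⟨(ham.monotone hk.1).trans (Nat.le_add_right _ _), ?_⟩, ?_⟩
  · have : a (k + 1) ≤ a (g (n + 1)) := ham.monotone hk.2
    simp only [Function.comp_apply]
    omega
  · have hsub : Ico (f (a k + i)) (f (a k + i + 1)) ⊆ Ico (F k) (F k + m k) := by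
      rw [hm]
      exact Ico_subset_Ico (hf.monotone (Nat.le_add_right _ _)) (hf.monotone (by omega))
    have := hy (a k + i)
    rw [hz _ k i rfl] at this
    exact (hi.mono hsub).trans this.symm

end CantorAdd

/-- For `X ⊆ 2^ℕ` the following are equivalent: (i) `X` has sharp measure zero;
(ii) `X` is `𝔈`-additive; (iii) `X` is sharply `𝔈`-additive. Consequently, `X` is
meager-additive iff it is `𝔈`-additive. -/
theorem stmt11 (X : Set Cantor) :
    (IsSSMZ X ↔ ∀ E : Set Cantor, MemE E → MemE (X + E)) ∧
    (IsSSMZ X ↔ ∀ E : Set Cantor, MemE E →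
        ∃ F : Set Cantor, IsSigmaCompact F ∧ X ⊆ F ∧ MemE (F + E)) ∧
    ((∀ M : Set Cantor, IsMeagre M → IsMeagre (X + M)) ↔
      ∀ E : Set Cantor, MemE E → MemE (X + E)) := by
  have hE : IsSSMZ X ↔ ∀ E : Set Cantor, MemE E → MemE (X + E) := by
    refine ⟨fun h E hE => ?_, fun h => (CantorAdd.blockGuessable_of_memE_add h).isSSMZ⟩
    obtain ⟨F, -, hXF, hFE⟩ := (CantorAdd.IsSSMZ.blockGuessable h).exists_isSigmaCompact hE
    exact CantorAdd.MemE.mono hFE (add_subset_add_right hXF)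
  refine ⟨hE, ⟨fun h E => (CantorAdd.IsSSMZ.blockGuessable h).exists_isSigmaCompact,
    fun h => hE.2 fun E hEE => ?_⟩, fun h => hE.1 ?_, fun h M hM => ?_⟩
  · obtain ⟨F, -, hXF, hFE⟩ := h E hEE
    exact CantorAdd.MemE.mono hFE (add_subset_add_right hXF)
  · exact (CantorAdd.blockGuessable_of_isMeagre_add h).isSSMZ
  · exact (CantorAdd.blockGuessable_of_memE_add h).isMeagre_add hM
end

section
/- If f : 2^ℕ → 2^ℕ is a continuous mapping and X ⊆ 2^ℕ is meager-additive, then f(X) is meager-additive. -/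
open Pointwise

namespace Cantor

/-- `x` and `y` coincide on the interval `[a, b)`. -/
def AgreeOn (x y : Cantor) (a b : ℕ) : Prop := ∀ i, a ≤ i → i < b → x i = y i

/-- The points that agree with `y` on only finitely many of the intervals `[g n, g (n + 1))`. -/
def eventuallyDisagree (g : ℕ → ℕ) (y : Cantor) : Set Cantor :=
  {x | ∃ N, ∀ n, N ≤ n → ¬ AgreeOn x y (g n) (g (n + 1))}

/-- The combinatorial form of meager-additivity: every interval partition has a coarsening `p`
and a point `y` that each `x ∈ X` matches on some interval of almost every coarse block. -/
def BlockMatching (X : Set Cantor) : Prop :=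
  ∀ g : ℕ → ℕ, StrictMono g → ∃ p : ℕ → ℕ, StrictMono p ∧ ∃ y : Cantor, ∀ x ∈ X, ∃ N, ∀ n, N ≤ n →
    ∃ k, p n ≤ k ∧ k < p (n + 1) ∧ AgreeOn x y (g k) (g (k + 1))

theorem eq_of_mem_blocks {g : ℕ → ℕ} (hg : StrictMono g) {k l i : ℕ} (hk : g k ≤ i)
    (hk' : i < g (k + 1)) (hl : g l ≤ i) (hl' : i < g (l + 1)) : k = l := by
  have h₁ := hg.lt_iff_lt.1 (hk.trans_lt hl')
  have h₂ := hg.lt_iff_lt.1 (hl.trans_lt hk')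
  omega

theorem exists_glue {α : Type*} [Nonempty α] {g : ℕ → ℕ} (hg : StrictMono g) (z : ℕ → ℕ → α) :
    ∃ y : ℕ → α, ∀ k i, g k ≤ i → i < g (k + 1) → y i = z k i := by
  classical
  refine ⟨fun i => if h : ∃ k, g k ≤ i ∧ i < g (k + 1) then z h.choose i
    else Classical.arbitrary α, fun k i h₁ h₂ => ?_⟩
  have h : ∃ k, g k ≤ i ∧ i < g (k + 1) := ⟨k, h₁, h₂⟩
  simp only [dif_pos h]
  rw [eq_of_mem_blocks hg h.choose_spec.1 h.choose_spec.2 h₁ h₂]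

theorem exists_agreeOn_subset {U : Set Cantor} (hU : IsOpen U) {x : Cantor} (hx : x ∈ U) :
    ∃ n, ∀ z, AgreeOn z x 0 n → z ∈ U := by
  obtain ⟨v, ⟨y, n, rfl⟩, hxv, hvU⟩ :=
    (PiNat.isTopologicalBasis_cylinders fun _ : ℕ => ZMod 2).exists_subset_of_mem_open hx hU
  rw [← PiNat.mem_cylinder_iff_eq.1 hxv] at hvU
  exact ⟨n, fun z hz => hvU fun i hi => hz i i.zero_le hi⟩

theorem isOpen_setOf_agreeOn (y : Cantor) (a b : ℕ) : IsOpen {x | AgreeOn x y a b} := by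
  rw [PiNat.isOpen_iff_dist]
  intro x hx
  refine ⟨(1 / 2) ^ b, by positivity, fun z hz i hai hib => ?_⟩
  rw [← PiNat.apply_eq_of_dist_lt hz hib.le]
  exact hx i hai hib

theorem isMeagre_eventuallyDisagree {g : ℕ → ℕ} (hg : StrictMono g) (y : Cantor) :
    IsMeagre (eventuallyDisagree g y) := by
  let U : ℕ → Set Cantor := fun N => ⋃ n, ⋃ (_ : N ≤ n), {x | AgreeOn x y (g n) (g (n + 1))}
  have hU : ∀ N, U N ∈ residual Cantor := by
    refine fun N => residual_of_dense_open
      (isOpen_iUnion fun n => isOpen_iUnion fun _ => isOpen_setOf_agreeOn _ _ _) ?_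
    rw [dense_iff_inter_open]
    rintro V hV ⟨x, hx⟩
    obtain ⟨L, hL⟩ := exists_agreeOn_subset hV hx
    let n := max L N
    have hn : L ≤ g n := (le_max_left L N).trans hg.le_apply
    refine ⟨fun i => if i < g n then x i else y i, hL _ fun i _ hi => ?_, ?_⟩
    · exact if_pos (hi.trans_le hn)
    · simp only [U, Set.mem_iUnion]
      exact ⟨n, le_max_right L N, fun i hi _ => if_neg hi.not_gt⟩
  refine Filter.mem_of_superset (countable_iInter_mem.2 hU) fun x hx => ?_
  rintro ⟨N, hN⟩
  have hxN := Set.mem_iInter.1 hx N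
  simp only [U, Set.mem_iUnion] at hxN
  obtain ⟨n, hn, h⟩ := hxN
  exact hN n hn h

/-- Some finite pattern placed after position `N` forces membership in a given dense open set. -/
theorem exists_forcing_pattern {U : Set Cantor} (hUo : IsOpen U) (hUd : Dense U) (N : ℕ) :
    ∃ N', N < N' ∧ ∃ y : Cantor, ∀ x, AgreeOn x y N N' → x ∈ U := by
  let e : (Fin N → ZMod 2) → Cantor := fun s i => if h : i < N then s ⟨i, h⟩ else 0
  let W : (Fin N → ZMod 2) → Set Cantor := fun s => Homeomorph.addRight (e s) ⁻¹' U
  have hWo : ∀ s, IsOpen (W s) := fun s => hUo.preimage (Homeomorph.addRight (e s)).continuous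
  have hWd : ∀ s, Dense (W s) := fun s =>
    hUd.preimage (Homeomorph.addRight (e s)).isOpenMap
  obtain ⟨y, hy⟩ := (dense_iInter_of_isOpen hWo hWd).nonempty
  obtain ⟨n, hn⟩ := exists_agreeOn_subset (isOpen_iInter_of_finite hWo) hy
  refine ⟨max n (N + 1), by omega, y, fun x hx => ?_⟩
  let s : Fin N → ZMod 2 := fun i => x i - y i
  have h := Set.mem_iInter.1 (hn (x - e s) fun i _ hi => ?_) s
  · simpa [W] using h
  · by_cases hiN : i < N
    · simp [e, s, hiN]
    · simpa [e, hiN] using hx i (by omega) (by omega)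

theorem exists_eventuallyDisagree_of_isMeagre {M : Set Cantor} (hM : IsMeagre M) :
    ∃ g : ℕ → ℕ, StrictMono g ∧ ∃ y, M ⊆ eventuallyDisagree g y := by
  obtain ⟨S, hSo, hSd, hSc, hSM⟩ := mem_residual_iff.1 hM
  obtain ⟨V, hV⟩ := (hSc.insert Set.univ).exists_eq_range (Set.insert_nonempty _ _)
  have hVS : ∀ n, V n = Set.univ ∨ V n ∈ S := fun n => by
    have : V n ∈ insert Set.univ S := hV ▸ Set.mem_range_self n
    simpa using this
  have hVo : ∀ n, IsOpen (V n) := fun n =>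
    (hVS n).elim (fun h => h ▸ isOpen_univ) (hSo _)
  have hVd : ∀ n, Dense (V n) := fun n =>
    (hVS n).elim (fun h => h ▸ dense_univ) (hSd _)
  let U : ℕ → Set Cantor := fun n => ⋂ i : Fin (n + 1), V i
  have hUo : ∀ n, IsOpen (U n) := fun n => isOpen_iInter_of_finite fun i => hVo i
  have hUd : ∀ n, Dense (U n) := fun n => dense_iInter_of_isOpen (fun i => hVo i) fun i => hVd i
  choose next hnext pat hpat using fun n N => exists_forcing_pattern (hUo n) (hUd n) N
  let g : ℕ → ℕ := fun n => Nat.rec 0 (fun k N => next k N) n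
  have hg : StrictMono g := strictMono_nat_of_lt_succ fun n => hnext n (g n)
  obtain ⟨y, hy⟩ := exists_glue hg fun n => pat n (g n)
  refine ⟨g, hg, y, fun x hxM => ?_⟩
  by_contra hx
  refine hSM (Set.mem_sInter.2 fun t ht => ?_) hxM
  obtain ⟨m, rfl⟩ : t ∈ Set.range V := hV ▸ Set.mem_insert_of_mem _ ht
  simp only [eventuallyDisagree, Set.mem_ofPred_eq, not_exists, not_forall, not_not] at hx
  obtain ⟨n, hmn, hn⟩ := hx m
  have hxU : x ∈ U n := hpat n (g n) x fun i h₁ h₂ => (hn i h₁ h₂).trans (hy n i h₁ h₂)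
  exact Set.mem_iInter.1 hxU ⟨m, by omega⟩

theorem isMeagre_add_of_blockMatching {X : Set Cantor} (hX : BlockMatching X) {M : Set Cantor}
    (hM : IsMeagre M) : IsMeagre (X + M) := by
  obtain ⟨g, hg, z, hMz⟩ := exists_eventuallyDisagree_of_isMeagre hM
  obtain ⟨p, hp, y, hy⟩ := hX g hg
  refine (isMeagre_eventuallyDisagree (hg.comp hp) (y + z)).mono ?_
  rintro _ ⟨x, hx, m, hm, rfl⟩
  obtain ⟨N₁, h₁⟩ := hy x hx
  obtain ⟨N₂, h₂⟩ := hMz hm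
  refine ⟨max N₁ N₂, fun n hn hagree => ?_⟩
  obtain ⟨k, hpk, hkp, hk⟩ := h₁ n (by omega)
  have hNp : n ≤ p n := hp.le_apply
  refine h₂ k (by omega) fun i hi hi' => ?_
  have h := hagree i ((hg.monotone hpk).trans hi) (hi'.trans_le (hg.monotone hkp))
  simpa [hk i hi hi'] using h

theorem blockMatching_of_isMeagre_add {X : Set Cantor}
    (hX : ∀ M : Set Cantor, IsMeagre M → IsMeagre (X + M)) : BlockMatching X := by
  classical
  intro g hg
  obtain ⟨q, hq, y, hy⟩ :=
    exists_eventuallyDisagree_of_isMeagre (hX _ (isMeagre_eventuallyDisagree hg 0))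
  let p : ℕ → ℕ := fun n => Nat.rec 0 (fun _ k => q (g k + 1)) n
  have hsucc : ∀ n, p (n + 1) = q (g (p n) + 1) := fun _ => rfl
  have hp : StrictMono p := strictMono_nat_of_lt_succ fun n => by
    have h₁ : p n ≤ g (p n) := hg.le_apply
    have h₂ : g (p n) + 1 ≤ q (g (p n) + 1) := hq.le_apply
    rw [hsucc]
    omega
  refine ⟨p, hp, y, fun x hx => ?_⟩
  by_contra! hbad
  let Bad : ℕ → Prop := fun n => ∀ k, p n ≤ k → k < p (n + 1) → ¬ AgreeOn x y (g k) (g (k + 1))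
  let m : Cantor := fun i =>
    if ∃ n, Bad n ∧ g (p n) ≤ i ∧ i < g (p (n + 1)) then y i - x i else 1
  have hm : m ∈ eventuallyDisagree g 0 := by
    refine ⟨0, fun k _ hk => ?_⟩
    rcases Classical.em (∃ n, Bad n ∧ p n ≤ k ∧ k < p (n + 1)) with ⟨n, hn, hpk, hkp⟩ | h
    · refine hn k hpk hkp fun i hi hi' => ?_
      have hmi := hk i hi hi'
      have hblock : ∃ n, Bad n ∧ g (p n) ≤ i ∧ i < g (p (n + 1)) :=
        ⟨n, hn, (hg.monotone hpk).trans hi, hi'.trans_le (hg.monotone hkp)⟩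
      simp only [m, if_pos hblock] at hmi
      exact (sub_eq_zero.1 hmi).symm
    · have hmi := hk (g k) le_rfl (hg k.lt_succ_self)
      have hblock : ¬ ∃ n, Bad n ∧ g (p n) ≤ g k ∧ g k < g (p (n + 1)) := by
        simpa only [hg.le_iff_le, hg.lt_iff_lt] using h
      simp only [m, if_neg hblock] at hmi
      exact one_ne_zero hmi
  obtain ⟨N, hN⟩ := hy (Set.add_mem_add hx hm)
  obtain ⟨n, hNn, hn⟩ := hbad N
  have hnp : n ≤ p n := hp.le_apply
  have hpg : p n ≤ g (p n) := hg.le_apply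
  refine hN (g (p n)) (by omega) fun i hi hi' => ?_
  have hblock : ∃ n, Bad n ∧ g (p n) ≤ i ∧ i < g (p (n + 1)) :=
    ⟨n, hn, hq.le_apply.trans hi, hi'.trans_le (by rw [← hsucc]; exact hg.le_apply)⟩
  simp only [Pi.add_apply, m, if_pos hblock]
  ring

theorem exists_modulus {f : Cantor → Cantor} (hf : Continuous f) (m : ℕ) :
    ∃ h, ∀ x x', AgreeOn x x' 0 h → AgreeOn (f x) (f x') 0 m := by
  have key : ∀ x, ∃ n, ∀ z, AgreeOn z x 0 n → AgreeOn (f z) (f x) 0 m := fun x =>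
    exists_agreeOn_subset ((isOpen_setOf_agreeOn (f x) 0 m).preimage hf)
      (show AgreeOn (f x) (f x) 0 m from fun _ _ _ => rfl)
  choose n hn using key
  obtain ⟨t, ht⟩ := CompactSpace.elim_nhds_subcover (fun x => {z | AgreeOn z x 0 (n x)})
    fun x => (isOpen_setOf_agreeOn x 0 (n x)).mem_nhds fun _ _ _ => rfl
  refine ⟨t.sup n, fun x x' hxx' => ?_⟩
  have hx' : x' ∈ ⋃ c ∈ t, {z | AgreeOn z c 0 (n c)} := ht ▸ Set.mem_univ x'
  simp only [Set.mem_iUnion] at hx'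
  obtain ⟨c, hct, hc⟩ := hx'
  have hxc : AgreeOn x c 0 (n c) := fun i hi hi' =>
    (hxx' i hi (hi'.trans_le (Finset.le_sup hct))).trans (hc i hi hi')
  exact fun i hi hi' => (hn c x hxc i hi hi').trans (hn c x' hc i hi hi').symm

theorem BlockMatching.image {X : Set Cantor} (hX : BlockMatching X) {f : Cantor → Cantor}
    (hf : Continuous f) : BlockMatching (f '' X) := by
  intro g hg
  choose h hh using exists_modulus hf
  -- Block `j` of `K` has one interval of `g` for each of the `2 ^ F j` prefixes of length `F j`.
  let KF : ℕ → ℕ × ℕ := fun j => Nat.rec (0, 0)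
    (fun _ a => (a.1 + 2 ^ a.2, a.2 + 1 + h (g (a.1 + 2 ^ a.2)))) j
  let K : ℕ → ℕ := fun j => (KF j).1
  let F : ℕ → ℕ := fun j => (KF j).2
  have hKsucc : ∀ j, K (j + 1) = K j + 2 ^ F j := fun _ => rfl
  have hFsucc : ∀ j, F (j + 1) = F j + 1 + h (g (K (j + 1))) := fun _ => rfl
  have hK : StrictMono K := strictMono_nat_of_lt_succ fun j => by
    rw [hKsucc]; exact Nat.lt_add_of_pos_right (by positivity)
  have hF : StrictMono F := strictMono_nat_of_lt_succ fun j => by rw [hFsucc]; omega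
  obtain ⟨p, hp, y, hy⟩ := hX F hF
  have hcard : ∀ j, Fintype.card (Fin (F j) → ZMod 2) = 2 ^ F j := fun j => by simp
  let e : ∀ j, (Fin (F j) → ZMod 2) ≃ Fin (2 ^ F j) := fun j => Fintype.equivFinOfCardEq (hcard j)
  let extend : ∀ j, (Fin (F j) → ZMod 2) → Cantor := fun j s i =>
    if hi : i < F j then s ⟨i, hi⟩ else y i
  obtain ⟨w, hw⟩ := exists_glue hK fun j k =>
    if hk : k - K j < 2 ^ F j then extend j ((e j).symm ⟨k - K j, hk⟩) else 0
  obtain ⟨y', hy'⟩ := exists_glue hg fun k => f (w k)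
  refine ⟨K ∘ p, hK.comp hp, y', ?_⟩
  rintro _ ⟨x, hx, rfl⟩
  obtain ⟨N, hN⟩ := hy x hx
  refine ⟨N, fun n hn => ?_⟩
  obtain ⟨j, hpj, hjp, hj⟩ := hN n hn
  let s : Fin (F j) → ZMod 2 := fun i => x i
  let k := K j + e j s
  have hk : k < K (j + 1) := by rw [hKsucc]; exact Nat.add_lt_add_left (e j s).isLt _
  have hwk : w k = extend j s := by
    rw [hw j k (Nat.le_add_right _ _) hk]
    simp [k]
  have hxw : AgreeOn x (w k) 0 (h (g (K (j + 1)))) := fun i _ hi => by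
    by_cases hiF : i < F j
    · simp [hwk, extend, hiF, s]
    · simpa [hwk, extend, hiF] using hj i (by omega) (by rw [hFsucc]; omega)
  refine ⟨k, (hK.monotone hpj).trans (Nat.le_add_right _ _), hk.trans_le (hK.monotone hjp),
    fun i hi hi' => ?_⟩
  rw [hy' k i hi hi']
  exact hh _ _ _ hxw i i.zero_le (hi'.trans_le (hg.monotone hk))

end Cantor

/-- If `f : 2^ℕ → 2^ℕ` is continuous and `X ⊆ 2^ℕ` is meager-additive, then `f '' X` is
meager-additive. -/
theorem stmt12 (f : Cantor → Cantor) (hf : Continuous f) (X : Set Cantor)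
    (hX : ∀ M : Set Cantor, IsMeagre M → IsMeagre (X + M)) :
    ∀ M : Set Cantor, IsMeagre M → IsMeagre (f '' X + M) := by
  exact fun _ hM => Cantor.isMeagre_add_of_blockMatching
    ((Cantor.blockMatching_of_isMeagre_add hX).image hf) hM
end
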